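/- arXiv:2412.11879 — 4 statements merged into one kernel-verified Lean document; each statement's English description precedes it below -/
import Mathlib

section
/- There exists a function F : ℂ → ℂ, meromorphic on all of ℂ, with F(s) = ∫_{[0,1]²} ζ(1−s, x₁)·ζ(1−s, x₂)·ζ(1−s, −x₁−2x₂)·ζ(1−s, −x₁−x₂) dx₁ dx₂ for every s with Re(s) > 1, such that for every positive integer m the limit lim_{s→−m} (s+m)² · F(s) exists and lies in the ℚ-linear span of the set of complex numbers { ζ(4m+2, t) : t ∈ {1, 1/2} } ∪ { ζ(a,t₁)·ζ(b,t₂) : a, b integers with a ≥ m+1, b ≥ m+1, a+b = 4m+2, and t₁, t₂ ∈ {1, 1/2} }, where for an integer w ≥ 2 and real t > 0, ζ(w,t) := Σ_{k=0}^∞ (k+t)^{−w}. -/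
open Complex MeasureTheory HurwitzZeta Filter

/-- The generalized binomial coefficient `s (s - 1) ⋯ (s - n + 1) / n!`. -/
noncomputable def binom (s : ℂ) (n : ℕ) : ℂ :=
  (∏ i ∈ Finset.range n, (s - i)) / n.factorial

lemma binom_eq_choose (s : ℂ) (n : ℕ) : binom s n = Ring.choose s n := by
  have h := Ring.descPochhammer_eq_factorial_smul_choose s n
  have h2 : (descPochhammer ℤ n).smeval s = ∏ i ∈ Finset.range n, (s - i) := by
    induction n with
    | zero => simp
    | succ n ih =>
      rw [descPochhammer_succ_right, Polynomial.smeval_mul, Finset.prod_range_succ,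
        ih (Ring.descPochhammer_eq_factorial_smul_choose s n)]
      simp [Polynomial.smeval_natCast]
  rw [h2, nsmul_eq_mul] at h
  rw [binom, h, mul_div_cancel_left₀]
  exact_mod_cast n.factorial_ne_zero

lemma hasSum_binom (a x : ℂ) (hx : ‖x‖ < 1) :
    HasSum (fun n => binom a n * x ^ n) ((1 + x) ^ a) := by
  have h := (one_add_cpow_hasFPowerSeriesOnBall_zero (a := a)).hasSum
    (y := x) (by simpa [← ENNReal.ofReal_one, Metric.eball_ofReal] using hx)
  simpa [binom_eq_choose, binomialSeries, FormalMultilinearSeries.coeff_ofScalars, mul_comm]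
    using h

lemma differentiable_binom (n : ℕ) : Differentiable ℂ (fun s => binom s n) := by
  unfold binom; fun_prop

lemma norm_binom_le (N n : ℕ) (s : ℂ) (hs : ‖s‖ ≤ N + 1) :
    ‖binom s n‖ ≤ (n + N).choose N := by
  have h1 : ‖∏ i ∈ Finset.range n, (s - i)‖ ≤ ((N + 1).ascFactorial n : ℕ) := by
    rw [Nat.ascFactorial_eq_prod_range, norm_prod]
    push_cast
    refine Finset.prod_le_prod (fun _ _ => norm_nonneg _) fun i _ => ?_
    refine (norm_sub_le _ _).trans ?_
    simpa using hs
  rw [Nat.ascFactorial_eq_factorial_mul_choose] at h1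
  rw [binom, norm_div, Complex.norm_natCast, div_le_iff₀ (by positivity)]
  refine h1.trans (le_of_eq ?_)
  rw [add_comm n N, Nat.choose_symm_add]
  push_cast
  ring

lemma mul_binom_sub_one (s : ℂ) (n : ℕ) :
    s * binom (s - 1) n = -(binom s n * (n - s)) := by
  have h : s * ∏ i ∈ Finset.range n, (s - 1 - i) = (∏ i ∈ Finset.range n, (s - i)) * (s - n) := by
    rw [← Finset.prod_range_succ, Finset.prod_range_succ', mul_comm]
    simp [sub_sub, add_comm]
  unfold binom
  rw [← mul_div_assoc, h]
  ring

lemma exists_rat_binom (q : ℚ) (n : ℕ) : ∃ r : ℚ, binom q n = r :=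
  ⟨(∏ i ∈ Finset.range n, (q - i)) / n.factorial, by simp [binom]⟩

lemma summable_choose_mul_pow (N : ℕ) {x : ℝ} (h0 : 0 ≤ x) (h1 : x < 1) :
    Summable fun n : ℕ => ((n + N).choose N : ℝ) * x ^ n :=
  summable_choose_mul_geometric_of_norm_lt_one N (by rwa [Real.norm_of_nonneg h0])

/-- The entire function `(w - 1) ζ(w, t)`. -/
noncomputable def hurwitzEntire (t : ℝ) : ℂ → ℂ :=
  Function.update (fun w => (w - 1) * hurwitzZeta t w) 1 1

lemma hurwitzEntire_of_ne (t : ℝ) {w : ℂ} (hw : w ≠ 1) :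
    hurwitzEntire t w = (w - 1) * hurwitzZeta t w := by
  simp [hurwitzEntire, hw]

lemma differentiable_hurwitzEntire (t : ℝ) : Differentiable ℂ (hurwitzEntire t) := by
  rw [← differentiableOn_univ,
    ← differentiableOn_compl_singleton_and_continuousAt_iff (c := 1) univ_mem]
  constructor
  · refine DifferentiableOn.congr (f := fun w => (w - 1) * hurwitzZeta t w) ?_ ?_
    · intro w hw
      have := differentiableAt_hurwitzZeta (t : UnitAddCircle) (s := w) (by simpa using hw)
      exact ((differentiableAt_id.sub_const 1).mul this).differentiableWithinAt
    · intro w hw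
      exact hurwitzEntire_of_ne t (by simpa using hw)
  · exact continuousAt_update_same.2 (hurwitzZeta_residue_one t)

/-- The coefficient of `x ^ n` in the expansion of `s ζ(1 - s, t + x)`. -/
noncomputable def zetaCoeff (t : ℝ) (n : ℕ) (s : ℂ) : ℂ :=
  -(binom s n * hurwitzEntire t (1 - s + n))

lemma differentiable_zetaCoeff (t : ℝ) (n : ℕ) : Differentiable ℂ (zetaCoeff t n) := by
  unfold zetaCoeff
  exact ((differentiable_binom n).mul
    ((differentiable_hurwitzEntire t).comp (by fun_prop))).neg

lemma zetaCoeff_eq (t : ℝ) (n : ℕ) {s : ℂ} (hs : s ≠ n) :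
    zetaCoeff t n s = s * binom (s - 1) n * hurwitzZeta t (1 - s + n) := by
  rw [zetaCoeff, hurwitzEntire_of_ne, mul_binom_sub_one]
  · ring
  · intro h; apply hs; linear_combination -h

lemma exists_rat_zetaCoeff_neg (t : ℝ) (ht : t ∈ Set.Icc (0 : ℝ) 1) (m n : ℕ) (hm : 0 < m) :
    ∃ r : ℚ, zetaCoeff t n (-m) =
      r * ∑' k : ℕ, 1 / ((k : ℂ) + (t : ℝ)) ^ (m + 1 + n) := by
  obtain ⟨r, hr⟩ := exists_rat_binom (-m - 1) n
  refine ⟨-m * r, ?_⟩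
  have h1 : (1 - (-(m : ℂ)) + n) = ((m + 1 + n : ℕ) : ℂ) := by push_cast; ring
  have h2 : (-(m : ℂ)) ≠ n := by
    intro h
    have := congrArg Complex.re h
    simp at this
    have : (0 : ℝ) < m := by exact_mod_cast hm
    have : (0 : ℝ) ≤ n := by positivity
    linarith
  have h3 := hasSum_hurwitzZeta_of_one_lt_re ht (s := ((m + 1 + n : ℕ) : ℂ)) (by
    rw [natCast_re]; exact_mod_cast (by omega : 1 < m + 1 + n))
  rw [zetaCoeff_eq _ _ h2, h1, ← h3.tsum_eq]
  simp only [cpow_natCast]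
  push_cast at hr ⊢
  rw [hr]

lemma summable_one_div_add_sq (t : ℝ) : Summable fun k : ℕ => 1 / |(k : ℝ) + t| ^ (2 : ℝ) :=
  (Real.summable_one_div_nat_add_rpow t 2).2 (by norm_num)

lemma norm_hurwitzZeta_le {t : ℝ} (ht : 0 < t) (ht1 : t ≤ 1) (M : ℕ) {w : ℂ} (hw : 2 ≤ w.re)
    (hM : w.re ≤ M) :
    ‖hurwitzZeta t w‖ ≤ (1 / t) ^ M * ∑' k : ℕ, 1 / |(k : ℝ) + t| ^ (2 : ℝ) := by
  have h := hasSum_hurwitzZeta_of_one_lt_re (a := t) ⟨ht.le, ht1⟩ (s := w) (by linarith)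
  rw [← h.tsum_eq, ← tsum_mul_left]
  refine tsum_of_norm_bounded ((summable_one_div_add_sq t).mul_left _).hasSum fun k => ?_
  have hk : (0 : ℝ) < k + t := by positivity
  rw [norm_div, norm_one, ← ofReal_natCast, ← ofReal_add, norm_cpow_eq_rpow_re_of_pos hk,
    abs_of_pos hk]
  have e1 : ((k : ℝ) + t) ^ w.re = (k + t) ^ (2 : ℝ) * (k + t) ^ (w.re - 2) := by
    rw [← Real.rpow_add hk]; ring_nf
  have e2 : t ^ M ≤ ((k : ℝ) + t) ^ (w.re - 2) := by
    calc t ^ M = t ^ (M : ℝ) := (Real.rpow_natCast _ _).symm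
      _ ≤ t ^ (w.re - 2) := Real.rpow_le_rpow_of_exponent_ge ht ht1 (by linarith)
      _ ≤ _ := Real.rpow_le_rpow ht.le (by simp) (by linarith)
  rw [e1, ← one_div_mul_one_div, mul_comm, one_div_pow]
  gcongr

lemma exists_summable_bound_zetaCoeff {t : ℝ} (ht : 0 < t) (ht1 : t ≤ 1) {x : ℝ} (hx0 : 0 ≤ x)
    (hx : x < t) (R : ℝ) :
    ∃ u : ℕ → ℝ, Summable u ∧ ∀ n s, ‖s‖ ≤ R → ‖zetaCoeff t n s‖ * x ^ n ≤ u n := by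
  obtain ⟨N, hN⟩ := exists_nat_ge R
  have hB : ∀ n, ∃ B, ∀ s : ℂ, ‖s‖ ≤ R → ‖zetaCoeff t n s‖ ≤ B := fun n => by
    obtain ⟨B, hB⟩ := (isCompact_closedBall (0 : ℂ) R).exists_bound_of_continuousOn
      (differentiable_zetaCoeff t n).continuous.continuousOn
    exact ⟨B, fun s hs => hB s (by simpa using hs)⟩
  choose B hB using hB
  set S := ∑' k : ℕ, 1 / |(k : ℝ) + t| ^ (2 : ℝ)
  have hS : 0 ≤ S := tsum_nonneg fun k => by positivity
  let v : ℕ → ℝ := fun n => N * (1 / t) ^ (N + 1) * S * (((n + N).choose N : ℝ) * (x / t) ^ n)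
  have hv : Summable v :=
    (summable_choose_mul_pow N (by positivity) ((div_lt_one ht).2 hx)).mul_left _
  refine ⟨fun n => if n < N + 3 then B n * x ^ n else v n, ?_, fun n s hs => ?_⟩
  · refine hv.congr_cofinite ?_
    rw [Filter.EventuallyEq, Nat.cofinite_eq_atTop]
    filter_upwards [eventually_ge_atTop (N + 3)] with n hn
    simp [hn]
  · simp only
    split_ifs with hn
    · gcongr; exact hB n s hs
    · push Not at hn
      have hsN : ‖s‖ ≤ N := hs.trans hN
      have hre := (abs_le.1 ((abs_re_le_norm s).trans hsN))
      have hn' : (N : ℝ) + 3 ≤ n := by exact_mod_cast hn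
      rw [zetaCoeff_eq, norm_mul, norm_mul]
      · have h1 : ‖binom (s - 1) n‖ ≤ (n + N).choose N := norm_binom_le _ _ _
          ((norm_sub_le _ _).trans (by simpa using hsN))
        have h2 := norm_hurwitzZeta_le ht ht1 (n + (N + 1)) (w := 1 - s + n)
          (by simp; linarith) (by simp; linarith)
        calc _ ≤ (N : ℝ) * (n + N).choose N * ((1 / t) ^ (n + (N + 1)) * S) * x ^ n := by gcongr
          _ = v n := by simp only [v]; rw [pow_add, one_div_pow t n, div_pow x]; field_simp
      · rintro rfl
        simp at hre
        linarith

/-- The analytic continuation of `s ∑ k, (k + t + x) ^ (s - 1)`. -/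
noncomputable def zetaSeries (t x : ℝ) (s : ℂ) : ℂ := ∑' n : ℕ, zetaCoeff t n s * (x : ℂ) ^ n

lemma differentiable_zetaSeries {t : ℝ} (ht : 0 < t) (ht1 : t ≤ 1) {x : ℝ} (hx : |x| < t) :
    Differentiable ℂ (zetaSeries t x) := by
  intro s
  obtain ⟨u, hu, hb⟩ := exists_summable_bound_zetaCoeff ht ht1 (abs_nonneg x) hx (‖s‖ + 1)
  have h : DifferentiableOn ℂ (fun s => ∑' n : ℕ, zetaCoeff t n s * (x : ℂ) ^ n)
      (Metric.ball 0 (‖s‖ + 1)) := by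
    refine differentiableOn_tsum_of_summable_norm hu (fun n => ?_) Metric.isOpen_ball ?_
    · exact ((differentiable_zetaCoeff t n).mul_const _).differentiableOn
    · intro n w hw
      rw [norm_mul, norm_pow, norm_real]
      exact hb n w (by simpa using (mem_ball_zero_iff.1 hw).le)
  exact h.differentiableAt (Metric.isOpen_ball.mem_nhds (by simp))

lemma hasSum_zetaSeries {t : ℝ} (ht : 0 < t) (ht1 : t ≤ 1) {x : ℝ} (hx : |x| < t) {s : ℂ}
    (hs : s.re < 0) :
    HasSum (fun k : ℕ => s * (((k + t + x : ℝ) : ℂ)) ^ (s - 1)) (zetaSeries t x s) := by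
  obtain ⟨N, hN⟩ := exists_nat_ge ‖s‖
  let f : ℕ × ℕ → ℂ := fun p =>
    s * (((p.1 + t : ℝ) : ℂ) ^ (s - 1)) * (binom (s - 1) p.2 * ((x / (p.1 + t) : ℝ) : ℂ) ^ p.2)
  have hf : Summable f := by
    have h1 : Summable fun k : ℕ => 1 / |(k : ℝ) + t| ^ (1 - s.re) :=
      (Real.summable_one_div_nat_add_rpow t _).2 (by linarith)
    have h2 := summable_choose_mul_pow N (x := |x| / t) (by positivity) ((div_lt_one ht).2 hx)
    refine ((h1.mul_of_nonneg h2 (fun _ => by positivity) fun _ => by positivity).mul_left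
      ‖s‖).of_norm_bounded fun p => ?_
    have hk : (0 : ℝ) < p.1 + t := by positivity
    simp only [f]
    rw [norm_mul, norm_mul, norm_mul, norm_pow, norm_real, norm_cpow_eq_rpow_re_of_pos hk,
      Real.norm_eq_abs, abs_div, abs_of_pos hk, mul_assoc]
    have e : ((p.1 : ℝ) + t) ^ (s - 1).re = 1 / (p.1 + t) ^ (1 - s.re) := by
      rw [one_div, ← Real.rpow_neg hk.le]; simp
    rw [e]
    gcongr
    · exact norm_binom_le _ _ _ ((norm_sub_le _ _).trans (by simpa using hN))
    · simp
  have h1 : ∀ k : ℕ, HasSum (fun n => f (k, n)) (s * (((k + t + x : ℝ) : ℂ)) ^ (s - 1)) := by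
    intro k
    have hk : (0 : ℝ) < k + t := by positivity
    have hxk : |x / (k + t)| < 1 := by
      rw [abs_div, abs_of_pos hk, div_lt_one hk]
      exact hx.trans_le (by simp)
    have h := (hasSum_binom (s - 1) ((x / (k + t) : ℝ) : ℂ) (by rwa [norm_real])).mul_left
      (s * (((k + t : ℝ) : ℂ) ^ (s - 1)))
    convert! h using 1
    rw [mul_assoc, ← ofReal_one, ← ofReal_add,
      ← mul_cpow_ofReal_nonneg hk.le (by linarith [(abs_lt.1 hxk).1]), ← ofReal_mul]
    congr 3
    field_simp
  have h2 : ∀ n : ℕ, HasSum (fun k => f (k, n)) (zetaCoeff t n s * (x : ℂ) ^ n) := by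
    intro n
    have h := (hasSum_hurwitzZeta_of_one_lt_re (a := t) ⟨ht.le, ht1⟩ (s := 1 - s + n) (by
      simp; linarith [(Nat.cast_nonneg n : (0 : ℝ) ≤ n)])).mul_left
        (s * binom (s - 1) n * (x : ℂ) ^ n)
    have hn : s ≠ n := by
      rintro rfl
      simp at hs
      linarith [(Nat.cast_nonneg n : (0 : ℝ) ≤ n)]
    rw [zetaCoeff_eq _ _ hn, mul_right_comm]
    convert! h using 2 with k
    have hk : ((k : ℂ) + t) ≠ 0 := by
      have : (0 : ℝ) < k + t := by positivity
      exact_mod_cast this.ne'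
    simp only [f]
    push_cast
    rw [show 1 - s + n = -(s - 1 - n) by ring, cpow_neg, one_div, inv_inv, cpow_sub (s - 1) _ hk,
      cpow_natCast, div_pow]
    field_simp
  have h3 := hf.hasSum.prod_fiberwise h1
  convert! h3 using 1
  rw [zetaSeries]
  exact (((Equiv.prodComm ℕ ℕ).hasSum_iff.2 hf.hasSum).prod_fiberwise h2).tsum_eq

lemma eq_zetaSeries {t : ℝ} (ht : 0 < t) (ht1 : t ≤ 1) {x : ℝ} (hx : |x| < t) {B : ℂ → ℂ}
    (hB : DifferentiableOn ℂ B {0}ᶜ)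
    (hsum : ∀ s : ℂ, s.re < 0 →
      HasSum (fun k : ℕ => s * (((k + t + x : ℝ) : ℂ)) ^ (s - 1)) (B s)) {s : ℂ} (hs : s ≠ 0) :
    B s = zetaSeries t x s := by
  have hopen : IsOpen ({0}ᶜ : Set ℂ) := isOpen_compl_singleton
  refine (hB.analyticOnNhd hopen).eqOn_of_preconnected_of_eventuallyEq
    ((differentiable_zetaSeries ht ht1 hx).differentiableOn.analyticOnNhd hopen)
    (isConnected_compl_singleton_of_one_lt_rank (by simp) 0).isPreconnected
    (z₀ := -1) (by simp) ?_ hs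
  have : {z : ℂ | z.re < 0} ∈ nhds (-1 : ℂ) :=
    (isOpen_lt continuous_re continuous_const).mem_nhds (by simp)
  filter_upwards [this] with z hz
  exact (hsum z hz).unique (hasSum_zetaSeries ht ht1 hx hz)

lemma differentiableOn_mul_hurwitzZeta_one_sub (a : UnitAddCircle) :
    DifferentiableOn ℂ (fun s => s * hurwitzZeta a (1 - s)) {0}ᶜ := by
  intro s hs
  have := (differentiableAt_hurwitzZeta a (s := 1 - s) (by simpa using hs)).comp s
    (f := fun s => 1 - s) (by fun_prop)
  exact (differentiableAt_id.mul this).differentiableWithinAt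

lemma hasSum_mul_hurwitzZeta_one_sub {a : ℝ} (ha : a ∈ Set.Ioc (0 : ℝ) 1) {s : ℂ}
    (hs : s.re < 0) :
    HasSum (fun k : ℕ => s * (((k + a : ℝ) : ℂ)) ^ (s - 1)) (s * hurwitzZeta a (1 - s)) := by
  convert! (hasSum_hurwitzZeta_of_one_lt_re (Set.Ioc_subset_Icc_self ha) (s := 1 - s)
    (by simp; linarith)).mul_left s using 3 with k
  rw [← neg_sub, cpow_neg, one_div]
  simp

lemma mul_hurwitzZeta_half {x : ℝ} (hx : |x| < 1 / 2) {s : ℂ} (hs : s ≠ 0) :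
    s * hurwitzZeta ((1 / 2 + x : ℝ) : UnitAddCircle) (1 - s) = zetaSeries (1 / 2) x s := by
  have := abs_lt.1 hx
  refine eq_zetaSeries (by norm_num) (by norm_num) hx
    (differentiableOn_mul_hurwitzZeta_one_sub _) (fun s hs => ?_) hs
  simpa only [add_assoc] using
    hasSum_mul_hurwitzZeta_one_sub (a := 1 / 2 + x) ⟨by linarith, by linarith⟩ hs

lemma mul_hurwitzZeta_neg {x : ℝ} (hx : x ∈ Set.Ioo (0 : ℝ) 1) {s : ℂ} (hs : s ≠ 0) :
    s * hurwitzZeta ((-x : ℝ) : UnitAddCircle) (1 - s) = zetaSeries 1 (-x) s := by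
  have h1 : ((-x : ℝ) : UnitAddCircle) = ((1 - x : ℝ) : UnitAddCircle) := by
    rw [sub_eq_neg_add, AddCircle.coe_add, AddCircle.coe_period, add_zero]
  refine eq_zetaSeries (by norm_num) (by norm_num) (by rw [abs_neg, abs_of_pos hx.1]; exact hx.2)
    (differentiableOn_mul_hurwitzZeta_one_sub _) (fun s hs => ?_) hs
  rw [h1]
  have h := hasSum_mul_hurwitzZeta_one_sub (a := 1 - x) ⟨by linarith [hx.2], by linarith [hx.1]⟩ hs
  simpa only [sub_eq_add_neg, add_assoc] using h

lemma mul_hurwitzZeta_pos {x : ℝ} (hx : x ∈ Set.Ioo (0 : ℝ) 1) {s : ℂ} (hs : s ≠ 0) :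
    s * hurwitzZeta (x : UnitAddCircle) (1 - s) = s * (x : ℂ) ^ (s - 1) + zetaSeries 1 x s := by
  have hx0 : (x : ℂ) ≠ 0 := by exact_mod_cast hx.1.ne'
  rw [← sub_eq_iff_eq_add']
  refine eq_zetaSeries (B := fun s => s * hurwitzZeta (x : UnitAddCircle) (1 - s) -
    s * (x : ℂ) ^ (s - 1)) (by norm_num) (by norm_num) (by rw [abs_of_pos hx.1]; exact hx.2)
    ((differentiableOn_mul_hurwitzZeta_one_sub _).sub ?_) (fun s hs => ?_) hs
  · refine Differentiable.differentiableOn fun s => ?_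
    exact differentiableAt_id.mul ((differentiableAt_id.sub_const 1).const_cpow (Or.inl hx0))
  · have h := (hasSum_nat_add_iff' 1).2
      (hasSum_mul_hurwitzZeta_one_sub (a := x) ⟨hx.1, hx.2.le⟩ hs)
    simpa [add_assoc] using h

/-- The `ℚ`-span of the products `∏ i, ζ(m + 1 + nᵢ, tᵢ)` of `q` factors with `∑ i, nᵢ = j`
and `tᵢ ∈ {1, 1/2}`. -/
noncomputable def zetaProdSpan (m q j : ℕ) : Submodule ℚ ℂ :=
  Submodule.span ℚ {z | ∃ l : List (ℕ × ℝ), l.length = q ∧ (∀ x ∈ l, x.2 ∈ ({1, 1/2} : Set ℝ)) ∧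
    (l.map Prod.fst).sum = j ∧
    z = (l.map fun x => ∑' k : ℕ, 1 / ((k : ℂ) + (x.2 : ℝ)) ^ (m + 1 + x.1)).prod}

lemma mul_mem_zetaProdSpan {m q q' j j' : ℕ} {z w : ℂ} (hz : z ∈ zetaProdSpan m q j)
    (hw : w ∈ zetaProdSpan m q' j') : z * w ∈ zetaProdSpan m (q + q') (j + j') := by
  have h := Submodule.mul_mem_mul hz hw
  rw [zetaProdSpan, zetaProdSpan, Submodule.span_mul_span] at h
  refine Submodule.span_mono ?_ h
  rintro _ ⟨_, ⟨l, hl1, hl2, hl3, rfl⟩, _, ⟨l', hl1', hl2', hl3', rfl⟩, rfl⟩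
  refine ⟨l ++ l', by simp [hl1, hl1'], fun x hx => ?_, by simp [hl3, hl3'], by simp⟩
  rcases List.mem_append.1 hx with hx | hx
  exacts [hl2 x hx, hl2' x hx]

lemma ratCast_mem_zetaProdSpan (m : ℕ) (r : ℚ) : (r : ℂ) ∈ zetaProdSpan m 0 0 := by
  have h : (1 : ℂ) ∈ zetaProdSpan m 0 0 := Submodule.subset_span ⟨[], by simp⟩
  simpa [Rat.smul_def] using Submodule.smul_mem _ r h

lemma zetaCoeff_neg_mem_zetaProdSpan {t : ℝ} (ht : t ∈ ({1, 1/2} : Set ℝ)) {m : ℕ} (hm : 0 < m)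
    (n : ℕ) : zetaCoeff t n (-m) ∈ zetaProdSpan m 1 n := by
  obtain ⟨r, hr⟩ := exists_rat_zetaCoeff_neg t (by rcases ht with rfl | rfl <;> norm_num) m n hm
  rw [hr, ← Rat.smul_def]
  exact Submodule.smul_mem _ _ (Submodule.subset_span ⟨[(n, t)], by simpa using ht⟩)

/-- The open unit square. -/
abbrev unitSquare : Set (ℝ × ℝ) := Set.Ioo (0 : ℝ) 1 ×ˢ Set.Ioo (0 : ℝ) 1

/-- A convergent expansion of `H s (a, b)` on the unit square as
`a ^ ((r + e) (s - 1)) * b ^ (e (s - 1))` times a power series in `a` and `b` whose coefficients are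
entire functions of `s` that lie in `zetaProdSpan m q j` at `s = -m`, `j` being the degree
in `a`. -/
structure CornerExpansion (r e q : ℕ) (H : ℂ → ℝ × ℝ → ℂ) where
  ι : Type
  countable : Countable ι
  coeff : ι → ℂ → ℂ
  j : ι → ℕ
  k : ι → ℕ
  differentiable : ∀ i, Differentiable ℂ (coeff i)
  bound : ∀ R : ℝ, ∃ u : ι → ℝ, Summable u ∧ ∀ i s, ‖s‖ ≤ R → ‖coeff i s‖ ≤ u i
  finite : ∀ N, {i | j i + k i ≤ N}.Finite
  k_le : r = 0 → ∀ i, k i ≤ j i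
  mem : ∀ m : ℕ, 0 < m → ∀ i, coeff i (-m) ∈ zetaProdSpan m q (j i)
  eq : ∀ s : ℂ, 1 < s.re → ∀ p ∈ unitSquare,
    H s p = (p.1 : ℂ) ^ (((r + e : ℕ) : ℂ) * (s - 1)) * (p.2 : ℂ) ^ ((e : ℂ) * (s - 1)) *
      ∑' i, coeff i s * (p.1 : ℂ) ^ j i * (p.2 : ℂ) ^ k i

lemma CornerExpansion.summable {r e q : ℕ} {H : ℂ → ℝ × ℝ → ℂ} (E : CornerExpansion r e q H) (s : ℂ)
    {p : ℝ × ℝ} (hp : p ∈ unitSquare) :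
    Summable fun i => ‖E.coeff i s * (p.1 : ℂ) ^ E.j i * (p.2 : ℂ) ^ E.k i‖ := by
  obtain ⟨u, hu, hb⟩ := E.bound ‖s‖
  refine hu.of_nonneg_of_le (fun _ => norm_nonneg _) fun i => ?_
  obtain ⟨h1, h2⟩ := hp
  rw [norm_mul, norm_mul, norm_pow, norm_pow, norm_real, norm_real, Real.norm_of_nonneg h1.1.le,
    Real.norm_of_nonneg h2.1.le]
  have h1' := h1.1.le
  have h2' := h2.1.le
  calc _ ≤ ‖E.coeff i s‖ * 1 * 1 := by
        gcongr
        · exact pow_le_one₀ h1.1.le h1.2.le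
        · exact pow_le_one₀ h2.1.le h2.2.le
    _ ≤ u i := by simpa using hb i s le_rfl

/-- The product of two corner expansions. -/
noncomputable def CornerExpansion.mul {r e q r' e' q' : ℕ} {H H' : ℂ → ℝ × ℝ → ℂ}
    (E : CornerExpansion r e q H) (E' : CornerExpansion r' e' q' H') :
    CornerExpansion (r + r') (e + e') (q + q') (fun s p => H s p * H' s p) where
  ι := E.ι × E'.ι
  countable := by
    have := E.countable
    have := E'.countable
    infer_instance
  coeff i s := E.coeff i.1 s * E'.coeff i.2 s
  j i := E.j i.1 + E'.j i.2
  k i := E.k i.1 + E'.k i.2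
  differentiable i := (E.differentiable _).mul (E'.differentiable _)
  bound R := by
    obtain ⟨u, hu, hb⟩ := E.bound R
    obtain ⟨u', hu', hb'⟩ := E'.bound R
    refine ⟨fun i => |u i.1| * |u' i.2|, hu.abs.mul_of_nonneg hu'.abs (fun _ => abs_nonneg _)
      (fun _ => abs_nonneg _), fun i s hs => ?_⟩
    rw [norm_mul]
    exact mul_le_mul ((hb _ _ hs).trans (le_abs_self _)) ((hb' _ _ hs).trans (le_abs_self _))
      (norm_nonneg _) (abs_nonneg _)
  finite N := by
    refine ((E.finite N).prod (E'.finite N)).subset fun i hi => ?_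
    simp only [Set.mem_ofPred_eq, Set.mem_prod] at hi ⊢
    omega
  k_le h i := add_le_add (E.k_le (by omega) _) (E'.k_le (by omega) _)
  mem m hm i := mul_mem_zetaProdSpan (E.mem m hm _) (E'.mem m hm _)
  eq s hs p hp := by
    have h1 : (p.1 : ℂ) ≠ 0 := by exact_mod_cast hp.1.1.ne'
    have h2 : (p.2 : ℂ) ≠ 0 := by exact_mod_cast hp.2.1.ne'
    have h3 : ∀ i : E.ι × E'.ι,
        E.coeff i.1 s * E'.coeff i.2 s * (p.1 : ℂ) ^ (E.j i.1 + E'.j i.2) *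
          (p.2 : ℂ) ^ (E.k i.1 + E'.k i.2) =
        (E.coeff i.1 s * (p.1 : ℂ) ^ E.j i.1 * (p.2 : ℂ) ^ E.k i.1) *
        (E'.coeff i.2 s * (p.1 : ℂ) ^ E'.j i.2 * (p.2 : ℂ) ^ E'.k i.2) := fun i => by
      rw [pow_add, pow_add]; ring
    simp only [h3]
    rw [E.eq s hs p hp, E'.eq s hs p hp,
      ← tsum_mul_tsum_of_summable_norm (E.summable s hp) (E'.summable s hp)]
    rw [show ((r + r' + (e + e') : ℕ) : ℂ) * (s - 1) =
        ((r + e : ℕ) : ℂ) * (s - 1) + ((r' + e' : ℕ) : ℂ) * (s - 1) by push_cast; ring,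
      show ((e + e' : ℕ) : ℂ) * (s - 1) = (e : ℂ) * (s - 1) + (e' : ℂ) * (s - 1) by
        push_cast; ring,
      cpow_add _ _ h1, cpow_add _ _ h2]
    ring

/-- The expansion of `s (β a b) ^ (s - 1)`. -/
noncomputable def CornerExpansion.edge (β : ℚ) (hβ : 0 < β) :
    CornerExpansion 0 1 0 (fun s p => s * ((β * p.1 * p.2 : ℝ) : ℂ) ^ (s - 1)) where
  ι := Unit
  countable := inferInstance
  coeff _ s := s * (β : ℂ) ^ (s - 1)
  j _ := 0
  k _ := 0
  differentiable _ := differentiable_id.mul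
    ((differentiable_id.sub_const 1).const_cpow (Or.inl (by exact_mod_cast hβ.ne')))
  bound R := by
    have hd : Differentiable ℂ fun s : ℂ => s * (β : ℂ) ^ (s - 1) := differentiable_id.mul
      ((differentiable_id.sub_const 1).const_cpow (Or.inl (by exact_mod_cast hβ.ne')))
    obtain ⟨B, hB⟩ := (isCompact_closedBall (0 : ℂ) R).exists_bound_of_continuousOn
      hd.continuous.continuousOn
    exact ⟨fun _ => B, (hasSum_fintype _).summable, fun _ s hs => hB s (by simpa using hs)⟩
  finite N := Set.toFinite _
  k_le _ _ := le_rfl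
  mem m hm _ := by
    convert! ratCast_mem_zetaProdSpan m (-m * β ^ (-(m : ℤ) - 1)) using 1
    push_cast
    rw [← cpow_intCast]
    push_cast
    rfl
  eq s hs p hp := by
    have hβ' : (0 : ℝ) ≤ β := by exact_mod_cast hβ.le
    rw [ofReal_mul, mul_cpow_ofReal_nonneg (by have := hp.1.1; positivity) hp.2.1.le, ofReal_mul,
      mul_cpow_ofReal_nonneg hβ' hp.1.1.le]
    simp
    ring

lemma summable_vertex_bound (α β : ℚ) (hα : 0 < α) (hβ : |β| < α) (R : ℝ) :
    ∃ u : ℕ → ℝ, Summable u ∧ ∀ (v : ℕ) (s : ℂ), ‖s‖ ≤ R →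
      ‖s * (α : ℂ) ^ (s - 1) * binom (s - 1) v * ((β / α : ℚ) : ℂ) ^ v‖ ≤ u v := by
  have hd : Differentiable ℂ fun s : ℂ => s * (α : ℂ) ^ (s - 1) := differentiable_id.mul
    ((differentiable_id.sub_const 1).const_cpow (Or.inl (by exact_mod_cast hα.ne')))
  obtain ⟨B, hB⟩ := (isCompact_closedBall (0 : ℂ) R).exists_bound_of_continuousOn
    hd.continuous.continuousOn
  obtain ⟨N, hN⟩ := exists_nat_ge R
  have hx : |((β / α : ℚ) : ℝ)| < 1 := by
    rw [← Rat.cast_abs]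
    exact_mod_cast (by rwa [abs_div, abs_of_pos hα, div_lt_one hα] : |β / α| < 1)
  refine ⟨_, (summable_choose_mul_pow N (abs_nonneg _) hx).mul_left B, fun v s hs => ?_⟩
  rw [norm_mul, norm_mul _ (binom _ _), norm_pow, norm_ratCast, mul_assoc]
  have h1 := hB s (by simpa using hs)
  have h2 : ‖binom (s - 1) v‖ ≤ (v + N).choose N := norm_binom_le _ _ _
    ((norm_sub_le _ _).trans (by simpa using hs.trans hN))
  have := (norm_nonneg _).trans h1
  gcongr

/-- The expansion of `s (a (α + β b)) ^ (s - 1)`. -/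
noncomputable def CornerExpansion.vertex (α β : ℚ) (hα : 0 < α) (hβ : |β| < α) :
    CornerExpansion 1 0 0 (fun s p => s * ((p.1 * (α + β * p.2) : ℝ) : ℂ) ^ (s - 1)) where
  ι := ℕ
  countable := inferInstance
  coeff v s := s * (α : ℂ) ^ (s - 1) * binom (s - 1) v * ((β / α : ℚ) : ℂ) ^ v
  j _ := 0
  k v := v
  differentiable v := ((differentiable_id.mul
    ((differentiable_id.sub_const 1).const_cpow (Or.inl (by exact_mod_cast hα.ne')))).mul
    ((differentiable_binom v).comp (differentiable_id.sub_const 1))).mul_const _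
  bound := summable_vertex_bound α β hα hβ
  finite N := (Set.finite_le_nat N).subset fun i hi => by simpa using hi
  k_le h := absurd h one_ne_zero
  mem m hm v := by
    obtain ⟨r, hr⟩ := exists_rat_binom (-m - 1) v
    convert! ratCast_mem_zetaProdSpan m (-m * α ^ (-(m : ℤ) - 1) * r * (β / α) ^ v) using 1
    push_cast at hr ⊢
    rw [← hr, ← cpow_intCast]
    push_cast
    rfl
  eq s hs p hp := by
    have hα' : (0 : ℝ) < α := by exact_mod_cast hα
    have hx : |((β / α : ℚ) : ℝ)| < 1 := by
      rw [← Rat.cast_abs]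
      exact_mod_cast (by rwa [abs_div, abs_of_pos hα, div_lt_one hα] : |β / α| < 1)
    have hy : |((β / α : ℚ) * p.2 : ℝ)| < 1 := by
      rw [abs_mul, abs_of_pos hp.2.1]
      exact mul_lt_one_of_nonneg_of_lt_one_left (abs_nonneg _) hx hp.2.2.le
    have h := hasSum_binom (s - 1) (((β / α : ℚ) * p.2 : ℝ) : ℂ) (by rwa [norm_real])
    have e : (p.1 * (α + β * p.2) : ℝ) = p.1 * (α * (1 + (β / α : ℚ) * p.2)) := by
      push_cast; field_simp
    rw [e, ofReal_mul, mul_cpow_ofReal_nonneg hp.1.1.le (by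
        have := (abs_lt.1 hy).1
        exact mul_nonneg hα'.le (by linarith)), ofReal_mul,
      mul_cpow_ofReal_nonneg hα'.le (by linarith [(abs_lt.1 hy).1]), ofReal_add, ofReal_one,
      ← h.tsum_eq, ← tsum_mul_left, ← tsum_mul_left, ← tsum_mul_left, ← tsum_mul_left]
    refine tsum_congr fun v => ?_
    simp [mul_pow]
    ring

lemma tsum_eq_tsum_sum_antidiagonal {f : ℕ × ℕ → ℂ} (hf : Summable f) :
    ∑' i, f i = ∑' n, ∑ c ∈ Finset.HasAntidiagonal.antidiagonal n, f c := by
  rw [← Finset.HasAntidiagonal.sigmaAntidiagonalEquivProd.tsum_eq]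
  refine (Summable.tsum_sigma' (fun n => (hasSum_fintype _).summable)
    ((Finset.HasAntidiagonal.sigmaAntidiagonalEquivProd.summable_iff).2 hf)).trans
    (tsum_congr fun n => ?_)
  rw [tsum_fintype]
  exact Finset.sum_coe_sort (Finset.HasAntidiagonal.antidiagonal n) f

lemma summable_regular_bound {t : ℝ} (ht : 0 < t) (ht1 : t ≤ 1) (α β : ℚ)
    (h : |(α : ℝ)| + |(β : ℝ)| < t) (R : ℝ) :
    ∃ u : ℕ × ℕ → ℝ, Summable u ∧ ∀ (i : ℕ × ℕ) (s : ℂ), ‖s‖ ≤ R →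
      ‖zetaCoeff t (i.1 + i.2) s * ((i.1 + i.2).choose i.1 * (α : ℂ) ^ i.1 * (β : ℂ) ^ i.2)‖
        ≤ u i := by
  set A := |(α : ℝ)| with hA
  set B := |(β : ℝ)| with hB
  have hA0 : 0 ≤ A := abs_nonneg _
  have hB0 : 0 ≤ B := abs_nonneg _
  obtain ⟨x, hx1, hx2⟩ := exists_between h
  have hx0 : 0 < x := by linarith
  obtain ⟨u, hu, hub⟩ := exists_summable_bound_zetaCoeff ht ht1 hx0.le hx2 R
  refine ⟨fun i => |u (i.1 + i.2)| / x ^ (i.1 + i.2) *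
    ((i.1 + i.2).choose i.1 * A ^ i.1 * B ^ i.2), ?_, fun i s hs => ?_⟩
  · rw [← Finset.HasAntidiagonal.sigmaAntidiagonalEquivProd.summable_iff, summable_sigma_of_nonneg
      (fun _ => by simp only [Function.comp]; positivity)]
    refine ⟨fun n => (hasSum_fintype _).summable, hu.abs.of_nonneg_of_le
      (fun n => tsum_nonneg fun _ => by simp only [Function.comp]; positivity) fun n => ?_⟩
    have e : ∀ c : Finset.HasAntidiagonal.antidiagonal n, ((fun i : ℕ × ℕ => |u (i.1 + i.2)| / x ^ (i.1 + i.2) *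
        ((i.1 + i.2).choose i.1 * A ^ i.1 * B ^ i.2)) ∘ Finset.HasAntidiagonal.sigmaAntidiagonalEquivProd) ⟨n, c⟩ =
        |u n| / x ^ n * (n.choose c.1.1 • (A ^ c.1.1 * B ^ c.1.2)) := fun c => by
      have := Finset.HasAntidiagonal.mem_antidiagonal.1 c.2
      simp [this]
      exact Or.inl (by ring)
    rw [tsum_congr e, tsum_mul_left, tsum_fintype,
      Finset.sum_coe_sort (Finset.HasAntidiagonal.antidiagonal n) (fun c => n.choose c.1 • (A ^ c.1 * B ^ c.2)),
      ← (Commute.all A B).add_pow', div_mul_eq_mul_div, div_le_iff₀ (by positivity)]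
    gcongr
  · rw [norm_mul, norm_mul, norm_mul, norm_pow, norm_pow, Complex.norm_natCast, norm_ratCast, norm_ratCast]
    have h1 : ‖zetaCoeff t (i.1 + i.2) s‖ ≤ |u (i.1 + i.2)| / x ^ (i.1 + i.2) := by
      rw [le_div_iff₀ (by positivity)]
      exact (hub _ s hs).trans (le_abs_self _)
    exact mul_le_mul_of_nonneg_right h1 (by positivity)

/-- The expansion of `zetaSeries t (a (α + β b))`. -/
noncomputable def CornerExpansion.regular {t : ℝ} (ht : t ∈ ({1, 1/2} : Set ℝ)) (α β : ℚ)
    (h : |(α : ℝ)| + |(β : ℝ)| < t) :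
    CornerExpansion 0 0 1 (fun s p => zetaSeries t (p.1 * (α + β * p.2)) s) where
  ι := ℕ × ℕ
  countable := inferInstance
  coeff i s := zetaCoeff t (i.1 + i.2) s * ((i.1 + i.2).choose i.1 * (α : ℂ) ^ i.1 * (β : ℂ) ^ i.2)
  j i := i.1 + i.2
  k i := i.2
  differentiable i := (differentiable_zetaCoeff _ _).mul_const _
  bound := summable_regular_bound (by rcases ht with rfl | rfl <;> norm_num)
    (by rcases ht with rfl | rfl <;> norm_num) α β h
  finite N := ((Set.finite_le_nat N).prod (Set.finite_le_nat N)).subset fun i hi => by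
    simp only [Set.mem_ofPred_eq, Set.mem_prod] at hi ⊢
    omega
  k_le _ i := Nat.le_add_left _ _
  mem m hm i := by
    have := mul_mem_zetaProdSpan (zetaCoeff_neg_mem_zetaProdSpan ht hm (i.1 + i.2))
      (ratCast_mem_zetaProdSpan m ((i.1 + i.2).choose i.1 * α ^ i.1 * β ^ i.2))
    push_cast at this
    exact this
  eq s hs p hp := by
    have ht0 : 0 < t := by rcases ht with rfl | rfl <;> norm_num
    have ht1 : t ≤ 1 := by rcases ht with rfl | rfl <;> norm_num
    obtain ⟨u, hu, hub⟩ := summable_regular_bound ht0 ht1 α β h ‖s‖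
    have hs : Summable fun i : ℕ × ℕ => zetaCoeff t (i.1 + i.2) s *
        ((i.1 + i.2).choose i.1 * (α : ℂ) ^ i.1 * (β : ℂ) ^ i.2) * (p.1 : ℂ) ^ (i.1 + i.2) *
          (p.2 : ℂ) ^ i.2 := by
      refine Summable.of_norm_bounded hu fun i => ?_
      rw [norm_mul, norm_mul _ ((p.1 : ℂ) ^ _), norm_pow, norm_pow, norm_real, norm_real,
        Real.norm_of_nonneg hp.1.1.le, Real.norm_of_nonneg hp.2.1.le]
      refine (mul_le_of_le_one_right (mul_nonneg (norm_nonneg _) (pow_nonneg hp.1.1.le _))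
        (pow_le_one₀ hp.2.1.le hp.2.2.le)).trans ((mul_le_of_le_one_right (norm_nonneg _)
        (pow_le_one₀ hp.1.1.le hp.1.2.le)).trans (hub i s le_rfl))
    rw [tsum_eq_tsum_sum_antidiagonal hs]
    simp only [add_zero, CharP.cast_eq_zero, zero_mul, cpow_zero, one_mul, zetaSeries]
    refine tsum_congr fun n => ?_
    push_cast
    rw [mul_pow, (Commute.all (α : ℂ) (β * p.2 : ℂ)).add_pow', Finset.mul_sum, Finset.mul_sum]
    refine Finset.sum_congr rfl fun c hc => ?_
    rw [Finset.HasAntidiagonal.mem_antidiagonal] at hc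
    simp [hc, mul_pow]
    ring

/-- The `ℚ`-span of the values `ζ(4m + 2, t)` and `ζ(a, t₁) ζ(b, t₂)`, with `a, b ≥ m + 1`,
`a + b = 4m + 2` and `t, t₁, t₂ ∈ {1, 1/2}`. -/
noncomputable def leadingCoeffSpan (m : ℕ) : Submodule ℚ ℂ :=
  Submodule.span ℚ
            ({z : ℂ | ∃ t ∈ ({1, 1/2} : Set ℝ),
                z = ∑' k : ℕ, 1 / ((k : ℂ) + (t : ℝ)) ^ (4 * m + 2)} ∪
             {z : ℂ | ∃ (a b : ℕ), ∃ t₁ ∈ ({1, 1/2} : Set ℝ), ∃ t₂ ∈ ({1, 1/2} : Set ℝ),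
                m + 1 ≤ a ∧ m + 1 ≤ b ∧ a + b = 4 * m + 2 ∧
                z = (∑' k : ℕ, 1 / ((k : ℂ) + (t₁ : ℝ)) ^ a) *
                    (∑' k : ℕ, 1 / ((k : ℂ) + (t₂ : ℝ)) ^ b)})

lemma zetaProdSpan_two_le (m : ℕ) : zetaProdSpan m 2 (2 * m) ≤ leadingCoeffSpan m := by
  refine Submodule.span_mono ?_
  rintro _ ⟨l, hl, ht, hj, rfl⟩
  obtain ⟨x, y, rfl⟩ := List.length_eq_two.1 hl
  simp only [List.map_cons, List.map_nil, List.sum_cons, List.sum_nil] at hj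
  exact Or.inr ⟨_, _, x.2, ht x (by simp), y.2, ht y (by simp),
    Nat.le_add_right (m + 1) x.1, Nat.le_add_right (m + 1) y.1, by omega, by simp⟩

lemma zetaProdSpan_one_le (m : ℕ) : zetaProdSpan m 1 (3 * m + 1) ≤ leadingCoeffSpan m := by
  refine Submodule.span_mono ?_
  rintro _ ⟨l, hl, ht, hj, rfl⟩
  obtain ⟨x, rfl⟩ := List.length_eq_one_iff.1 hl
  simp only [List.map_cons, List.map_nil, List.sum_cons, List.sum_nil] at hj
  refine Or.inl ⟨x.2, ht x (by simp), ?_⟩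
  simp [show m + 1 + x.1 = 4 * m + 2 by omega]

lemma zetaProdSpan_zero_le (m j : ℕ) (hj : j ≠ 0) : zetaProdSpan m 0 j ≤ leadingCoeffSpan m := by
  refine Submodule.span_le.2 ?_
  rintro _ ⟨l, hl, ht, h, rfl⟩
  rw [List.length_eq_zero_iff.1 hl] at h
  exact absurd h.symm hj

/-- `I` extends from `1 < re s` to a meromorphic function `F` on `ℂ` such that
`(s + m) ^ 2 * F s` has a limit in `leadingCoeffSpan m` at every negative integer `-m`. -/
def HasMeromorphicExtension (I : ℂ → ℂ) : Prop :=
  ∃ F : ℂ → ℂ, (∀ z, MeromorphicAt F z) ∧ (∀ s, 1 < s.re → F s = I s) ∧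
    ∀ m : ℕ, 0 < m → ∃ L ∈ leadingCoeffSpan m,
      Tendsto (fun s => (s + (m : ℂ)) ^ 2 * F s)
        (nhdsWithin (-(m : ℂ)) {-(m : ℂ)}ᶜ) (nhds L)

lemma exists_radius_linear_factor (P : ℕ) (s₀ : ℂ) :
    ∃ ε > 0, ∀ n : ℕ, 0 < n → ∃ α : ℂ → ℂ, DifferentiableOn ℂ α (Metric.ball s₀ ε) ∧
      (∀ s ∈ Metric.ball s₀ ε, ‖α s‖ ≤ 1) ∧
      (∀ s ∈ Metric.ball s₀ ε, s ≠ s₀ → α s = (s - s₀) / (P * (s - 1) + n)) ∧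
      (P * (s₀ - 1) + n ≠ 0 → α s₀ = 0) ∧ (P * (s₀ - 1) + n = 0 → α s₀ = 1 / P) := by
  obtain ⟨N, hN⟩ := exists_nat_ge (‖(P : ℂ) * (s₀ - 1)‖ + 1)
  have hlim : Tendsto (fun ε : ℝ => (P + 1) * ε) (nhdsWithin 0 (Set.Ioi 0)) (nhds 0) := by
    have : Tendsto (fun ε : ℝ => (P + 1) * ε) (nhds 0) (nhds ((P + 1) * 0)) :=
      (continuous_const_mul _).tendsto _
    rw [mul_zero] at this
    exact this.mono_left nhdsWithin_le_nhds
  have h1 : ∀ᶠ ε in nhdsWithin (0 : ℝ) (Set.Ioi 0), ∀ n ∈ {n : ℕ | n ≤ N},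
      (P : ℂ) * (s₀ - 1) + n ≠ 0 → (P + 1) * ε ≤ ‖(P : ℂ) * (s₀ - 1) + n‖ := by
    rw [eventually_all_finite (Set.finite_le_nat N)]
    intro n _
    by_cases h : (P : ℂ) * (s₀ - 1) + n = 0
    · simp [h]
    · filter_upwards [hlim.eventually (gt_mem_nhds (norm_pos_iff.2 h))] with ε hε _ using hε.le
  obtain ⟨ε, hε, hε1, hε0⟩ := (h1.and ((hlim.eventually (gt_mem_nhds one_pos)).and
    self_mem_nhdsWithin)).exists
  refine ⟨ε, hε0, fun n hn => ?_⟩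
  have hε0 : 0 < ε := hε0
  by_cases h : (P : ℂ) * (s₀ - 1) + n = 0
  · have hP : (P : ℂ) ≠ 0 := by
      rintro hP
      rw [hP, zero_mul, zero_add, Nat.cast_eq_zero] at h
      omega
    refine ⟨fun _ => 1 / P, differentiableOn_const _, fun _ _ => ?_, fun s _ hs => ?_,
      fun h' => absurd h h', fun _ => rfl⟩
    · have : 1 ≤ (P : ℝ) := by exact_mod_cast Nat.one_le_iff_ne_zero.2 (by exact_mod_cast hP)
      simpa using inv_le_one_of_one_le₀ this
    · have := sub_ne_zero.2 hs
      rw [show (P : ℂ) * (s - 1) + n = P * (s - s₀) by linear_combination h]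
      field_simp
  · have hle : (P + 1) * ε ≤ ‖(P : ℂ) * (s₀ - 1) + n‖ := by
      by_cases hnN : n ≤ N
      · exact hε n hnN h
      · have h2 : ‖(n : ℂ)‖ ≤ ‖(P : ℂ) * (s₀ - 1) + n‖ + ‖(P : ℂ) * (s₀ - 1)‖ := by
          simpa using norm_sub_le ((P : ℂ) * (s₀ - 1) + n) ((P : ℂ) * (s₀ - 1))
        have h3 : (N : ℝ) ≤ n := by exact_mod_cast (not_le.1 hnN).le
        rw [Complex.norm_natCast] at h2
        linarith
    have hD : ∀ s ∈ Metric.ball s₀ ε, ε ≤ ‖(P : ℂ) * (s - 1) + n‖ := fun s hs => by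
      rw [mem_ball_iff_norm] at hs
      have h2 : ‖(P : ℂ) * (s₀ - 1) + n‖ ≤ ‖(P : ℂ) * (s - 1) + n‖ + ‖(P : ℂ) * (s - s₀)‖ := by
        refine le_trans (le_of_eq ?_) (norm_sub_le _ _)
        ring_nf
      rw [norm_mul, Complex.norm_natCast] at h2
      have : (P : ℝ) * ‖s - s₀‖ ≤ P * ε := by gcongr
      linarith
    refine ⟨fun s => (s - s₀) / (P * (s - 1) + n), fun s hs => ?_, fun s hs => ?_,
      fun _ _ _ => rfl, fun _ => by simp, fun h' => absurd h' h⟩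
    · have := norm_pos_iff.1 (hε0.trans_le (hD s hs))
      exact DifferentiableAt.differentiableWithinAt (by fun_prop (disch := assumption))
    · rw [norm_div]
      exact div_le_one_of_le₀ ((mem_ball_iff_norm.1 hs).le.trans (hD s hs)) (norm_nonneg _)

/-- The sum of the integrals over the unit square of the terms of `a * H s (a, b)`. -/
noncomputable def CornerExpansion.sum {r e q : ℕ} {H : ℂ → ℝ × ℝ → ℂ}
    (E : CornerExpansion r e q H) (s : ℂ) : ℂ :=
  ∑' i, E.coeff i s * ((1 / (((r + e : ℕ) : ℂ) * (s - 1) + (E.j i + 2 : ℕ))) *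
    (1 / ((e : ℂ) * (s - 1) + (E.k i + 1 : ℕ))))

lemma CornerExpansion.exists_analytic {r e q : ℕ} {H : ℂ → ℝ × ℝ → ℂ}
    (E : CornerExpansion r e q H) (s₀ : ℂ) :
    ∃ α β : E.ι → ℂ,
      (∀ i, (((r + e : ℕ) : ℂ) * (s₀ - 1) + (E.j i + 2 : ℕ) ≠ 0 → α i = 0) ∧
        (((r + e : ℕ) : ℂ) * (s₀ - 1) + (E.j i + 2 : ℕ) = 0 → α i = 1 / (r + e : ℕ)) ∧
        ((e : ℂ) * (s₀ - 1) + (E.k i + 1 : ℕ) ≠ 0 → β i = 0) ∧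
        ((e : ℂ) * (s₀ - 1) + (E.k i + 1 : ℕ) = 0 → β i = 1 / e)) ∧
      MeromorphicAt E.sum s₀ ∧
      Tendsto (fun s => (s - s₀) ^ 2 * E.sum s) (nhdsWithin s₀ {s₀}ᶜ)
        (nhds (∑' i, E.coeff i s₀ * (α i * β i))) := by
  obtain ⟨ε₁, hε₁, h1⟩ := exists_radius_linear_factor (r + e) s₀
  obtain ⟨ε₂, hε₂, h2⟩ := exists_radius_linear_factor e s₀
  choose α hα1 hα2 hα3 hα4 hα5 using fun i => h1 (E.j i + 2) (by omega)
  choose β hβ1 hβ2 hβ3 hβ4 hβ5 using fun i => h2 (E.k i + 1) (by omega)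
  refine ⟨fun i => α i s₀, fun i => β i s₀, fun i => ⟨hα4 i, hα5 i, hβ4 i, hβ5 i⟩, ?_⟩
  set U := Metric.ball s₀ (min ε₁ ε₂)
  have hU : U ∈ nhds s₀ := Metric.ball_mem_nhds _ (lt_min hε₁ hε₂)
  have hU1 : U ⊆ Metric.ball s₀ ε₁ := Metric.ball_subset_ball (min_le_left _ _)
  have hU2 : U ⊆ Metric.ball s₀ ε₂ := Metric.ball_subset_ball (min_le_right _ _)
  obtain ⟨u, hu, hb⟩ := E.bound (‖s₀‖ + min ε₁ ε₂)
  set Φ : ℂ → ℂ := fun s => ∑' i, E.coeff i s * (α i s * β i s)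
  have hΦ : DifferentiableOn ℂ Φ U := by
    refine differentiableOn_tsum_of_summable_norm hu (fun i => ?_) Metric.isOpen_ball
      fun i s hs => ?_
    · exact (E.differentiable i).differentiableOn.mul
        (((hα1 i).mono hU1).mul ((hβ1 i).mono hU2))
    · have h3 : ‖s‖ ≤ ‖s₀‖ + min ε₁ ε₂ := by
        have h4 := norm_le_norm_add_norm_sub s₀ s
        rw [norm_sub_rev] at h4
        have h5 := mem_ball_iff_norm.1 hs
        linarith
      rw [norm_mul, norm_mul]
      refine (mul_le_of_le_one_right (norm_nonneg _) (mul_le_one₀ (hα2 i s (hU1 hs))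
        (norm_nonneg _) (hβ2 i s (hU2 hs)))).trans (hb i s h3)
  have hΦa : AnalyticAt ℂ Φ s₀ := hΦ.analyticAt hU
  have heq : ∀ᶠ s in nhdsWithin s₀ {s₀}ᶜ, Φ s = (s - s₀) ^ 2 * E.sum s := by
    filter_upwards [self_mem_nhdsWithin, nhdsWithin_le_nhds hU] with s hs hsU
    simp only [Φ, CornerExpansion.sum]
    rw [← tsum_mul_left]
    refine tsum_congr fun i => ?_
    rw [hα3 i s (hU1 hsU) hs, hβ3 i s (hU2 hsU) hs]
    ring
  refine ⟨?_, (hΦa.continuousAt.tendsto.mono_left nhdsWithin_le_nhds).congr' heq⟩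
  have hm : MeromorphicAt (fun s => ((s - s₀) ^ 2)⁻¹ * Φ s) s₀ :=
    (((MeromorphicAt.id s₀).sub (MeromorphicAt.const s₀ s₀)).pow 2).inv.mul hΦa.meromorphicAt
  refine hm.congr ?_
  filter_upwards [heq, self_mem_nhdsWithin] with s hs hne
  have := sub_ne_zero.2 (show s ≠ s₀ from hne)
  rw [hs]
  field_simp

lemma CornerExpansion.tsum_mem {r e q : ℕ} {H : ℂ → ℝ × ℝ → ℂ} (E : CornerExpansion r e q H)
    (hsum : r + e + q = 4) (he : e ≤ 1) {m : ℕ} (hm : 0 < m) {α β : E.ι → ℂ}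
    (h : ∀ i, (((r + e : ℕ) : ℂ) * (-m - 1) + (E.j i + 2 : ℕ) ≠ 0 → α i = 0) ∧
        (((r + e : ℕ) : ℂ) * (-m - 1) + (E.j i + 2 : ℕ) = 0 → α i = 1 / (r + e : ℕ)) ∧
        ((e : ℂ) * (-m - 1) + (E.k i + 1 : ℕ) ≠ 0 → β i = 0) ∧
        ((e : ℂ) * (-m - 1) + (E.k i + 1 : ℕ) = 0 → β i = 1 / e)) :
    ∑' i, E.coeff i (-m) * (α i * β i) ∈ leadingCoeffSpan m := by
  classical
  have h1 : ∀ (P n : ℕ), (P : ℂ) * (-m - 1) + n = 0 ↔ n = P * (m + 1) := fun P n => by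
    rw [← Nat.cast_inj (R := ℂ)]
    push_cast
    exact ⟨fun h => by linear_combination h, fun h => by linear_combination h⟩
  simp only [ne_eq, h1] at h
  rw [tsum_eq_sum (s := (E.finite ((r + e) * (m + 1) + e * (m + 1))).toFinset) fun i hi => ?_]
  · refine Submodule.sum_mem _ fun i _ => ?_
    by_cases hj : E.j i + 2 = (r + e) * (m + 1)
    swap
    · simp [(h i).1 hj]
    by_cases hk : E.k i + 1 = e * (m + 1)
    swap
    · simp [(h i).2.2.1 hk]
    have he1 : e = 1 := by
      interval_cases e
      · simp at hk
      · rfl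
    subst he1
    have hmem : E.coeff i (-m) ∈ leadingCoeffSpan m := by
      have h2 := E.mem m hm i
      have hr : r ≤ 3 := by omega
      interval_cases r
      · have := E.k_le rfl i
        omega
      · obtain rfl : q = 2 := by omega
        rw [show E.j i = 2 * m by omega] at h2
        exact zetaProdSpan_two_le m h2
      · obtain rfl : q = 1 := by omega
        rw [show E.j i = 3 * m + 1 by omega] at h2
        exact zetaProdSpan_one_le m h2
      · obtain rfl : q = 0 := by omega
        exact zetaProdSpan_zero_le m _ (by omega) h2
    have := Submodule.smul_mem _ ((1 / (r + 1 : ℕ) : ℚ) * (1 / (1 : ℕ))) hmem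
    rw [Rat.smul_def] at this
    rw [(h i).2.1 hj, (h i).2.2.2 hk, mul_comm]
    push_cast at this ⊢
    exact this
  · simp only [Set.Finite.mem_toFinset, Set.mem_ofPred_eq] at hi
    by_cases hj : E.j i + 2 = (r + e) * (m + 1)
    · rw [(h i).2.2.1 (by intro hk; omega), mul_zero, mul_zero]
    · rw [(h i).1 hj, zero_mul, mul_zero]

lemma integral_Ioo_cpow {w : ℂ} (hw : 0 ≤ w.re) :
    IntegrableOn (fun x : ℝ => (x : ℂ) ^ w) (Set.Ioo 0 1) ∧
      ∫ x in Set.Ioo (0 : ℝ) 1, (x : ℂ) ^ w = 1 / (w + 1) := by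
  have hw' : -1 < w.re := by linarith
  constructor
  · have := intervalIntegral.intervalIntegrable_cpow' (a := 0) (b := 1) hw'
    rwa [intervalIntegrable_iff_integrableOn_Ioo_of_le zero_le_one] at this
  · have h := integral_cpow (a := 0) (b := 1) (r := w) (Or.inl hw')
    rw [intervalIntegral.integral_of_le zero_le_one, integral_Ioc_eq_integral_Ioo] at h
    have h0 : w + 1 ≠ 0 := fun h0 => by
      have := congrArg re h0
      simp at this
      linarith
    simpa [zero_cpow h0] using h

lemma volume_restrict_unitSquare : (volume : Measure (ℝ × ℝ)).restrict unitSquare =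
    ((volume : Measure ℝ).restrict (Set.Ioo 0 1)).prod ((volume : Measure ℝ).restrict (Set.Ioo 0 1)) := by
  rw [Measure.prod_restrict, Measure.volume_eq_prod]

instance : IsFiniteMeasure ((volume : Measure (ℝ × ℝ)).restrict unitSquare) := by
  rw [volume_restrict_unitSquare]; infer_instance

lemma CornerExpansion.integrableOn_and_integral {r e q : ℕ} {H : ℂ → ℝ × ℝ → ℂ}
    (E : CornerExpansion r e q H) {s : ℂ} (hs : 1 < s.re) :
    IntegrableOn (fun p => p.1 * H s p) unitSquare ∧
      ∫ p in unitSquare, p.1 * H s p = E.sum s := by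
  have := E.countable
  obtain ⟨u, hu, hb⟩ := E.bound ‖s‖
  set A : E.ι → ℂ := fun i => ((r + e : ℕ) : ℂ) * (s - 1) + (E.j i + 1 : ℕ) with hA
  set B : E.ι → ℂ := fun i => (e : ℂ) * (s - 1) + (E.k i : ℕ) with hB
  have hAre : ∀ i, 0 ≤ (A i).re := fun i => by
    simp only [hA, add_re, mul_re, natCast_re, natCast_im, zero_mul, sub_zero, sub_re, one_re]
    have : 0 ≤ s.re - 1 := by linarith
    positivity
  have hBre : ∀ i, 0 ≤ (B i).re := fun i => by
    simp only [hB, add_re, mul_re, natCast_re, natCast_im, zero_mul, sub_zero, sub_re, one_re]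
    have : 0 ≤ s.re - 1 := by linarith
    positivity
  set T : E.ι → ℝ × ℝ → ℂ := fun i p => E.coeff i s * ((p.1 : ℂ) ^ A i * (p.2 : ℂ) ^ B i) with hT
  have hTint : ∀ i, IntegrableOn (T i) unitSquare := fun i => by
    rw [IntegrableOn, volume_restrict_unitSquare]
    exact (((integral_Ioo_cpow (hAre i)).1).mul_prod (integral_Ioo_cpow (hBre i)).1).const_mul _
  have hTval : ∀ i, ∫ p in unitSquare, T i p = E.coeff i s * ((1 / (A i + 1)) * (1 / (B i + 1))) :=
    fun i => by
      rw [volume_restrict_unitSquare, integral_const_mul, integral_prod_mul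
        (fun x : ℝ => (x : ℂ) ^ A i) (fun x : ℝ => (x : ℂ) ^ B i),
        (integral_Ioo_cpow (hAre i)).2, (integral_Ioo_cpow (hBre i)).2]
  have hTle : ∀ i, ∀ p ∈ unitSquare, ‖T i p‖ ≤ u i := fun i p hp => by
    rw [hT, norm_mul, norm_mul, norm_cpow_eq_rpow_re_of_pos hp.1.1,
      norm_cpow_eq_rpow_re_of_pos hp.2.1]
    refine (mul_le_of_le_one_right (norm_nonneg _) (mul_le_one₀
      (Real.rpow_le_one hp.1.1.le hp.1.2.le (hAre i)) (Real.rpow_nonneg hp.2.1.le _)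
      (Real.rpow_le_one hp.2.1.le hp.2.2.le (hBre i)))).trans (hb i s le_rfl)
  have hms : MeasurableSet unitSquare := measurableSet_Ioo.prod measurableSet_Ioo
  have hTsum : Summable fun i => ∫ p in unitSquare, ‖T i p‖ := by
    refine (hu.mul_right ((volume : Measure (ℝ × ℝ)).real unitSquare)).of_nonneg_of_le
      (fun i => integral_nonneg fun _ => norm_nonneg _) fun i => ?_
    have := norm_setIntegral_le_of_norm_le_const (μ := volume) (s := unitSquare)
      (f := fun p => ‖T i p‖) (C := u i) (by
        rw [← Measure.restrict_apply_univ]; exact measure_lt_top _ _)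
      (fun p hp => by simpa using hTle i p hp)
    exact (le_abs_self _).trans this
  have heq : Set.EqOn (fun p => p.1 * H s p) (fun p => ∑' i, T i p) unitSquare := fun p hp => by
    have h1 : (p.1 : ℂ) ≠ 0 := by exact_mod_cast hp.1.1.ne'
    have h2 : (p.2 : ℂ) ≠ 0 := by exact_mod_cast hp.2.1.ne'
    simp only [E.eq s hs p hp, hT]
    rw [← mul_assoc, ← tsum_mul_left]
    refine tsum_congr fun i => ?_
    rw [hA, hB, cpow_add _ _ h1, cpow_add _ _ h2, cpow_natCast, cpow_natCast]
    ring
  have hint : IntegrableOn (fun p => ∑' i, T i p) unitSquare := by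
    refine Integrable.of_bound (C := ∑' i, u i) ?_ ?_
    · refine aestronglyMeasurable_of_tendsto_ae atTop (f := fun (S : Finset E.ι) p => ∑ i ∈ S, T i p)
        (fun S => (integrable_finsetSum S fun i _ => hTint i).aestronglyMeasurable) ?_
      exact (ae_restrict_iff' hms).2 (Eventually.of_forall fun p hp =>
        (hu.of_norm_bounded fun i => hTle i p hp).hasSum)
    · refine (ae_restrict_iff' hms).2 (Eventually.of_forall fun p hp => ?_)
      exact tsum_of_norm_bounded hu.hasSum fun i => hTle i p hp
  refine ⟨(integrableOn_congr_fun heq hms).2 hint, ?_⟩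
  rw [setIntegral_congr_fun hms heq]
  rw [← (hasSum_integral_of_summable_integral_norm hTint hTsum).tsum_eq, CornerExpansion.sum]
  refine tsum_congr fun i => ?_
  rw [hTval i, hA, hB]
  push_cast
  ring_nf

lemma CornerExpansion.hasMeromorphicExtension {r e q : ℕ} {H : ℂ → ℝ × ℝ → ℂ}
    (E : CornerExpansion r e q H) (hsum : r + e + q = 4) (he : e ≤ 1) :
    HasMeromorphicExtension fun s => ∫ p in unitSquare, p.1 * H s p := by
  refine ⟨E.sum, fun z => ?_, fun s hs => (E.integrableOn_and_integral hs).2.symm, fun m hm => ?_⟩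
  · obtain ⟨α, β, _, h, _⟩ := E.exists_analytic z
    exact h
  · obtain ⟨α, β, h, _, ht⟩ := E.exists_analytic (-m)
    exact ⟨_, E.tsum_mem hsum he hm h, by simpa using ht⟩

lemma HasMeromorphicExtension.congr {I J : ℂ → ℂ} (h : HasMeromorphicExtension I)
    (hIJ : ∀ s : ℂ, 1 < s.re → J s = I s) : HasMeromorphicExtension J := by
  obtain ⟨F, h1, h2, h3⟩ := h
  exact ⟨F, h1, fun s hs => (h2 s hs).trans (hIJ s hs).symm, h3⟩

lemma HasMeromorphicExtension.add {I J : ℂ → ℂ} (hI : HasMeromorphicExtension I)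
    (hJ : HasMeromorphicExtension J) : HasMeromorphicExtension fun s => I s + J s := by
  obtain ⟨F, hF1, hF2, hF3⟩ := hI
  obtain ⟨G, hG1, hG2, hG3⟩ := hJ
  refine ⟨fun s => F s + G s, fun z => (hF1 z).add (hG1 z),
    fun s hs => by simp only [hF2 s hs, hG2 s hs], fun m hm => ?_⟩
  obtain ⟨L, hL, hL'⟩ := hF3 m hm
  obtain ⟨M, hM, hM'⟩ := hG3 m hm
  exact ⟨L + M, Submodule.add_mem _ hL hM, (hL'.add hM').congr fun s => by ring⟩

lemma HasMeromorphicExtension.mul {I g : ℂ → ℂ} (hI : HasMeromorphicExtension I)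
    (hg : ∀ z, MeromorphicAt g z)
    (hgm : ∀ m : ℕ, 0 < m → ContinuousAt g (-m) ∧ ∃ r : ℚ, g (-m) = r) :
    HasMeromorphicExtension fun s => g s * I s := by
  obtain ⟨F, hF1, hF2, hF3⟩ := hI
  refine ⟨fun s => g s * F s, fun z => (hg z).mul (hF1 z),
    fun s hs => by simp only [hF2 s hs], fun m hm => ?_⟩
  obtain ⟨L, hL, hL'⟩ := hF3 m hm
  obtain ⟨hc, r, hr⟩ := hgm m hm
  refine ⟨r • L, Submodule.smul_mem _ _ hL, ?_⟩
  rw [Rat.smul_def, ← hr]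
  exact ((hc.tendsto.mono_left nhdsWithin_le_nhds).mul hL').congr fun s => by ring

/-- `H` is a finite sum of functions having corner expansions of total order `N` and edge order
at most `c`. -/
inductive Expandable (N c : ℕ) : (ℂ → ℝ × ℝ → ℂ) → Prop
  | of {r e q : ℕ} {H : ℂ → ℝ × ℝ → ℂ} (E : CornerExpansion r e q H) (h : r + e + q = N)
    (he : e ≤ c) : Expandable N c H
  | add {H H' : ℂ → ℝ × ℝ → ℂ} (h : Expandable N c H) (h' : Expandable N c H') :
    Expandable N c fun s p => H s p + H' s p
  | congr {H H' : ℂ → ℝ × ℝ → ℂ} (h : Expandable N c H)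
    (h' : ∀ s : ℂ, 1 < s.re → ∀ p ∈ unitSquare, H' s p = H s p) : Expandable N c H'

lemma Expandable.mul {N c N' c' : ℕ} {H H' : ℂ → ℝ × ℝ → ℂ} (h : Expandable N c H)
    (h' : Expandable N' c' H') : Expandable (N + N') (c + c') fun s p => H s p * H' s p := by
  induction h with
  | of E hE he =>
    induction h' with
    | of E' hE' he' => exact .of (E.mul E') (by omega) (by omega)
    | add _ _ ih1 ih2 => exact .congr (.add ih1 ih2) fun s _ p _ => mul_add _ _ _
    | congr _ h ih => exact .congr ih fun s hs p hp => by rw [h s hs p hp]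
  | add _ _ ih1 ih2 => exact .congr (.add ih1 ih2) fun s _ p _ => add_mul _ _ _
  | congr _ h ih => exact .congr ih fun s hs p hp => by rw [h s hs p hp]

lemma measurableSet_unitSquare : MeasurableSet unitSquare :=
  measurableSet_Ioo.prod measurableSet_Ioo

lemma Expandable.integrableOn_and_hasMeromorphicExtension {H : ℂ → ℝ × ℝ → ℂ}
    (h : Expandable 4 1 H) :
    (∀ s : ℂ, 1 < s.re → IntegrableOn (fun p => p.1 * H s p) unitSquare) ∧
      HasMeromorphicExtension fun s => ∫ p in unitSquare, p.1 * H s p := by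
  induction h with
  | of E h he =>
    exact ⟨fun s hs => (E.integrableOn_and_integral hs).1, E.hasMeromorphicExtension h he⟩
  | add _ _ ih1 ih2 =>
    simp only [mul_add]
    refine ⟨fun s hs => (ih1.1 s hs).add (ih2.1 s hs), (ih1.2.add ih2.2).congr fun s hs => ?_⟩
    exact integral_add (ih1.1 s hs) (ih2.1 s hs)
  | congr _ h ih =>
    refine ⟨fun s hs => (ih.1 s hs).congr_fun (fun p hp => ?_) measurableSet_unitSquare,
      ih.2.congr fun s hs => setIntegral_congr_fun measurableSet_unitSquare fun p hp => ?_⟩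
    · simp only [h s hs p hp]
    · simp only [h s hs p hp]

/-- `ζ(1 - s, x)` -/
noncomputable def reflZeta (s : ℂ) (x : ℝ) : ℂ := hurwitzZeta (x : UnitAddCircle) (1 - s)

lemma reflZeta_add_one (s : ℂ) (x : ℝ) : reflZeta s (x + 1) = reflZeta s x := by
  simp [reflZeta]

lemma expandable_half (α β : ℚ) (h : |(α : ℝ)| + |(β : ℝ)| < 1 / 2) :
    Expandable 1 0 fun s p => s * reflZeta s (1 / 2 + p.1 * (α + β * p.2)) := by
  refine .congr (.of (.regular (Or.inr rfl) α β h) rfl le_rfl) fun s hs p hp => ?_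
  refine mul_hurwitzZeta_half ?_ (ne_zero_of_one_lt_re hs)
  have h1 : |(α : ℝ) + β * p.2| ≤ |(α : ℝ)| + |(β : ℝ)| := by
    refine (abs_add_le _ _).trans (add_le_add le_rfl ?_)
    rw [abs_mul, abs_of_pos hp.2.1]
    exact mul_le_of_le_one_right (abs_nonneg _) hp.2.2.le
  rw [abs_mul, abs_of_pos hp.1.1]
  exact (mul_le_of_le_one_left (abs_nonneg _) hp.1.2.le).trans_lt (h1.trans_lt h)

lemma expandable_vertex (α β : ℚ) (hα : |β| < α) (h : α + |β| < 1) {σ : ℝ} (hσ : σ = 1 ∨ σ = -1) :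
    Expandable 1 0 fun s p => s * reflZeta s (σ * (p.1 * (α + β * p.2))) := by
  have hα0 : 0 < α := (abs_nonneg _).trans_lt hα
  have hmem : ∀ p ∈ unitSquare, (p.1 * (α + β * p.2) : ℝ) ∈ Set.Ioo (0 : ℝ) 1 := fun p hp => by
    have h1 : |(β : ℝ) * p.2| ≤ |(β : ℝ)| := by
      rw [abs_mul, abs_of_pos hp.2.1]
      exact mul_le_of_le_one_right (abs_nonneg _) hp.2.2.le
    have h2 : |(β : ℝ)| < α := by exact_mod_cast hα
    have h3 : (α : ℝ) + |(β : ℝ)| < 1 := by exact_mod_cast h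
    have h4 := abs_le.1 h1
    have h5 : 0 < (α : ℝ) + β * p.2 := by linarith
    exact ⟨mul_pos hp.1.1 h5, (mul_le_of_le_one_left h5.le hp.1.2.le).trans_lt (by linarith)⟩
  rcases hσ with rfl | rfl
  · refine .congr (.add (.of (.vertex α β hα0 hα) rfl le_rfl)
      (.of (.regular (Or.inl rfl) α β ?_) rfl le_rfl)) fun s hs p hp => ?_
    · rw [abs_of_pos (by exact_mod_cast hα0)]; exact_mod_cast h
    · rw [one_mul]
      exact mul_hurwitzZeta_pos (hmem p hp) (ne_zero_of_one_lt_re hs)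
  · refine .congr (.of (.regular (Or.inl rfl) (-α) (-β) ?_) rfl le_rfl) fun s hs p hp => ?_
    · push_cast
      rw [abs_neg, abs_neg, abs_of_pos (by exact_mod_cast hα0)]; exact_mod_cast h
    · rw [neg_one_mul]
      refine (mul_hurwitzZeta_neg (hmem p hp) (ne_zero_of_one_lt_re hs)).trans ?_
      congr 1
      push_cast
      ring

lemma expandable_edge (β : ℚ) (hβ : 0 < β) (hβ1 : β < 1) {σ : ℝ} (hσ : σ = 1 ∨ σ = -1) :
    Expandable 1 1 fun s p => s * reflZeta s (σ * (β * p.1 * p.2)) := by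
  have hβ' : (0 : ℝ) < β := by exact_mod_cast hβ
  have hβ1' : (β : ℝ) < 1 := by exact_mod_cast hβ1
  have hmem : ∀ p ∈ unitSquare, (β * p.1 * p.2 : ℝ) ∈ Set.Ioo (0 : ℝ) 1 := fun p hp => by
    have h1 := hp.1.1
    have h2 := hp.2.1
    refine ⟨by positivity, ?_⟩
    calc _ ≤ (β : ℝ) * 1 * 1 := by
          have := hp.1.2.le
          have := hp.2.2.le
          gcongr
      _ < 1 := by linarith
  rcases hσ with rfl | rfl
  · refine .congr (.add (.of (.edge β hβ) rfl le_rfl)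
      (.of (.regular (Or.inl rfl) 0 β ?_) rfl zero_le_one)) fun s hs p hp => ?_
    · rw [abs_of_pos hβ']; simpa using hβ1'
    · rw [one_mul]
      refine (mul_hurwitzZeta_pos (hmem p hp) (ne_zero_of_one_lt_re hs)).trans ?_
      congr 2
      push_cast
      ring
  · refine .congr (.of (.regular (Or.inl rfl) 0 (-β) ?_) rfl zero_le_one) fun s hs p hp => ?_
    · push_cast
      rw [abs_neg, abs_of_pos hβ']; simpa using hβ1'
    · rw [neg_one_mul]
      refine (mul_hurwitzZeta_neg (hmem p hp) (ne_zero_of_one_lt_re hs)).trans ?_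
      congr 1
      push_cast
      ring

/-- The map `(a, b) ↦ (u + a (α + β b), v + a (γ + δ b))`. -/
def cornerChart (u v α β γ δ : ℝ) (p : ℝ × ℝ) : ℝ × ℝ :=
  (u + p.1 * (α + β * p.2), v + p.1 * (γ + δ * p.2))

lemma injOn_cornerChart (u v : ℝ) {α β γ δ : ℝ} (hd : α * δ - β * γ ≠ 0) :
    Set.InjOn (cornerChart u v α β γ δ) unitSquare := by
  rintro ⟨a, b⟩ h ⟨a', b'⟩ h' heq
  simp only [cornerChart, Prod.mk.injEq, add_right_inj] at heq
  obtain ⟨h1, h2⟩ := heq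
  have ha : a = a' := mul_left_cancel₀ hd (by linear_combination δ * h1 - β * h2)
  have hab : a * b = a' * b' := mul_left_cancel₀ hd (by linear_combination α * h2 - γ * h1)
  have h0 : 0 < a := h.1.1
  subst ha
  exact Prod.ext rfl (mul_left_cancel₀ h0.ne' hab)

lemma setIntegral_image_cornerChart (u v : ℝ) {α β γ δ : ℝ} (hd : α * δ - β * γ ≠ 0)
    (g : ℝ × ℝ → ℂ) :
    ∫ p in cornerChart u v α β γ δ '' unitSquare, g p =
      (|α * δ - β * γ| : ℝ) * ∫ p in unitSquare, p.1 * g (cornerChart u v α β γ δ p) := by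
  have hderiv : ∀ p : ℝ × ℝ, HasFDerivAt (cornerChart u v α β γ δ) (LinearMap.toContinuousLinearMap
      (Matrix.toLin (Module.Basis.finTwoProd ℝ) (Module.Basis.finTwoProd ℝ)
        !![α + β * p.2, p.1 * β; γ + δ * p.2, p.1 * δ])) p := fun p => by
    rw [Matrix.toLin_finTwoProd_toContinuousLinearMap]
    have h1 : HasFDerivAt (fun p : ℝ × ℝ => p.1) (ContinuousLinearMap.fst ℝ ℝ ℝ) p := hasFDerivAt_fst
    have h2 : HasFDerivAt (fun p : ℝ × ℝ => p.2) (ContinuousLinearMap.snd ℝ ℝ ℝ) p := hasFDerivAt_snd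
    refine HasFDerivAt.prodMk ?_ ?_
    · refine ((h1.mul ((h2.const_mul β).const_add α)).const_add u).congr_fderiv ?_
      ext <;> simp [mul_comm]
    · refine ((h1.mul ((h2.const_mul δ).const_add γ)).const_add v).congr_fderiv ?_
      ext <;> simp [mul_comm]
  rw [integral_image_eq_integral_abs_det_fderiv_smul volume measurableSet_unitSquare
    (fun p _ => (hderiv p).hasFDerivWithinAt) (injOn_cornerChart u v hd), ← integral_const_mul]
  refine setIntegral_congr_fun measurableSet_unitSquare fun p hp => ?_
  have hdet : (LinearMap.toContinuousLinearMap
      (Matrix.toLin (Module.Basis.finTwoProd ℝ) (Module.Basis.finTwoProd ℝ)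
        !![α + β * p.2, p.1 * β; γ + δ * p.2, p.1 * δ])).det = p.1 * (α * δ - β * γ) := by
    conv_lhs => rw [LinearMap.det_toContinuousLinearMap, LinearMap.det_toLin, Matrix.det_fin_two_of]
    ring
  simp only [hdet, abs_mul, abs_of_pos hp.1.1, real_smul, ofReal_mul]
  ring

lemma hasMeromorphicExtension_chart {u v : ℝ} {α β γ δ d : ℚ} (hd : (α * δ - β * γ) = d)
    (hd0 : d ≠ 0) {g : ℂ → ℝ × ℝ → ℂ}
    (hg : Expandable 4 1 fun s p => s ^ 4 * g s (cornerChart u v α β γ δ p)) :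
    HasMeromorphicExtension fun s => ∫ p in cornerChart u v α β γ δ '' unitSquare, g s p := by
  have hd' : (α * δ - β * γ : ℝ) = d := by exact_mod_cast hd
  have h1 := hg.integrableOn_and_hasMeromorphicExtension.2
  refine (h1.mul (g := fun s => (|d| : ℚ) * (s ^ 4)⁻¹) (fun z => ?_) fun m hm => ⟨?_, ?_⟩).congr
    fun s hs => ?_
  · exact (MeromorphicAt.const _ z).mul ((MeromorphicAt.id z).pow 4).inv
  · have : (-(m : ℂ)) ^ 4 ≠ 0 := pow_ne_zero _ (neg_ne_zero.2 (by exact_mod_cast hm.ne'))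
    fun_prop (disch := assumption)
  · exact ⟨|d| * ((-m : ℚ) ^ 4)⁻¹, by push_cast; rfl⟩
  · have hs4 : s ^ 4 ≠ 0 := pow_ne_zero _ (ne_zero_of_one_lt_re hs)
    rw [setIntegral_image_cornerChart u v (by rw [hd']; exact_mod_cast hd0), hd', mul_assoc,
      ← integral_const_mul (s ^ 4)⁻¹]
    congr 1
    · rw [← Rat.cast_abs, ofReal_ratCast]
    · refine setIntegral_congr_fun measurableSet_unitSquare fun p hp => ?_
      rw [mul_left_comm, inv_mul_cancel_left₀ hs4]

/-- `ζ(1 - s, σ₁ x) ζ(1 - s, σ₂ y) ζ(1 - s, σ₃ (x - y)) ζ(1 - s, σ₄ (x + y))` -/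
noncomputable def signedProd (σ₁ σ₂ σ₃ σ₄ : ℝ) (s : ℂ) (p : ℝ × ℝ) : ℂ :=
  reflZeta s (σ₁ * p.1) * reflZeta s (σ₂ * p.2) * reflZeta s (σ₃ * (p.1 - p.2)) *
    reflZeta s (σ₄ * (p.1 + p.2))

section signs

variable {σ₁ σ₂ σ₃ σ₄ : ℝ}

lemma expandable_signedProd_chart_zero (h₁ : σ₁ = 1 ∨ σ₁ = -1) (h₂ : σ₂ = 1 ∨ σ₂ = -1)
    (h₃ : σ₃ = 1 ∨ σ₃ = -1) (h₄ : σ₄ = 1 ∨ σ₄ = -1) :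
    Expandable 4 1 fun s p => s ^ 4 * signedProd σ₁ σ₂ σ₃ σ₄ s
      (cornerChart 0 0 (1 / 2 : ℚ) (0 : ℚ) (0 : ℚ) (1 / 4 : ℚ) p) := by
  refine .congr ((((expandable_vertex (1 / 2) 0 (by norm_num) (by norm_num) h₁).mul
    (expandable_edge (1 / 4) (by norm_num) (by norm_num) h₂)).mul
    (expandable_vertex (1 / 2) (-1 / 4) (by norm_num [abs_div]) (by norm_num [abs_div]) h₃)).mul
    (expandable_vertex (1 / 2) (1 / 4) (by norm_num) (by norm_num) h₄)) fun s hs p hp => ?_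
  simp only [signedProd, cornerChart]
  push_cast
  ring_nf

lemma expandable_signedProd_chart_third (h₁ : σ₁ = 1 ∨ σ₁ = -1) (h₂ : σ₂ = 1 ∨ σ₂ = -1)
    (h₃ : σ₃ = 1 ∨ σ₃ = -1) (h₄ : σ₄ = 1 ∨ σ₄ = -1) :
    Expandable 4 1 fun s p => s ^ 4 * signedProd σ₁ σ₂ σ₃ σ₄ s
      (cornerChart 0 0 (1 / 3 : ℚ) (1 / 6 : ℚ) (1 / 3 : ℚ) (-1 / 12 : ℚ) p) := by
  refine .congr ((((expandable_vertex (1 / 3) (1 / 6) (by norm_num) (by norm_num) h₁).mul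
    (expandable_vertex (1 / 3) (-1 / 12) (by norm_num [abs_div]) (by norm_num [abs_div]) h₂)).mul
    (expandable_edge (1 / 4) (by norm_num) (by norm_num) h₃)).mul
    (expandable_vertex (2 / 3) (1 / 12) (by norm_num) (by norm_num) h₄)) fun s hs p hp => ?_
  simp only [signedProd, cornerChart]
  push_cast
  ring_nf

lemma reflZeta_sign_mul_one_add (s : ℂ) (x : ℝ) {σ : ℝ} (hσ : σ = 1 ∨ σ = -1) :
    reflZeta s (σ * (1 + x)) = reflZeta s (-σ * -x) := by
  rcases hσ with rfl | rfl
  · rw [← reflZeta_add_one s (-1 * -x)]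
    ring_nf
  · rw [← reflZeta_add_one s (-1 * (1 + x))]
    ring_nf

lemma expandable_sign_half (α β : ℚ) (h : |(α : ℝ)| + |(β : ℝ)| < 1 / 2) {σ : ℝ}
    (hσ : σ = 1 ∨ σ = -1) :
    Expandable 1 0 fun s p => s * reflZeta s (σ * (1 / 2 + p.1 * (α + β * p.2))) := by
  rcases hσ with rfl | rfl
  · simpa using expandable_half α β h
  · refine .congr (expandable_half (-α) (-β) (by simpa using h)) fun s hs p hp => ?_
    rw [← reflZeta_add_one s (-1 * _)]
    push_cast
    ring_nf

lemma expandable_signedProd_chart_half (h₁ : σ₁ = 1 ∨ σ₁ = -1) (h₂ : σ₂ = 1 ∨ σ₂ = -1)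
    (h₃ : σ₃ = 1 ∨ σ₃ = -1) (h₄ : σ₄ = 1 ∨ σ₄ = -1) :
    Expandable 4 1 fun s p => s ^ 4 * signedProd σ₁ σ₂ σ₃ σ₄ s
      (cornerChart (1 / 2) (1 / 2) (-1 / 6 : ℚ) (1 / 6 : ℚ) (-1 / 6 : ℚ) (-1 / 12 : ℚ) p) := by
  refine .congr ((((expandable_sign_half (-1 / 6) (1 / 6) (by norm_num [abs_div]) h₁).mul
    (expandable_sign_half (-1 / 6) (-1 / 12) (by norm_num [abs_div]) h₂)).mul
    (expandable_edge (1 / 4) (by norm_num) (by norm_num) h₃)).mul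
    (expandable_vertex (1 / 3) (-1 / 12) (by norm_num [abs_div]) (by norm_num [abs_div])
      (σ := -σ₄) (by rcases h₄ with rfl | rfl <;> simp))) fun s hs p hp => ?_
  simp only [signedProd, cornerChart]
  rw [show (1 / 2 + p.1 * (((-1 / 6 : ℚ) : ℝ) + ((1 / 6 : ℚ) : ℝ) * p.2) +
      (1 / 2 + p.1 * (((-1 / 6 : ℚ) : ℝ) + ((-1 / 12 : ℚ) : ℝ) * p.2))) =
      1 + -(p.1 * (1 / 3 + -1 / 12 * p.2)) by push_cast; ring,
    reflZeta_sign_mul_one_add s _ h₄]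
  push_cast
  ring_nf

/-- The triangle `0 < y < x < 1/2`. -/
def alcoveTriangle : Set (ℝ × ℝ) := {p | 0 < p.2 ∧ p.2 < p.1 ∧ p.1 < 1 / 2}

lemma image_cornerChart_zero :
    cornerChart 0 0 (1 / 2 : ℚ) (0 : ℚ) (0 : ℚ) (1 / 4 : ℚ) '' unitSquare =
      {p | 0 < p.2 ∧ 2 * p.2 < p.1 ∧ p.1 < 1 / 2} := by
  ext ⟨x, y⟩
  simp only [Set.mem_image, Prod.exists, cornerChart, Prod.mk.injEq, Set.mem_prod, Set.mem_Ioo,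
    Set.mem_ofPred_eq]
  push_cast
  constructor
  · rintro ⟨a, b, ⟨⟨ha0, ha1⟩, hb0, hb1⟩, rfl, rfl⟩
    refine ⟨by ring_nf; positivity, by nlinarith, by linarith⟩
  · rintro ⟨h1, h2, h3⟩
    have hx : 0 < x := by linarith
    refine ⟨2 * x, 2 * y / x, ⟨⟨by linarith, by linarith⟩, by positivity,
      by rwa [div_lt_one hx]⟩, by ring, by field_simp; ring⟩

lemma image_cornerChart_third :
    cornerChart 0 0 (1 / 3 : ℚ) (1 / 6 : ℚ) (1 / 3 : ℚ) (-1 / 12 : ℚ) '' unitSquare =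
      {p | p.1 < 2 * p.2 ∧ p.2 < p.1 ∧ p.1 + 2 * p.2 < 1} := by
  ext ⟨x, y⟩
  simp only [Set.mem_image, Prod.exists, cornerChart, Prod.mk.injEq, Set.mem_prod, Set.mem_Ioo,
    Set.mem_ofPred_eq]
  push_cast
  constructor
  · rintro ⟨a, b, ⟨⟨ha0, ha1⟩, hb0, hb1⟩, rfl, rfl⟩
    have := mul_pos ha0 hb0
    refine ⟨by nlinarith, by nlinarith, by linarith⟩
  · rintro ⟨h1, h2, h3⟩
    have ha : 0 < x + 2 * y := by linarith
    refine ⟨x + 2 * y, 4 * (x - y) / (x + 2 * y), ⟨⟨ha, by linarith⟩,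
      div_pos (by linarith) ha, by rw [div_lt_one ha]; linarith⟩, ?_, ?_⟩ <;> field_simp <;> ring

lemma image_cornerChart_half :
    cornerChart (1 / 2) (1 / 2) (-1 / 6 : ℚ) (1 / 6 : ℚ) (-1 / 6 : ℚ) (-1 / 12 : ℚ) '' unitSquare =
      {p | p.2 < p.1 ∧ p.1 < 1 / 2 ∧ 1 < p.1 + 2 * p.2} := by
  ext ⟨x, y⟩
  simp only [Set.mem_image, Prod.exists, cornerChart, Prod.mk.injEq, Set.mem_prod, Set.mem_Ioo,
    Set.mem_ofPred_eq]
  push_cast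
  constructor
  · rintro ⟨a, b, ⟨⟨ha0, ha1⟩, hb0, hb1⟩, rfl, rfl⟩
    have := mul_pos ha0 hb0
    refine ⟨by nlinarith, by nlinarith, by linarith⟩
  · rintro ⟨h1, h2, h3⟩
    have ha : 0 < 3 - 2 * x - 4 * y := by linarith
    refine ⟨3 - 2 * x - 4 * y, 4 * (x - y) / (3 - 2 * x - 4 * y), ⟨⟨ha, by linarith⟩,
      div_pos (by linarith) ha, by rw [div_lt_one ha]; linarith⟩, ?_, ?_⟩ <;> field_simp <;> ring

lemma volume_line (c d : ℝ) : volume {p : ℝ × ℝ | p.2 = c * p.1 + d} = 0 := by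
  have hm : MeasurableSet {p : ℝ × ℝ | p.2 = c * p.1 + d} :=
    (isClosed_eq (by fun_prop) (by fun_prop)).measurableSet
  rw [Measure.volume_eq_prod, Measure.measure_prod_null hm]
  refine Eventually.of_forall fun x => ?_
  have : Prod.mk x ⁻¹' {p : ℝ × ℝ | p.2 = c * p.1 + d} = {c * x + d} := by
    ext y; simp
  simp [this]

lemma continuous_expZeta {s : ℂ} (hs : 1 < s.re) :
    Continuous fun x : ℝ => expZeta (x : UnitAddCircle) s := by
  have h := fun x : ℝ => (hasSum_expZeta_of_one_lt_re x hs).tsum_eq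
  simp only [← h]
  refine continuous_tsum (u := fun n : ℕ => 1 / (n : ℝ) ^ s.re) (fun n => by fun_prop)
    (Real.summable_one_div_nat_rpow.2 hs) fun n x => ?_
  rw [norm_div]
  rcases Nat.eq_zero_or_pos n with rfl | hn
  · rw [Nat.cast_zero, zero_cpow (ne_zero_of_one_lt_re hs), norm_zero, div_zero]
    positivity
  · rw [norm_natCast_cpow_of_pos hn]
    gcongr
    rw [show 2 * Real.pi * I * x * n = ((2 * Real.pi * x * n : ℝ) : ℂ) * I by push_cast; ring,
      norm_exp_ofReal_mul_I]

lemma continuous_reflZeta {s : ℂ} (hs : 1 < s.re) : Continuous (reflZeta s) := by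
  have h : reflZeta s = fun x : ℝ => (2 * Real.pi) ^ (-s) * Gamma s *
      (exp (-Real.pi * I * s / 2) * expZeta (x : UnitAddCircle) s +
        exp (Real.pi * I * s / 2) * expZeta ((-x : ℝ) : UnitAddCircle) s) := by
    funext x
    rw [reflZeta, hurwitzZeta_one_sub _ (fun n h => ?_) (Or.inr (fun h => ?_))]
    · rfl
    · rw [h] at hs
      simp at hs
      linarith [(Nat.cast_nonneg n : (0 : ℝ) ≤ n)]
    · rw [h] at hs
      simp at hs
  rw [h]
  have h1 := continuous_expZeta hs
  have h2 := h1.comp continuous_neg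
  simp only [Function.comp_def] at h2
  fun_prop

lemma continuous_signedProd (σ₁ σ₂ σ₃ σ₄ : ℝ) {s : ℂ} (hs : 1 < s.re) :
    Continuous (signedProd σ₁ σ₂ σ₃ σ₄ s) := by
  have := continuous_reflZeta hs
  unfold signedProd
  fun_prop

lemma alcoveTriangle_ae_eq : alcoveTriangle =ᵐ[volume]
    ({p | 0 < p.2 ∧ 2 * p.2 < p.1 ∧ p.1 < 1 / 2} ∪ ({p | p.1 < 2 * p.2 ∧ p.2 < p.1 ∧
      p.1 + 2 * p.2 < 1} ∪ {p | p.2 < p.1 ∧ p.1 < 1 / 2 ∧ 1 < p.1 + 2 * p.2}) : Set (ℝ × ℝ)) := by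
  refine ae_eq_set.2 ⟨measure_mono_null ?_ (measure_union_null (volume_line (1 / 2) 0)
    (volume_line (-1 / 2) (1 / 2))), measure_mono_null ?_ measure_empty⟩
  · rintro ⟨x, y⟩ ⟨⟨h1, h2, h3⟩, h4⟩
    simp only [Set.mem_union, Set.mem_ofPred_eq, not_or, not_and, not_lt] at h4 h1 h2 h3 ⊢
    obtain ⟨h4, h5, h6⟩ := h4
    rcases lt_trichotomy x (2 * y) with h | h | h
    · right
      linarith [h5 h h2, h6 h2 h3]
    · left
      linarith
    · exact absurd h3 (not_lt.2 (h4 h1 h))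
  · rintro ⟨x, y⟩ ⟨h | h | h, h'⟩ <;> refine h' ?_ <;>
      simp only [Set.mem_ofPred_eq, alcoveTriangle] at h ⊢ <;>
      exact ⟨by linarith, by linarith, by linarith⟩

lemma setIntegral_alcoveTriangle {g : ℝ × ℝ → ℂ} (hg : Continuous g) :
    ∫ p in alcoveTriangle, g p = (∫ p in {p | 0 < p.2 ∧ 2 * p.2 < p.1 ∧ p.1 < 1 / 2}, g p) +
      ((∫ p in {p | p.1 < 2 * p.2 ∧ p.2 < p.1 ∧ p.1 + 2 * p.2 < 1}, g p) +
        ∫ p in {p | p.2 < p.1 ∧ p.1 < 1 / 2 ∧ 1 < p.1 + 2 * p.2}, g p) := by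
  have hint : ∀ S ⊆ Set.Icc ((0, 0) : ℝ × ℝ) (1, 1), IntegrableOn g S := fun S hS =>
    hg.integrableOn_Icc.mono_set hS
  have hm2 : MeasurableSet {p : ℝ × ℝ | p.1 < 2 * p.2 ∧ p.2 < p.1 ∧ p.1 + 2 * p.2 < 1} := by
    measurability
  have hm3 : MeasurableSet {p : ℝ × ℝ | p.2 < p.1 ∧ p.1 < 1 / 2 ∧ 1 < p.1 + 2 * p.2} := by
    measurability
  have hs1 : {p : ℝ × ℝ | 0 < p.2 ∧ 2 * p.2 < p.1 ∧ p.1 < 1 / 2} ⊆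
      Set.Icc ((0, 0) : ℝ × ℝ) (1, 1) := by
    rintro ⟨x, y⟩ h
    simp only [Set.mem_ofPred_eq, Set.mem_Icc, Prod.mk_le_mk] at h ⊢
    exact ⟨⟨by linarith, by linarith⟩, by linarith, by linarith⟩
  have hs2 : {p : ℝ × ℝ | p.1 < 2 * p.2 ∧ p.2 < p.1 ∧ p.1 + 2 * p.2 < 1} ⊆
      Set.Icc ((0, 0) : ℝ × ℝ) (1, 1) := by
    rintro ⟨x, y⟩ h
    simp only [Set.mem_ofPred_eq, Set.mem_Icc, Prod.mk_le_mk] at h ⊢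
    exact ⟨⟨by linarith, by linarith⟩, by linarith, by linarith⟩
  have hs3 : {p : ℝ × ℝ | p.2 < p.1 ∧ p.1 < 1 / 2 ∧ 1 < p.1 + 2 * p.2} ⊆
      Set.Icc ((0, 0) : ℝ × ℝ) (1, 1) := by
    rintro ⟨x, y⟩ h
    simp only [Set.mem_ofPred_eq, Set.mem_Icc, Prod.mk_le_mk] at h ⊢
    exact ⟨⟨by linarith, by linarith⟩, by linarith, by linarith⟩
  rw [setIntegral_congr_set alcoveTriangle_ae_eq, setIntegral_union ?_ (hm2.union hm3) (hint _ hs1)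
    ((hint _ hs2).union (hint _ hs3)), setIntegral_union ?_ hm3 (hint _ hs2) (hint _ hs3)]
  · refine Set.disjoint_left.2 ?_
    rintro ⟨x, y⟩ h h'
    simp only [Set.mem_ofPred_eq] at h h'
    linarith
  · refine Set.disjoint_left.2 ?_
    rintro ⟨x, y⟩ h (h' | h')
    · simp only [Set.mem_ofPred_eq] at h h'
      linarith
    · simp only [Set.mem_ofPred_eq] at h h'
      linarith

lemma hasMeromorphicExtension_alcoveTriangle (h₁ : σ₁ = 1 ∨ σ₁ = -1) (h₂ : σ₂ = 1 ∨ σ₂ = -1)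
    (h₃ : σ₃ = 1 ∨ σ₃ = -1) (h₄ : σ₄ = 1 ∨ σ₄ = -1) :
    HasMeromorphicExtension fun s => ∫ p in alcoveTriangle, signedProd σ₁ σ₂ σ₃ σ₄ s p := by
  have c1 := hasMeromorphicExtension_chart (d := 1 / 8) (by norm_num) (by norm_num)
    (expandable_signedProd_chart_zero h₁ h₂ h₃ h₄)
  have c2 := hasMeromorphicExtension_chart (d := -1 / 12) (by norm_num) (by norm_num)
    (expandable_signedProd_chart_third h₁ h₂ h₃ h₄)
  have c3 := hasMeromorphicExtension_chart (d := 1 / 24) (by norm_num) (by norm_num)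
    (expandable_signedProd_chart_half h₁ h₂ h₃ h₄)
  rw [image_cornerChart_zero] at c1
  rw [image_cornerChart_third] at c2
  rw [image_cornerChart_half] at c3
  exact (c1.add (c2.add c3)).congr fun s hs =>
    setIntegral_alcoveTriangle (continuous_signedProd σ₁ σ₂ σ₃ σ₄ hs)

end signs

lemma setIntegral_Ioo_prod_Ioo {a b c d : ℝ} (hab : a ≤ b) (hcd : c ≤ d) {g : ℝ × ℝ → ℂ}
    (hg : Continuous g) :
    ∫ p in Set.Ioo a b ×ˢ Set.Ioo c d, g p = ∫ y in c..d, ∫ x in a..b, g (x, y) := by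
  have hint : IntegrableOn (fun p : ℝ × ℝ => g p.swap) (Set.Ioo c d ×ˢ Set.Ioo a b) := by
    refine ((hg.comp continuous_swap).integrableOn_Icc (a := (c, a)) (b := (d, b))).mono_set ?_
    rintro ⟨x, y⟩ ⟨h, h'⟩
    exact ⟨⟨h.1.le, h'.1.le⟩, h.2.le, h'.2.le⟩
  rw [Measure.volume_eq_prod, ← setIntegral_prod_swap, setIntegral_prod _ hint,
    intervalIntegral.integral_of_le hcd, integral_Ioc_eq_integral_Ioo]
  simp only [Prod.swap_prod_mk, intervalIntegral.integral_of_le hab, integral_Ioc_eq_integral_Ioo]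

lemma Function.Periodic.integral_eq_integral_half {g : ℝ → ℂ} (hp : Function.Periodic g 1)
    (hg : Continuous g) :
    ∫ x in (0 : ℝ)..1, g x = ∫ x in (0 : ℝ)..(1 / 2), (g x + g (-x)) := by
  have h := hp.intervalIntegral_add_eq 0 (-(1 / 2))
  rw [intervalIntegral.integral_add (hg.intervalIntegrable _ _)
    ((hg.comp' continuous_neg).intervalIntegrable _ _), intervalIntegral.integral_comp_neg, add_comm,
    neg_zero, intervalIntegral.integral_add_adjacent_intervals (hg.intervalIntegrable _ _)
    (hg.intervalIntegrable _ _)]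
  norm_num at h ⊢
  exact h

lemma setIntegral_half_square {g : ℝ × ℝ → ℂ} (hg : Continuous g) :
    ∫ p in Set.Ioo (0 : ℝ) (1 / 2) ×ˢ Set.Ioo (0 : ℝ) (1 / 2), g p =
      (∫ p in alcoveTriangle, g p) + ∫ p in alcoveTriangle, g p.swap := by
  have hm : MeasurableSet alcoveTriangle := by unfold alcoveTriangle; measurability
  have hms : MeasurableSet (Prod.swap ⁻¹' alcoveTriangle) := measurable_swap hm
  have hae : (Set.Ioo (0 : ℝ) (1 / 2) ×ˢ Set.Ioo (0 : ℝ) (1 / 2) : Set (ℝ × ℝ)) =ᵐ[volume]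
      (alcoveTriangle ∪ Prod.swap ⁻¹' alcoveTriangle : Set (ℝ × ℝ)) := by
    have h0 : ∀ᵐ p : ℝ × ℝ, ¬ p.2 = 1 * p.1 + 0 := ae_iff.2 (by simpa using volume_line 1 0)
    filter_upwards [h0] with ⟨x, y⟩ h
    refine propext ?_
    change (x, y) ∈ Set.Ioo (0 : ℝ) (1 / 2) ×ˢ Set.Ioo (0 : ℝ) (1 / 2) ↔
      (x, y) ∈ alcoveTriangle ∪ Prod.swap ⁻¹' alcoveTriangle
    simp only [Set.mem_prod, Set.mem_Ioo, Set.mem_union, Set.mem_preimage, Prod.swap_prod_mk,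
      alcoveTriangle, Set.mem_ofPred_eq]
    constructor
    · rintro ⟨h1, h2⟩
      rcases lt_trichotomy x y with h' | h' | h'
      · exact Or.inr ⟨h1.1, h', h2.2⟩
      · exact absurd (by linarith) h
      · exact Or.inl ⟨h2.1, h', h1.2⟩
    · rintro (h' | h') <;> exact ⟨⟨by linarith, by linarith⟩, by linarith, by linarith⟩
  have hsub : alcoveTriangle ⊆ Set.Icc ((0, 0) : ℝ × ℝ) (1, 1) := by
    rintro ⟨x, y⟩ ⟨h1, h2, h3⟩
    simp only [Set.mem_Icc, Prod.mk_le_mk] at h1 h2 h3 ⊢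
    exact ⟨⟨by linarith, by linarith⟩, by linarith, by linarith⟩
  have hsub' : Prod.swap ⁻¹' alcoveTriangle ⊆ Set.Icc ((0, 0) : ℝ × ℝ) (1, 1) := by
    rintro p hp
    obtain ⟨h1, h2⟩ := hsub hp
    exact ⟨⟨h1.2, h1.1⟩, h2.2, h2.1⟩
  rw [setIntegral_congr_set hae, setIntegral_union ?_ hms (hg.integrableOn_Icc.mono_set hsub)
    (hg.integrableOn_Icc.mono_set hsub')]
  · congr 1
    exact (Measure.measurePreserving_swap.setIntegral_preimage_emb
      MeasurableEquiv.prodComm.measurableEmbedding (fun p => g p.swap) alcoveTriangle)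
  · refine Set.disjoint_left.2 ?_
    rintro ⟨x, y⟩ ⟨_, h, _⟩ ⟨_, h', _⟩
    exact lt_asymm h h'

/-- The integral over the unit square, folded onto `(0, 1 / 2) ^ 2`. -/
lemma setIntegral_eq_signedProd {s : ℂ} (hs : 1 < s.re) :
    (∫ x in Set.Ioo (0 : ℝ) 1 ×ˢ Set.Ioo (0 : ℝ) 1, reflZeta s x.1 * reflZeta s x.2 *
      reflZeta s (-x.1 - 2 * x.2) * reflZeta s (-x.1 - x.2)) =
    ∫ p in Set.Ioo (0 : ℝ) (1 / 2) ×ˢ Set.Ioo (0 : ℝ) (1 / 2),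
      (signedProd (-1) 1 1 (-1) s p + signedProd 1 1 1 (-1) s p
        + (signedProd (-1) (-1) (-1) 1 s p + signedProd 1 (-1) (-1) 1 s p)) := by
  have hc := continuous_reflZeta hs
  have hp : Function.Periodic (reflZeta s) 1 := reflZeta_add_one s
  have hc' := fun σ₁ σ₂ σ₃ σ₄ => continuous_signedProd σ₁ σ₂ σ₃ σ₄ hs
  set G : ℝ → ℝ → ℂ := fun y x =>
    reflZeta s (x - y) * reflZeta s y * reflZeta s (-x - y) * reflZeta s (-x) with hG
  have hGc : Continuous (Function.uncurry G) := by
    simp only [hG, Function.uncurry_def]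
    fun_prop
  have hGy : ∀ y, Continuous (G y) := fun y => by simp only [hG]; fun_prop
  have hGp : ∀ y, Function.Periodic (G y) 1 := fun y x => by
    simp only [hG]
    rw [show x + 1 - y = x - y + 1 by ring, hp, show -(x + 1) - y = -x - y - 1 by ring,
      hp.sub_eq, show -(x + 1) = -x - 1 by ring, hp.sub_eq]
  have hGp' : Function.Periodic G 1 := fun y => by
    funext x
    simp only [hG]
    rw [show x - (y + 1) = x - y - 1 by ring, hp.sub_eq, hp,
      show -x - (y + 1) = -x - y - 1 by ring, hp.sub_eq]
  have hshift : ∀ y, ∫ x in (0 : ℝ)..1, reflZeta s x * reflZeta s y *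
      reflZeta s (-x - 2 * y) * reflZeta s (-x - y) = ∫ x in (0 : ℝ)..1, G y x := fun y => by
    have h := (hGp y).intervalIntegral_add_eq 0 y
    have h' := intervalIntegral.integral_comp_add_right (a := 0) (b := 1) (G y) y
    rw [zero_add] at h h'
    rw [h, add_comm y 1, ← h']
    refine intervalIntegral.integral_congr fun x _ => ?_
    simp only [hG]
    ring_nf
  rw [setIntegral_Ioo_prod_Ioo zero_le_one zero_le_one (by fun_prop),
    setIntegral_Ioo_prod_Ioo (by norm_num) (by norm_num) (by fun_prop)]
  simp only [hshift, (hGp _).integral_eq_integral_half (hGy _)]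
  rw [Function.Periodic.integral_eq_integral_half]
  · refine intervalIntegral.integral_congr fun y _ => ?_
    have hi : ∀ y, IntervalIntegrable (fun x => G y x + G y (-x)) volume 0 (1 / 2) := fun y =>
      ((hGy y).add ((hGy y).comp continuous_neg)).intervalIntegrable _ _
    rw [← intervalIntegral.integral_add (hi y) (hi (-y))]
    refine intervalIntegral.integral_congr fun x _ => ?_
    simp only [hG, signedProd]
    ring_nf
  · intro y
    simp only [hGp' y]
  · refine intervalIntegral.continuous_parametric_intervalIntegral_of_continuous' ?_ _ _
    simp only [hG, Function.uncurry_def]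
    fun_prop

lemma signedProd_swap (σ₁ σ₂ σ₃ σ₄ : ℝ) (s : ℂ) (p : ℝ × ℝ) :
    signedProd σ₁ σ₂ σ₃ σ₄ s p.swap = signedProd σ₂ σ₁ (-σ₃) σ₄ s p := by
  simp only [signedProd, Prod.fst_swap, Prod.snd_swap]
  rw [show σ₃ * (p.2 - p.1) = -σ₃ * (p.1 - p.2) by ring, add_comm p.2]
  ring

lemma hasMeromorphicExtension_half_square {σ₁ σ₂ σ₃ σ₄ : ℝ} (h₁ : σ₁ = 1 ∨ σ₁ = -1)
    (h₂ : σ₂ = 1 ∨ σ₂ = -1) (h₃ : σ₃ = 1 ∨ σ₃ = -1) (h₄ : σ₄ = 1 ∨ σ₄ = -1) :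
    HasMeromorphicExtension fun s => ∫ p in Set.Ioo (0 : ℝ) (1 / 2) ×ˢ Set.Ioo (0 : ℝ) (1 / 2),
      signedProd σ₁ σ₂ σ₃ σ₄ s p := by
  refine ((hasMeromorphicExtension_alcoveTriangle h₁ h₂ h₃ h₄).add
    (hasMeromorphicExtension_alcoveTriangle (σ₃ := -σ₃) h₂ h₁ ?_ h₄)).congr fun s hs => ?_
  · rcases h₃ with rfl | rfl <;> simp
  · rw [setIntegral_half_square (continuous_signedProd σ₁ σ₂ σ₃ σ₄ hs)]
    simp only [signedProd_swap]

lemma hasMeromorphicExtension_unitSquare : HasMeromorphicExtension fun s =>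
    ∫ x in Set.Ioo (0 : ℝ) 1 ×ˢ Set.Ioo (0 : ℝ) 1, reflZeta s x.1 * reflZeta s x.2 *
      reflZeta s (-x.1 - 2 * x.2) * reflZeta s (-x.1 - x.2) := by
  have h : ∀ {σ₁ σ₂ σ₃ σ₄ : ℝ}, _ → _ → _ → _ → _ := @hasMeromorphicExtension_half_square
  refine (((h (σ₁ := -1) (σ₂ := 1) (σ₃ := 1) (σ₄ := -1) ?_ ?_ ?_ ?_).add
    (h (σ₁ := 1) (σ₂ := 1) (σ₃ := 1) (σ₄ := -1) ?_ ?_ ?_ ?_)).add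
    ((h (σ₁ := -1) (σ₂ := -1) (σ₃ := -1) (σ₄ := 1) ?_ ?_ ?_ ?_).add
    (h (σ₁ := 1) (σ₂ := -1) (σ₃ := -1) (σ₄ := 1) ?_ ?_ ?_ ?_))).congr fun s hs => ?_
  on_goal 17 =>
    have hi : ∀ σ₁ σ₂ σ₃ σ₄, IntegrableOn (signedProd σ₁ σ₂ σ₃ σ₄ s)
        (Set.Ioo (0 : ℝ) (1 / 2) ×ˢ Set.Ioo (0 : ℝ) (1 / 2)) := fun σ₁ σ₂ σ₃ σ₄ => by
      refine ((continuous_signedProd σ₁ σ₂ σ₃ σ₄ hs).integrableOn_Icc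
        (a := (0, 0)) (b := (1 / 2, 1 / 2))).mono_set ?_
      rintro ⟨x, y⟩ ⟨h, h'⟩
      exact ⟨⟨h.1.le, h'.1.le⟩, h.2.le, h'.2.le⟩
    rw [setIntegral_eq_signedProd hs, integral_add ((hi _ _ _ _).fun_add (hi _ _ _ _))
      ((hi _ _ _ _).fun_add (hi _ _ _ _)), integral_add (hi _ _ _ _) (hi _ _ _ _),
      integral_add (hi _ _ _ _) (hi _ _ _ _)]
  all_goals simp

/-- The leading Laurent coefficient at every negative integer `-m` of the
meromorphic continuation of
`I_{B₂}(s) = ∫_{[0,1]²} ζ(1-s,x₁)ζ(1-s,x₂)ζ(1-s,-x₁-2x₂)ζ(1-s,-x₁-x₂) dx`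
lies in the `ℚ`-span of `ζ(4m+2,t)` and `ζ(a,t₁)ζ(b,t₂)` with `a,b ≥ m+1`, `a+b = 4m+2`,
and `t, t₁, t₂ ∈ {1, 1/2}`, where `ζ(w,t) = Σ_{k≥0}(k+t)^{-w}`. -/
theorem stmt_14 :
    ∃ F : ℂ → ℂ,
      (∀ z : ℂ, MeromorphicAt F z) ∧
      (∀ s : ℂ, 1 < s.re →
        F s = ∫ x in (Set.Ioo (0 : ℝ) 1 ×ˢ Set.Ioo (0 : ℝ) 1),
          hurwitzZeta (x.1 : UnitAddCircle) (1 - s) *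
            hurwitzZeta (x.2 : UnitAddCircle) (1 - s) *
            hurwitzZeta ((-x.1 - 2 * x.2 : ℝ) : UnitAddCircle) (1 - s) *
            hurwitzZeta ((-x.1 - x.2 : ℝ) : UnitAddCircle) (1 - s)) ∧
      ∀ m : ℕ, 0 < m →
        ∃ L ∈ Submodule.span ℚ
            ({z : ℂ | ∃ t ∈ ({1, 1/2} : Set ℝ),
                z = ∑' k : ℕ, 1 / ((k : ℂ) + (t : ℝ)) ^ (4 * m + 2)} ∪
             {z : ℂ | ∃ (a b : ℕ), ∃ t₁ ∈ ({1, 1/2} : Set ℝ), ∃ t₂ ∈ ({1, 1/2} : Set ℝ),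
                m + 1 ≤ a ∧ m + 1 ≤ b ∧ a + b = 4 * m + 2 ∧
                z = (∑' k : ℕ, 1 / ((k : ℂ) + (t₁ : ℝ)) ^ a) *
                    (∑' k : ℕ, 1 / ((k : ℂ) + (t₂ : ℝ)) ^ b)}),
          Tendsto (fun s => (s + (m : ℂ)) ^ 2 * F s)
            (nhdsWithin (-(m : ℂ)) {-(m : ℂ)}ᶜ) (nhds L) := by
  exact hasMeromorphicExtension_unitSquare
end

section
/- Let n ≥ 1, let V ⊆ ℝ^n be an n-dimensional simplex, and let ℋ be a family of affine hyperplanes of ℝ^n, each of which is disjoint from the interior of V. Then there exist finitely many n-dimensional simplices V₁,…,V_M and points p₁,…,p_M ∈ ℝ^n such that: ⋃_{i=1}^M V_i = V; the interiors of the V_i are pairwise disjoint; each p_i is a vertex of V_i; and for every i and every H ∈ ℋ, either p_i ∈ H or H ∩ V_i = ∅. -/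
/-- The barycenter of the face `{v 0, …, v k}` of the simplex with vertices `v`. -/
noncomputable def flagBarycenter {n : ℕ} {E : Type*} [AddCommGroup E] [Module ℝ E]
    (v : Fin (n + 1) → E) (k : Fin (n + 1)) : E :=
  ((k : ℝ) + 1)⁻¹ • ∑ j ∈ Finset.Iic k, v j

/-- The weights on `v` of the point with weights `w` on `flagBarycenter v`. -/
noncomputable def flagWeight {n : ℕ} (w : Fin (n + 1) → ℝ) (j : Fin (n + 1)) : ℝ :=
  ∑ k ∈ Finset.Ici j, w k * ((k : ℝ) + 1)⁻¹

theorem sum_smul_flagBarycenter {n : ℕ} {E : Type*} [AddCommGroup E] [Module ℝ E]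
    (v : Fin (n + 1) → E) (w : Fin (n + 1) → ℝ) :
    ∑ k, w k • flagBarycenter v k = ∑ j, flagWeight w j • v j := by
  simp only [flagBarycenter, flagWeight, smul_smul, Finset.smul_sum, Finset.sum_smul]
  refine Finset.sum_comm' fun k j => ?_
  simp

theorem sum_flagWeight {n : ℕ} (w : Fin (n + 1) → ℝ) : ∑ j, flagWeight w j = ∑ k, w k := by
  have h := sum_smul_flagBarycenter (fun _ => (1 : ℝ)) w
  simp only [smul_eq_mul, mul_one] at h
  rw [← h]
  refine Finset.sum_congr rfl fun k _ => ?_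
  have hk : (k : ℝ) + 1 ≠ 0 := by positivity
  simp [flagBarycenter, hk]

theorem flagWeight_last {n : ℕ} (w : Fin (n + 1) → ℝ) :
    flagWeight w (Fin.last n) = w (Fin.last n) * ((n : ℝ) + 1)⁻¹ := by
  have h : Finset.Ici (Fin.last n) = {Fin.last n} := by
    ext k
    simp
  simp [flagWeight, h]

theorem flagWeight_castSucc {n : ℕ} (w : Fin (n + 1) → ℝ) (i : Fin n) :
    flagWeight w i.castSucc =
      w i.castSucc * ((i : ℝ) + 1)⁻¹ + flagWeight w i.succ := by
  have h : Finset.Ici i.castSucc = insert i.castSucc (Finset.Ici i.succ) := by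
    ext k
    simp only [Finset.mem_Ici, Finset.mem_insert, Fin.le_def, Fin.ext_iff, Fin.val_castSucc,
      Fin.val_succ]
    omega
  rw [flagWeight, h, Finset.sum_insert (by simp [Fin.le_def])]
  simp [flagWeight]

theorem eq_zero_of_flagWeight_eq_zero {n : ℕ} {w : Fin (n + 1) → ℝ}
    (h : ∀ j, flagWeight w j = 0) (k : Fin (n + 1)) : w k = 0 := by
  induction k using Fin.lastCases with
  | last =>
    have h' := flagWeight_last w
    have hn : (n : ℝ) + 1 ≠ 0 := by positivity
    simpa [h, hn] using h'
  | cast i =>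
    have h' := flagWeight_castSucc w i
    have hi : (i : ℝ) + 1 ≠ 0 := by positivity
    simpa [h, hi] using h'

theorem flagWeight_nonneg {n : ℕ} {w : Fin (n + 1) → ℝ} (hw : ∀ k, 0 ≤ w k)
    (j : Fin (n + 1)) : 0 ≤ flagWeight w j :=
  Finset.sum_nonneg fun k _ => mul_nonneg (hw k) (by positivity)

theorem flagWeight_antitone {n : ℕ} {w : Fin (n + 1) → ℝ} (hw : ∀ k, 0 ≤ w k) :
    Antitone (flagWeight w) := by
  refine Fin.antitone_iff_succ_le.2 fun i => ?_
  rw [flagWeight_castSucc]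
  exact le_add_of_nonneg_left (mul_nonneg (hw _) (by positivity))

theorem flagWeight_strictAnti {n : ℕ} {w : Fin (n + 1) → ℝ} (hw : ∀ k, 0 < w k) :
    StrictAnti (flagWeight w) := by
  refine Fin.strictAnti_iff_succ_lt.2 fun i => ?_
  rw [flagWeight_castSucc]
  exact lt_add_of_pos_left _ (mul_pos (hw _) (by positivity))

theorem exists_flagWeight_eq {n : ℕ} {l : Fin (n + 1) → ℝ} (hl : Antitone l)
    (hl0 : ∀ j, 0 ≤ l j) : ∃ w : Fin (n + 1) → ℝ, (∀ k, 0 ≤ w k) ∧ flagWeight w = l := by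
  refine ⟨Fin.lastCases (((n : ℝ) + 1) * l (Fin.last n))
    (fun i => ((i : ℝ) + 1) * (l i.castSucc - l i.succ)), fun k => ?_, funext fun j => ?_⟩
  · induction k using Fin.lastCases with
    | last =>
      simp only [Fin.lastCases_last]
      exact mul_nonneg (by positivity) (hl0 _)
    | cast i =>
      simp only [Fin.lastCases_castSucc]
      exact mul_nonneg (by positivity) (sub_nonneg.2 (hl (Fin.castSucc_lt_succ).le))
  · induction j using Fin.reverseInduction with
    | last =>
      rw [flagWeight_last, Fin.lastCases_last]
      field_simp
    | cast i ih =>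
      rw [flagWeight_castSucc, ih, Fin.lastCases_castSucc]
      field_simp
      ring

theorem affineIndependent_flagBarycenter {n : ℕ} {E : Type*} [AddCommGroup E] [Module ℝ E]
    {v : Fin (n + 1) → E} (hv : AffineIndependent ℝ v) :
    AffineIndependent ℝ (flagBarycenter v) := by
  rw [affineIndependent_iff_of_fintype] at hv ⊢
  intro w hw h
  rw [Finset.weightedVSub_eq_linear_combination _ hw, sum_smul_flagBarycenter] at h
  have hs : ∑ j, flagWeight w j = 0 := by rw [sum_flagWeight, hw]
  refine eq_zero_of_flagWeight_eq_zero (hv (flagWeight w) hs ?_)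
  rw [Finset.weightedVSub_eq_linear_combination _ hs, h]

theorem mem_convexHull_range_iff {ι E : Type*} [Fintype ι] [AddCommGroup E] [Module ℝ E]
    {v : ι → E} {x : E} : x ∈ convexHull ℝ (Set.range v) ↔
      ∃ w : ι → ℝ, (∀ i, 0 ≤ w i) ∧ ∑ i, w i = 1 ∧ ∑ i, w i • v i = x := by
  refine ⟨fun h => ?_, ?_⟩
  · rw [convexHull_range_eq_exists_affineCombination] at h
    obtain ⟨s, w, hw, hs, rfl⟩ := h
    classical
    refine ⟨fun i => if i ∈ s then w i else 0, fun i => ?_, ?_, ?_⟩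
    · dsimp only
      split_ifs with hi
      exacts [hw i hi, le_rfl]
    · simpa using hs
    · rw [Finset.affineCombination_eq_linear_combination _ _ _ hs]
      simp
  · rintro ⟨w, hw, hs, rfl⟩
    exact (convex_convexHull ℝ _).sum_mem (fun i _ => hw i) hs
      fun i _ => subset_convexHull ℝ _ ⟨i, rfl⟩

theorem mem_convexHull_flagBarycenter_iff {n : ℕ} {E : Type*} [AddCommGroup E] [Module ℝ E]
    {v : Fin (n + 1) → E} {x : E} : x ∈ convexHull ℝ (Set.range (flagBarycenter v)) ↔
      ∃ l : Fin (n + 1) → ℝ, Antitone l ∧ (∀ i, 0 ≤ l i) ∧ ∑ i, l i = 1 ∧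
        ∑ i, l i • v i = x := by
  rw [mem_convexHull_range_iff]
  constructor
  · rintro ⟨w, hw, hs, rfl⟩
    exact ⟨flagWeight w, flagWeight_antitone hw, flagWeight_nonneg hw,
      by rw [sum_flagWeight, hs], (sum_smul_flagBarycenter v w).symm⟩
  · rintro ⟨l, hl, hl0, hs, rfl⟩
    obtain ⟨w, hw, rfl⟩ := exists_flagWeight_eq hl hl0
    exact ⟨w, hw, by rw [← sum_flagWeight, hs], sum_smul_flagBarycenter v w⟩

theorem iUnion_convexHull_flagBarycenter {n : ℕ} {E : Type*} [AddCommGroup E] [Module ℝ E]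
    (v : Fin (n + 1) → E) :
    ⋃ σ : Equiv.Perm (Fin (n + 1)), convexHull ℝ (Set.range (flagBarycenter (v ∘ σ))) =
      convexHull ℝ (Set.range v) := by
  ext x
  simp only [Set.mem_iUnion, mem_convexHull_flagBarycenter_iff]
  constructor
  · rintro ⟨σ, l, -, hl0, hs, hx⟩
    rw [← σ.surjective.range_comp v]
    exact mem_convexHull_range_iff.2 ⟨l, hl0, hs, hx⟩
  · intro hx
    obtain ⟨w, hw, hs, rfl⟩ := mem_convexHull_range_iff.1 hx
    refine ⟨Tuple.sort (-w), w ∘ Tuple.sort (-w), fun i j hij => ?_, fun i => hw _, ?_, ?_⟩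
    · exact neg_le_neg_iff.1 (Tuple.monotone_sort (-w) hij)
    · exact (Equiv.sum_comp (Tuple.sort (-w)) w).trans hs
    · exact Equiv.sum_comp (Tuple.sort (-w)) fun i => w i • v i

/-- An interior point of a full-dimensional simplex has positive weights on the vertices. -/
theorem exists_pos_weights_of_mem_interior_convexHull {n : ℕ} {E : Type*}
    [NormedAddCommGroup E] [NormedSpace ℝ E] [FiniteDimensional ℝ E]
    (hE : Module.finrank ℝ E = n) {v : Fin (n + 1) → E} (hv : AffineIndependent ℝ v) {x : E}
    (hx : x ∈ interior (convexHull ℝ (Set.range v))) :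
    ∃ w : Fin (n + 1) → ℝ, (∀ i, 0 < w i) ∧ ∑ i, w i = 1 ∧ ∑ i, w i • v i = x := by
  let b : AffineBasis (Fin (n + 1)) ℝ E :=
    ⟨v, hv, (hv.affineSpan_eq_top_iff_card_eq_finrank_add_one).2 (by simp [hE])⟩
  have h : x ∈ interior (convexHull ℝ (Set.range b)) := hx
  rw [b.interior_convexHull] at h
  exact ⟨fun i => b.coord i x, h, b.sum_coord_apply_eq_one x, b.linear_combination_coord_eq_self x⟩

theorem eq_of_mem_interior_flagBarycenter {n : ℕ} {E : Type*}
    [NormedAddCommGroup E] [NormedSpace ℝ E] [FiniteDimensional ℝ E]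
    (hE : Module.finrank ℝ E = n) {v : Fin (n + 1) → E} (hv : AffineIndependent ℝ v)
    {σ τ : Equiv.Perm (Fin (n + 1))} {x : E}
    (hσ : x ∈ interior (convexHull ℝ (Set.range (flagBarycenter (v ∘ σ)))))
    (hτ : x ∈ interior (convexHull ℝ (Set.range (flagBarycenter (v ∘ τ))))) : σ = τ := by
  have key : ∀ ρ : Equiv.Perm (Fin (n + 1)),
      x ∈ interior (convexHull ℝ (Set.range (flagBarycenter (v ∘ ρ)))) →
      ∃ l : Fin (n + 1) → ℝ, StrictAnti (l ∘ ρ) ∧ ∑ i, l i = 1 ∧ ∑ i, l i • v i = x := by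
    intro ρ h
    obtain ⟨w, hw, hs, hx⟩ := exists_pos_weights_of_mem_interior_convexHull hE
      (affineIndependent_flagBarycenter (hv.comp_embedding ρ.toEmbedding)) h
    refine ⟨flagWeight w ∘ ρ.symm, ?_, ?_, ?_⟩
    · simpa [Function.comp_assoc] using flagWeight_strictAnti hw
    · exact (Equiv.sum_comp ρ.symm (flagWeight w)).trans ((sum_flagWeight w).trans hs)
    · rw [← hx]
      refine Eq.trans ?_ (sum_smul_flagBarycenter (v ∘ ρ) w).symm
      rw [← Equiv.sum_comp ρ]
      simp
  obtain ⟨l, hl, hls, hlx⟩ := key σ hσ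
  obtain ⟨m, hm, hms, hmx⟩ := key τ hτ
  obtain rfl : l = m := by
    refine (affineIndependent_iff_eq_of_fintype_affineCombination_eq ℝ v).1 hv l m hls hms ?_
    rw [Finset.affineCombination_eq_linear_combination _ _ _ hls,
      Finset.affineCombination_eq_linear_combination _ _ _ hms, hlx, hmx]
  have h : (-l) ∘ σ = (-l) ∘ τ :=
    Tuple.unique_monotone (fun i j hij => neg_le_neg (hl.antitone hij))
      (fun i j hij => neg_le_neg (hm.antitone hij))
  have hinj : Function.Injective l := by
    have h' := hl.injective.comp σ.symm.injective
    simpa [Function.comp_assoc] using h'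
  ext i
  have h' := congrFun h i
  simp only [Function.comp_apply, Pi.neg_apply, neg_inj] at h'
  rw [hinj h']

/-- A continuous function without zeros in the interior of a convex body has a weak sign on it. -/
theorem Convex.nonneg_or_nonpos_of_ne_zero_on_interior {E : Type*} [NormedAddCommGroup E]
    [NormedSpace ℝ E] {s : Set E} (hs : Convex ℝ s) (hne : (interior s).Nonempty) {f : E → ℝ}
    (hf : Continuous f) (h0 : ∀ x ∈ interior s, f x ≠ 0) :
    (∀ x ∈ s, 0 ≤ f x) ∨ (∀ x ∈ s, f x ≤ 0) := by
  have hsub : s ⊆ closure (interior s) := by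
    rw [hs.closure_interior_eq_closure_of_nonempty_interior hne]
    exact subset_closure
  by_cases h : ∀ x ∈ interior s, 0 ≤ f x
  · exact Or.inl fun x hx =>
      closure_minimal h (isClosed_le continuous_const hf) (hsub hx)
  · push Not at h
    obtain ⟨y, hy, hfy⟩ := h
    refine Or.inr fun x hx =>
      closure_minimal (fun z hz => ?_) (isClosed_le hf continuous_const) (hsub hx)
    by_contra hfz
    obtain ⟨t, ht, htf⟩ := hs.interior.isPreconnected.intermediate_value hy hz
      hf.continuousOn ⟨hfy.le, (not_le.1 hfz).le⟩
    exact h0 t ht htf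

/-- If a linear functional is at least `c` at every `v i` and equals `c` at a point of the cell
of the barycentric subdivision given by the flag `v`, then it equals `c` at `v 0`. -/
theorem eq_zero_of_mem_flagBarycenter {n : ℕ} {E : Type*} [AddCommGroup E] [Module ℝ E]
    {v : Fin (n + 1) → E} (f : E →ₗ[ℝ] ℝ) {c : ℝ} (hf : ∀ i, c ≤ f (v i)) {x : E}
    (hx : x ∈ convexHull ℝ (Set.range (flagBarycenter v))) (hfx : f x = c) : f (v 0) = c := by
  obtain ⟨l, hl, hl0, hs, rfl⟩ := mem_convexHull_flagBarycenter_iff.1 hx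
  have hsum : ∑ i, l i * (f (v i) - c) = 0 := by
    simp only [mul_sub, Finset.sum_sub_distrib, ← Finset.sum_mul, hs, one_mul]
    simpa [sub_eq_zero] using hfx
  have h0 := (Finset.sum_eq_zero_iff_of_nonneg
    fun i _ => mul_nonneg (hl0 i) (sub_nonneg.2 (hf i))).1 hsum 0 (Finset.mem_univ _)
  rcases mul_eq_zero.1 h0 with h | h
  · have hz : ∀ i, l i = 0 := fun i => le_antisymm (h ▸ hl (Fin.zero_le i)) (hl0 i)
    simp [hz] at hs
  · exact sub_eq_zero.1 h

/-- Given an `n`-simplex `V ⊆ ℝⁿ` and a family `ℋ` of affine hyperplanes each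
disjoint from the interior of `V`, there is a triangulation `V = V₁ ∪ ⋯ ∪ V_M` into
`n`-simplices with pairwise disjoint interiors, each with a distinguished vertex `pᵢ`, such
that every `H ∈ ℋ` either contains `pᵢ` or is disjoint from `Vᵢ`. -/
theorem stmt_17 (n : ℕ) (hn : 1 ≤ n)
    (V : Set (Fin n → ℝ)) (v : Fin (n + 1) → (Fin n → ℝ))
    (hv : AffineIndependent ℝ v) (hV : V = convexHull ℝ (Set.range v))
    (ℋ : Set (Set (Fin n → ℝ)))
    (hHyp : ∀ H ∈ ℋ, ∃ (a : Fin n → ℝ) (c : ℝ), a ≠ 0 ∧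
      H = {x : Fin n → ℝ | ∑ i, a i * x i = c})
    (hHdisj : ∀ H ∈ ℋ, H ∩ interior V = ∅) :
    ∃ (M : ℕ) (W : Fin M → Set (Fin n → ℝ)) (p : Fin M → (Fin n → ℝ))
      (vert : Fin M → Fin (n + 1) → (Fin n → ℝ)),
      (∀ i, AffineIndependent ℝ (vert i)) ∧
      (∀ i, W i = convexHull ℝ (Set.range (vert i))) ∧
      (⋃ i, W i) = V ∧
      (∀ i j, i ≠ j → interior (W i) ∩ interior (W j) = ∅) ∧
      (∀ i, ∃ l, vert i l = p i) ∧
      (∀ i, ∀ H ∈ ℋ, p i ∈ H ∨ H ∩ W i = ∅) := by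
  subst hV
  let e := Fintype.equivFin (Equiv.Perm (Fin (n + 1)))
  let u : Fin (Fintype.card (Equiv.Perm (Fin (n + 1)))) → Fin (n + 1) → Fin n → ℝ :=
    fun i => flagBarycenter (v ∘ e.symm i)
  refine ⟨_, fun i => convexHull ℝ (Set.range (u i)), fun i => v (e.symm i 0), u, fun i => ?_,
    fun i => rfl, ?_, fun i j hij => ?_, fun i => ⟨0, ?_⟩, fun i H hH => ?_⟩
  · exact affineIndependent_flagBarycenter (hv.comp_embedding (e.symm i).toEmbedding)
  · rw [← iUnion_convexHull_flagBarycenter v]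
    exact e.symm.surjective.iUnion_comp
      fun σ : Equiv.Perm (Fin (n + 1)) => convexHull ℝ (Set.range (flagBarycenter (v ∘ σ)))
  · refine Set.eq_empty_iff_forall_notMem.2 fun x hx => hij (e.symm.injective ?_)
    exact eq_of_mem_interior_flagBarycenter (by simp) hv hx.1 hx.2
  · have h : Finset.Iic (0 : Fin (n + 1)) = {0} := by
      ext k
      simp
    simp [u, flagBarycenter, h]
  · obtain ⟨a, c, -, rfl⟩ := hHyp H hH
    refine or_iff_not_imp_right.2 fun hne => ?_
    obtain ⟨x, hxH, hx⟩ := Set.nonempty_iff_ne_empty.2 hne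
    let f : (Fin n → ℝ) →ₗ[ℝ] ℝ := ∑ i, a i • LinearMap.proj i
    have hf : ∀ y, f y = ∑ i, a i * y i := fun y => by simp [f]
    have hspan : affineSpan ℝ (Set.range v) = ⊤ :=
      hv.affineSpan_eq_top_iff_card_eq_finrank_add_one.2 (by simp)
    have hvmem : ∀ k, v k ∈ convexHull ℝ (Set.range v) := fun k =>
      subset_convexHull ℝ _ ⟨k, rfl⟩
    have hsign := (convex_convexHull ℝ (Set.range v)).nonneg_or_nonpos_of_ne_zero_on_interior
      (interior_convexHull_nonempty_iff_affineSpan_eq_top.2 hspan)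
      (f := fun y => f y - c)
      (f.continuous_of_finiteDimensional.sub continuous_const) fun y hy h0 =>
        Set.eq_empty_iff_forall_notMem.1 (hHdisj _ hH) y
          ⟨(hf y).symm.trans (sub_eq_zero.1 h0), hy⟩
    have hfx : f x = c := (hf x).trans hxH
    refine (hf _).symm.trans ?_
    rcases hsign with h | h
    · exact eq_zero_of_mem_flagBarycenter f (v := v ∘ e.symm i)
        (fun k => sub_nonneg.1 (h _ (hvmem _))) hx hfx
    · have h' := eq_zero_of_mem_flagBarycenter (-f) (v := v ∘ e.symm i) (c := -c)
        (fun k => neg_le_neg (sub_nonpos.1 (h _ (hvmem _)))) hx (by simp [hfx])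
      simpa using h'
end

section
/- Let n ≥ 1 and m > n be integers and let B be an n×m matrix with integer entries which contains the identity matrix I_n as an n×n column-submatrix. For 1 ≤ i ≤ m let l_i : ℝ^n → ℝ be the linear form whose coefficients are the entries of the i-th column of B. Then there exist finitely many n-dimensional simplices V₁,…,V_M with pairwise disjoint interiors such that ⋃_{j=1}^M V_j = [0,1]^n and, for every j: (1) every coordinate of every vertex of V_j is a rational number q such that d·q ∈ ℤ for some d ∈ D(B); (2) for every 1 ≤ i ≤ m there exists an integer N_{i,j} with N_{i,j} ≤ l_i(x) ≤ N_{i,j}+1 for all x ∈ V_j. -/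
/-- The level of a square integer matrix `A` (meaningful when `det A ≠ 0`): the least positive
integer `N` such that every entry of `N·A⁻¹` is an integer. -/
noncomputable def matrixLevel {n : ℕ} (A : Matrix (Fin n) (Fin n) ℤ) : ℕ :=
  sInf {N : ℕ | 0 < N ∧ ∀ i j, ∃ z : ℤ, (N : ℚ) * (A.map ((↑) : ℤ → ℚ))⁻¹ i j = (z : ℚ)}

/-- `D(B)`: the set of levels of the invertible `n×n` column-submatrices of an `n×m` integer
matrix `B` (columns selected in order, i.e. via a strictly monotone map). -/
noncomputable def DSet {n m : ℕ} (B : Matrix (Fin n) (Fin m) ℤ) : Set ℕ :=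
  {d | ∃ c : Fin n → Fin m, StrictMono c ∧ (B.submatrix id c).det ≠ 0 ∧
    d = matrixLevel (B.submatrix id c)}

/-- A finite set of vertices of a full-dimensional simplex. -/
def IsFullSimplex {E : Type*} [AddCommGroup E] [Module ℝ E] (T : Finset E) : Prop :=
  AffineIndependent ℝ ((↑) : T → E) ∧ T.card = Module.finrank ℝ E + 1

/-- Every linear form of the family takes values between two consecutive integers on `T`. -/
def IsCompatible {ι E : Type*} [AddCommGroup E] [Module ℝ E] (l : ι → E →ₗ[ℝ] ℝ)
    (T : Finset E) : Prop :=
  ∀ i, ∃ N : ℤ, ∀ t ∈ T, (N : ℝ) ≤ l i t ∧ l i t ≤ N + 1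

theorem IsCompatible.mono {ι E : Type*} [AddCommGroup E] [Module ℝ E] {l : ι → E →ₗ[ℝ] ℝ}
    {T U : Finset E} (hT : IsCompatible l T) (hU : U ⊆ T) : IsCompatible l U := fun i => by
  obtain ⟨N, hN⟩ := hT i
  exact ⟨N, fun t ht => hN t (hU ht)⟩

theorem affineMap_sum_smul {E : Type*} [AddCommGroup E] [Module ℝ E] (a : E →ᵃ[ℝ] ℝ)
    (T : Finset E) (w : E → ℝ) (hw : ∑ t ∈ T, w t = 1) :
    a (∑ t ∈ T, w t • t) = ∑ t ∈ T, w t * a t := by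
  have h := T.map_affineCombination id w hw a
  rw [T.affineCombination_eq_linear_combination _ _ hw,
    T.affineCombination_eq_linear_combination _ _ hw] at h
  simpa using h

namespace IsFullSimplex

/-- The affine basis formed by the vertices of a full-dimensional simplex. -/
noncomputable def basis {E : Type*} [AddCommGroup E] [Module ℝ E] [FiniteDimensional ℝ E]
    {T : Finset E} (hT : IsFullSimplex T) : AffineBasis T ℝ E where
  toFun := (↑)
  ind' := hT.1
  tot' := by
    rw [hT.1.affineSpan_eq_top_iff_card_eq_finrank_add_one]
    simpa using hT.2

theorem basis_apply {E : Type*} [AddCommGroup E] [Module ℝ E] [FiniteDimensional ℝ E]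
    {T : Finset E} (hT : IsFullSimplex T) (t : T) : hT.basis t = t := rfl

theorem range_basis {E : Type*} [AddCommGroup E] [Module ℝ E] [FiniteDimensional ℝ E]
    {T : Finset E} (hT : IsFullSimplex T) : Set.range hT.basis = (T : Set E) := by
  ext x
  simp [basis_apply]

theorem exists_weights {E : Type*} [AddCommGroup E] [Module ℝ E] [FiniteDimensional ℝ E]
    {T : Finset E} (hT : IsFullSimplex T) (y : E) :
    ∃ w : E → ℝ, (∀ t : T, w t = hT.basis.coord t y) ∧ ∑ t ∈ T, w t = 1 ∧
      ∑ t ∈ T, w t • t = y := by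
  classical
  refine ⟨fun t => if h : t ∈ T then hT.basis.coord ⟨t, h⟩ y else 0, fun t => by simp, ?_, ?_⟩
  · rw [← Finset.sum_coe_sort]
    simpa using hT.basis.sum_coord_apply_eq_one y
  · rw [← Finset.sum_coe_sort T]
    simpa [basis_apply] using hT.basis.linear_combination_coord_eq_self y

theorem exists_affineMap {E : Type*} [AddCommGroup E] [Module ℝ E] [FiniteDimensional ℝ E]
    {T : Finset E} (hT : IsFullSimplex T) (h : E → ℝ) :
    ∃ a : E →ᵃ[ℝ] ℝ, ∀ t ∈ T, a t = h t := by
  classical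
  refine ⟨∑ t : T, h t • hT.basis.coord t, fun t ht => ?_⟩
  have hc (s : T) : hT.basis.coord s t = if s = ⟨t, ht⟩ then 1 else 0 :=
    hT.basis.coord_apply s ⟨t, ht⟩
  have hs (U : Finset T) : (∑ s ∈ U, h s • hT.basis.coord s) t
      = ∑ s ∈ U, h s * hT.basis.coord s t := by
    induction U using Finset.induction_on with
    | empty => simp
    | insert s U hs ih => simp [Finset.sum_insert hs, ih]
  rw [hs]
  simp [hc]

theorem exists_pos_weights {E : Type*} [NormedAddCommGroup E] [NormedSpace ℝ E]
    [FiniteDimensional ℝ E] {T : Finset E} (hT : IsFullSimplex T) {x : E}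
    (hx : x ∈ interior (convexHull ℝ (T : Set E))) :
    ∃ w : E → ℝ, (∀ t ∈ T, 0 < w t) ∧ ∑ t ∈ T, w t = 1 ∧ ∑ t ∈ T, w t • t = x := by
  rw [← hT.range_basis, hT.basis.interior_convexHull] at hx
  obtain ⟨w, h1, h2⟩ := hT.exists_weights x
  exact ⟨w, fun t ht => (hx ⟨t, ht⟩).trans_eq (h1 ⟨t, ht⟩).symm, h2⟩

end IsFullSimplex

/-- Generic heights: no point of `S` lies on the graph of the affine function interpolating the
heights on a full-dimensional simplex with other vertices. -/
theorem exists_generic_heights {E : Type*} [AddCommGroup E] [Module ℝ E]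
    [FiniteDimensional ℝ E] (S : Finset E) :
    ∃ h : E → ℝ, ∀ T ⊆ S, IsFullSimplex T → ∀ a : E →ᵃ[ℝ] ℝ, (∀ t ∈ T, a t = h t) →
      ∀ s ∈ S, a s = h s → s ∈ T := by
  classical
  choose w hw1 hw2 using fun (p : {T : Finset E // IsFullSimplex T}) (y : E) =>
    (p.2.exists_weights y).imp fun w h => h.2
  let W : Finset E → E → E → ℝ := fun T s =>
    if hT : IsFullSimplex T then w ⟨T, hT⟩ s else 0
  let f : Finset E → E → (E → ℝ) →ₗ[ℝ] ℝ := fun T s =>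
    LinearMap.proj s - ∑ t ∈ T, W T s t • LinearMap.proj t
  have hf (T s h) : f T s h = h s - ∑ t ∈ T, W T s t * h t := by simp [f]
  let bad : Finset (Submodule ℝ (E → ℝ)) :=
    ((S.powerset ×ˢ S).filter fun p => p.2 ∉ p.1).image fun p => LinearMap.ker (f p.1 p.2)
  have htop : ⊤ ∉ bad := by
    simp only [bad, Finset.mem_image, Finset.mem_filter, not_exists, not_and]
    rintro ⟨T, s⟩ ⟨-, hs⟩ hker
    have h0 : f T s (Pi.single s 1) = 0 := by
      rw [LinearMap.ker_eq_top] at hker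
      simp [hker]
    rw [hf, Finset.sum_eq_zero] at h0
    · simp at h0
    · intro t ht
      have : t ≠ s := fun h => hs (h ▸ ht)
      simp [this]
  obtain ⟨h, hh⟩ := (Set.ne_univ_iff_exists_notMem _).1
    (Subspace.biUnion_ne_univ_of_top_notMem htop)
  refine ⟨h, fun T hTS hT a ha s hs has => ?_⟩
  by_contra hsT
  apply hh
  simp only [Set.mem_iUnion]
  refine ⟨LinearMap.ker (f T s), Finset.mem_image.2 ⟨(T, s), ?_, rfl⟩, ?_⟩
  · simp [hTS, hs, hsT]
  · rw [SetLike.mem_coe, LinearMap.mem_ker, hf, ← has]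
    have hW : W T s = w ⟨T, hT⟩ s := by simp [W, hT]
    conv_lhs => rw [← hw2 ⟨T, hT⟩ s]
    rw [affineMap_sum_smul _ _ _ (hw1 ⟨T, hT⟩ s), hw2, hW, sub_eq_zero]
    exact Finset.sum_congr rfl fun t ht => by rw [ha t ht]

theorem exists_isFullSimplex_of_mem_convexHull {E : Type*} [AddCommGroup E] [Module ℝ E]
    [FiniteDimensional ℝ E] {S U : Finset E} {x : E}
    (hx : ∀ T ⊆ S, T.card ≤ Module.finrank ℝ E → x ∉ affineSpan ℝ (T : Set E))
    (hU : U ⊆ S) (hxU : x ∈ convexHull ℝ (U : Set E)) :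
    ∃ T ⊆ U, IsFullSimplex T ∧ x ∈ convexHull ℝ (T : Set E) := by
  rw [convexHull_eq_union] at hxU
  simp only [Set.mem_iUnion] at hxU
  obtain ⟨T, hTU, hT, hxT⟩ := hxU
  have hTU : T ⊆ U := by exact_mod_cast hTU
  refine ⟨T, hTU, ⟨hT, ?_⟩, hxT⟩
  have h1 := hT.card_le_finrank_succ.trans (Nat.succ_le_succ (Submodule.finrank_le _))
  rw [Fintype.card_coe] at h1
  by_contra h2
  exact hx T (hTU.trans hU) (by omega) (convexHull_subset_affineSpan _ hxT)

/-- The simplex step: a vertex lying below the interpolated height lets one exchange a vertex so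
as to lower the interpolated height over `x`. -/
theorem exists_pivot {E : Type*} [AddCommGroup E] [Module ℝ E] [FiniteDimensional ℝ E]
    {S T : Finset E} {x s : E}
    (hx : ∀ T ⊆ S, T.card ≤ Module.finrank ℝ E → x ∉ affineSpan ℝ (T : Set E))
    (hTS : T ⊆ S) (hT : IsFullSimplex T) (hxT : x ∈ convexHull ℝ (T : Set E)) (hs : s ∈ S)
    (h : E → ℝ) (a : E →ᵃ[ℝ] ℝ) (ha : ∀ t ∈ T, a t = h t) (has : h s < a s) :
    ∃ T' : Finset E, (∀ t ∈ T', t = s ∨ t ∈ T) ∧ IsFullSimplex T' ∧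
      x ∈ convexHull ℝ (T' : Set E) ∧
      ∀ a' : E →ᵃ[ℝ] ℝ, (∀ t ∈ T', a' t = h t) → a' x < a x := by
  classical
  have hsT : s ∉ T := fun hsT => has.ne (ha s hsT).symm
  rw [Finset.mem_convexHull'] at hxT
  obtain ⟨w, hw0, hw1, hwx⟩ := hxT
  obtain ⟨μ, -, hμ1, hμs⟩ := hT.exists_weights s
  have hwpos : ∀ t ∈ T, 0 < w t := by
    intro t ht
    refine (hw0 t ht).lt_of_ne' fun hwt => ?_
    refine hx (T.erase t) ((T.erase_subset t).trans hTS) ?_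
      (convexHull_subset_affineSpan _ (Finset.mem_convexHull'.2 ⟨w, fun y hy =>
        hw0 y (Finset.mem_of_mem_erase hy), ?_, ?_⟩))
    · rw [Finset.card_erase_of_mem ht, hT.2]; simp
    · rw [Finset.sum_erase _ hwt, hw1]
    · rw [Finset.sum_erase _ (by simp [hwt]), hwx]
  obtain ⟨t₁, ht₁, hμt₁⟩ : ∃ t ∈ T, 0 < μ t := by
    by_contra! hcon
    have := Finset.sum_nonpos hcon
    linarith
  obtain ⟨t₀, ht₀, hmin⟩ := (T.filter fun t => 0 < μ t).exists_min_image (fun t => w t / μ t)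
    ⟨t₁, by simp [ht₁, hμt₁]⟩
  simp only [Finset.mem_filter] at ht₀ hmin
  obtain ⟨ht₀, hμ₀⟩ := ht₀
  set ε := w t₀ / μ t₀ with hε
  have hεpos : 0 < ε := div_pos (hwpos t₀ ht₀) hμ₀
  have hε0 : w t₀ - ε * μ t₀ = 0 := by rw [hε]; field_simp; ring
  have hnonneg : ∀ t ∈ T, 0 ≤ w t - ε * μ t := by
    intro t ht
    rcases lt_or_ge 0 (μ t) with hp | hp
    · have := hmin t ⟨ht, hp⟩
      rw [le_div_iff₀ hp] at this
      linarith
    · nlinarith [hw0 t ht]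
  let w' : E → ℝ := fun t => if t = s then ε else w t - ε * μ t
  have hw's : w' s = ε := by simp [w']
  have hw'T : ∀ t ∈ T, w' t = w t - ε * μ t := fun t ht => by
    have : t ≠ s := fun h => hsT (h ▸ ht)
    simp [w', this]
  have hsE : s ∉ T.erase t₀ := fun h => hsT (Finset.mem_of_mem_erase h)
  have hsum1 : ∑ t ∈ insert s (T.erase t₀), w' t = 1 := by
    rw [Finset.sum_insert hsE, Finset.sum_erase _ (by rw [hw'T _ ht₀, hε0]),
      Finset.sum_congr rfl hw'T, hw's, Finset.sum_sub_distrib, ← Finset.mul_sum, hw1, hμ1]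
    ring
  have hsumx : ∑ t ∈ insert s (T.erase t₀), w' t • t = x := by
    rw [Finset.sum_insert hsE, Finset.sum_erase _ (by rw [hw'T _ ht₀, hε0, zero_smul]),
      Finset.sum_congr rfl fun t ht => by rw [hw'T t ht], hw's]
    simp only [sub_smul, mul_smul]
    rw [Finset.sum_sub_distrib, ← Finset.smul_sum, hwx, hμs]
    abel
  have hmem : x ∈ convexHull ℝ ((insert s (T.erase t₀) : Finset E) : Set E) := by
    refine Finset.mem_convexHull'.2 ⟨w', fun t ht => ?_, hsum1, hsumx⟩
    rcases Finset.mem_insert.1 ht with rfl | ht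
    · rw [hw's]; exact hεpos.le
    · rw [hw'T t (Finset.mem_of_mem_erase ht)]; exact hnonneg t (Finset.mem_of_mem_erase ht)
  have hsub : insert s (T.erase t₀) ⊆ S :=
    Finset.insert_subset hs ((T.erase_subset t₀).trans hTS)
  obtain ⟨T', hT', hT'full, -⟩ := exists_isFullSimplex_of_mem_convexHull hx hsub hmem
  have hcard : (insert s (T.erase t₀)).card = Module.finrank ℝ E + 1 := by
    rw [Finset.card_insert_of_notMem hsE, Finset.card_erase_of_mem ht₀, hT.2]; simp
  obtain rfl : T' = insert s (T.erase t₀) :=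
    Finset.eq_of_subset_of_card_le hT' (by rw [hcard, hT'full.2])
  refine ⟨_, fun t ht => ?_, hT'full, hmem, fun a' ha' => ?_⟩
  · exact (Finset.mem_insert.1 ht).imp_right Finset.mem_of_mem_erase
  · have hax : a x = ∑ t ∈ T, w t * h t := by
      rw [← hwx, affineMap_sum_smul _ _ _ hw1]
      exact Finset.sum_congr rfl fun t ht => by rw [ha t ht]
    have has' : a s = ∑ t ∈ T, μ t * h t := by
      conv_lhs => rw [← hμs]
      rw [affineMap_sum_smul _ _ _ hμ1]
      exact Finset.sum_congr rfl fun t ht => by rw [ha t ht]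
    have e1 : a' x = ε * h s + (a x - ε * a s) := by
      rw [hax, has', ← hsumx, affineMap_sum_smul _ _ _ hsum1,
        Finset.sum_congr rfl fun t ht => by rw [ha' t ht],
        Finset.sum_insert hsE, Finset.sum_erase _ (by rw [hw'T _ ht₀, hε0, zero_mul]),
        hw's, Finset.mul_sum, ← Finset.sum_sub_distrib]
      congr 1
      exact Finset.sum_congr rfl fun t ht => by rw [hw'T t ht]; ring
    rw [e1]
    nlinarith

/-- If two full-dimensional compatible simplices have a common interior point, their vertices
taken together are compatible. -/
theorem IsCompatible.union {ι E : Type*} [NormedAddCommGroup E] [NormedSpace ℝ E]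
    [FiniteDimensional ℝ E] [DecidableEq E] {l : ι → E →ₗ[ℝ] ℝ} {T U : Finset E}
    (hTl : IsCompatible l T) (hUl : IsCompatible l U) (hT : IsFullSimplex T) {x : E}
    (hxT : x ∈ interior (convexHull ℝ (T : Set E))) (hxU : x ∈ convexHull ℝ (U : Set E)) :
    IsCompatible l (T ∪ U) := by
  intro i
  obtain ⟨N, hN⟩ := hTl i
  by_cases hc : ∃ c, ∀ t ∈ T, l i t = c
  · obtain ⟨c, hc⟩ := hc
    refine ⟨⌊c⌋, fun y _ => ?_⟩
    have : l i y = c := by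
      obtain ⟨μ, -, h1, h2⟩ := hT.exists_weights y
      rw [← h2, map_sum, ← one_mul c, ← h1, Finset.sum_mul]
      exact Finset.sum_congr rfl fun t ht => by simp [hc t ht]
    rw [this]
    exact ⟨Int.floor_le c, (Int.lt_floor_add_one c).le⟩
  · push Not at hc
    obtain ⟨w, hw0, hw1, hwx⟩ := hT.exists_pos_weights hxT
    have hlx : l i x = ∑ t ∈ T, w t * l i t := by rw [← hwx, map_sum]; simp
    have h1 : (N : ℝ) < l i x := by
      obtain ⟨t, ht, hne⟩ := hc N
      rw [hlx, ← one_mul (N : ℝ),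
        show (1 : ℝ) * (N : ℝ) = (∑ t ∈ T, w t) * (N : ℝ) by rw [hw1], Finset.sum_mul]
      exact Finset.sum_lt_sum (fun t ht => mul_le_mul_of_nonneg_left (hN t ht).1 (hw0 t ht).le)
        ⟨t, ht, mul_lt_mul_of_pos_left ((hN t ht).1.lt_of_ne' hne) (hw0 t ht)⟩
    have h2 : l i x < N + 1 := by
      obtain ⟨t, ht, hne⟩ := hc (N + 1)
      rw [hlx, ← one_mul (N + 1 : ℝ),
        show (1 : ℝ) * (N + 1 : ℝ) = (∑ t ∈ T, w t) * (N + 1 : ℝ) by rw [hw1], Finset.sum_mul]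
      exact Finset.sum_lt_sum (fun t ht => mul_le_mul_of_nonneg_left (hN t ht).2 (hw0 t ht).le)
        ⟨t, ht, mul_lt_mul_of_pos_left ((hN t ht).2.lt_of_ne hne) (hw0 t ht)⟩
    obtain ⟨N', hN'⟩ := hUl i
    rw [Finset.mem_convexHull'] at hxU
    obtain ⟨v, hv0, hv1, hvx⟩ := hxU
    have hlx' : l i x = ∑ t ∈ U, v t * l i t := by rw [← hvx, map_sum]; simp
    have h3 : (N' : ℝ) ≤ l i x := by
      rw [hlx', ← one_mul (N' : ℝ),
        show (1 : ℝ) * (N' : ℝ) = (∑ t ∈ U, v t) * (N' : ℝ) by rw [hv1], Finset.sum_mul]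
      exact Finset.sum_le_sum fun t ht => mul_le_mul_of_nonneg_left (hN' t ht).1 (hv0 t ht)
    have h4 : l i x ≤ N' + 1 := by
      rw [hlx', ← one_mul (N' + 1 : ℝ),
        show (1 : ℝ) * (N' + 1 : ℝ) = (∑ t ∈ U, v t) * (N' + 1 : ℝ) by rw [hv1], Finset.sum_mul]
      exact Finset.sum_le_sum fun t ht => mul_le_mul_of_nonneg_left (hN' t ht).2 (hv0 t ht)
    have h5 : N' < N + 1 := by exact_mod_cast h3.trans_lt h2
    have h6 : N < N' + 1 := by exact_mod_cast h1.trans_le h4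
    obtain rfl : N = N' := by omega
    refine ⟨N, fun t ht => ?_⟩
    rcases Finset.mem_union.1 ht with ht | ht
    exacts [hN t ht, hN' t ht]

theorem dense_generic {E : Type*} [NormedAddCommGroup E] [NormedSpace ℝ E]
    [FiniteDimensional ℝ E] (S : Finset E) :
    Dense {x : E | ∀ T ⊆ S, T.card ≤ Module.finrank ℝ E → x ∉ affineSpan ℝ (T : Set E)} := by
  let _ : MeasurableSpace E := borel E
  have : BorelSpace E := ⟨rfl⟩
  apply MeasureTheory.Measure.dense_of_ae (μ := MeasureTheory.Measure.addHaar)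
  have key : ∀ T ∈ S.powerset, ∀ᵐ x : E ∂MeasureTheory.Measure.addHaar,
      T.card ≤ Module.finrank ℝ E → x ∉ affineSpan ℝ (T : Set E) := by
    intro T _
    by_cases hT : T.card ≤ Module.finrank ℝ E
    · have hne : affineSpan ℝ (T : Set E) ≠ ⊤ := by
        intro htop
        have h0 : T.Nonempty := by
          rw [Finset.nonempty_iff_ne_empty]
          rintro rfl
          simp at htop
        have h1 : vectorSpan ℝ (T : Set E) = ⊤ := by
          rw [← direction_affineSpan, htop, AffineSubspace.direction_top]
        have h2 := finrank_vectorSpan_range_le ℝ ((↑) : T → E) (n := T.card - 1) (by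
          have := h0.card_pos
          simp; omega)
        rw [Subtype.range_coe_subtype] at h2
        change Module.finrank ℝ (vectorSpan ℝ (T : Set E)) ≤ _ at h2
        rw [h1, finrank_top] at h2
        have := h0.card_pos
        omega
      filter_upwards [MeasureTheory.compl_mem_ae_iff.2
        (MeasureTheory.Measure.addHaar_affineSubspace MeasureTheory.Measure.addHaar _ hne)]
        with x hx _ using hx
    · exact Filter.Eventually.of_forall fun x h => absurd h hT
  filter_upwards [(MeasureTheory.ae_ball_iff S.powerset.countable_toSet).2 key] with x hx T hTS
  exact hx T (Finset.mem_powerset.2 hTS)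

/-- A regular triangulation, using only vertices in `S`, of a convex set that is locally the
convex hull of compatible points of `S`. -/
theorem exists_compatible_triangulation {ι E : Type*} [NormedAddCommGroup E] [NormedSpace ℝ E]
    [FiniteDimensional ℝ E] (l : ι → E →ₗ[ℝ] ℝ) (S : Finset E) {K : Set E}
    (hSK : (S : Set E) ⊆ K) (hconv : Convex ℝ K) (hK : K ⊆ closure (interior K))
    (hcov : ∀ x ∈ interior K, ∃ P ⊆ S, IsCompatible l P ∧ x ∈ convexHull ℝ (P : Set E)) :
    ∃ G : Finset (Finset E),
      (∀ T ∈ G, T ⊆ S ∧ IsFullSimplex T ∧ IsCompatible l T) ∧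
      (∀ T ∈ G, ∀ U ∈ G, T ≠ U → interior (convexHull ℝ (T : Set E)) ∩
        interior (convexHull ℝ (U : Set E)) = ∅) ∧
      ⋃ T ∈ G, convexHull ℝ (T : Set E) = K := by
  classical
  obtain ⟨h, hh⟩ := exists_generic_heights S
  have ha : ∀ T : Finset E, ∃ a : E →ᵃ[ℝ] ℝ, IsFullSimplex T → ∀ t ∈ T, a t = h t := by
    intro T
    by_cases hT : IsFullSimplex T
    · exact (hT.exists_affineMap h).imp fun a ha _ => ha
    · exact ⟨0, fun h => absurd h hT⟩
  choose a ha using ha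
  let G : Finset (Finset E) := S.powerset.filter fun T => IsFullSimplex T ∧ IsCompatible l T ∧
    ∀ s ∈ S, IsCompatible l (insert s T) → a T s ≤ h s
  have hG : ∀ T, T ∈ G ↔ T ⊆ S ∧ IsFullSimplex T ∧ IsCompatible l T ∧
    ∀ s ∈ S, IsCompatible l (insert s T) → a T s ≤ h s := by simp [G]
  refine ⟨G, fun T hT => ?_, fun T hT U hU hTU => ?_, Set.Subset.antisymm ?_ ?_⟩
  · have := (hG T).1 hT
    exact ⟨this.1, this.2.1, this.2.2.1⟩
  · rw [Set.eq_empty_iff_forall_notMem]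
    rintro x ⟨hxT, hxU⟩
    apply hTU
    obtain ⟨hTS, hTf, hTc, hTl⟩ := (hG T).1 hT
    obtain ⟨hUS, hUf, hUc, hUl⟩ := (hG U).1 hU
    have hcomp := hTc.union hUc hTf hxT (interior_subset hxU)
    have hle : ∀ t ∈ T, a U t ≤ h t := fun t ht => hUl t (hTS ht) (hcomp.mono
      (Finset.insert_subset (Finset.mem_union_left _ ht) Finset.subset_union_right))
    have hle' : ∀ u ∈ U, a T u ≤ h u := fun u hu => hTl u (hUS hu) (hcomp.mono
      (Finset.insert_subset (Finset.mem_union_right _ hu) Finset.subset_union_left))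
    obtain ⟨w, hw0, hw1, hwx⟩ := hTf.exists_pos_weights hxT
    obtain ⟨v, hv0, hv1, hvx⟩ := hUf.exists_pos_weights hxU
    have e1 : a T x = ∑ t ∈ T, w t * h t := by
      rw [← hwx, affineMap_sum_smul _ _ _ hw1]
      exact Finset.sum_congr rfl fun t ht => by rw [ha T hTf t ht]
    have e2 : a U x = ∑ t ∈ T, w t * a U t := by
      rw [← hwx, affineMap_sum_smul _ _ _ hw1]
    have e3 : a T x ≤ a U x := by
      rw [← hvx, affineMap_sum_smul _ _ _ hv1, affineMap_sum_smul _ _ _ hv1]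
      exact Finset.sum_le_sum fun u hu => by
        rw [ha U hUf u hu]; exact mul_le_mul_of_nonneg_left (hle' u hu) (hv0 u hu).le
    have hmul : ∀ t ∈ T, w t * a U t ≤ w t * h t := fun t ht =>
      mul_le_mul_of_nonneg_left (hle t ht) (hw0 t ht).le
    have e4 := (Finset.sum_eq_sum_iff_of_le hmul).1
      (le_antisymm (Finset.sum_le_sum hmul) (by rw [← e1, ← e2]; exact e3))
    have hsub : T ⊆ U := fun t ht => hh U hUS hUf (a U) (ha U hUf) t (hTS ht)
      (mul_left_cancel₀ (hw0 t ht).ne' (e4 t ht))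
    exact Finset.eq_of_subset_of_card_le hsub (by rw [hTf.2, hUf.2])
  · refine Set.iUnion₂_subset fun T hT => convexHull_min ?_ hconv
    exact (Finset.coe_subset.2 ((hG T).1 hT).1).trans hSK
  · have hclosed : IsClosed (⋃ T ∈ G, convexHull ℝ (T : Set E)) :=
      G.finite_toSet.isClosed_biUnion fun T _ => T.finite_toSet.isClosed_convexHull ℝ
    refine hK.trans (closure_minimal ?_ hclosed)
    refine ((dense_generic S).open_subset_closure_inter isOpen_interior).trans
      (closure_minimal ?_ hclosed)
    rintro x ⟨hxK, hx⟩
    obtain ⟨P, hPS, hPc, hxP⟩ := hcov x hxK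
    obtain ⟨T₀, hT₀P, hT₀f, hxT₀⟩ := exists_isFullSimplex_of_mem_convexHull hx hPS hxP
    obtain ⟨T, hT, hmin⟩ := (S.powerset.filter fun T => IsFullSimplex T ∧ IsCompatible l T ∧
      x ∈ convexHull ℝ (T : Set E)).exists_min_image (fun T => a T x)
      ⟨T₀, by simp [hT₀P.trans hPS, hT₀f, hPc.mono hT₀P, hxT₀]⟩
    simp only [Finset.mem_filter, Finset.mem_powerset] at hT hmin
    obtain ⟨hTS, hTf, hTc, hxT⟩ := hT
    refine Set.mem_biUnion ((hG T).2 ⟨hTS, hTf, hTc, fun s hs hsc => ?_⟩) hxT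
    by_contra! hlt
    obtain ⟨T', hT', hT'f, hxT', hlt'⟩ := exists_pivot hx hTS hTf hxT hs h (a T) (ha T hTf) hlt
    have hsub : T' ⊆ insert s T := fun t ht => Finset.mem_insert.2 (hT' t ht)
    exact (hmin T' ⟨hsub.trans (Finset.insert_subset hs hTS), hT'f, hsc.mono hsub,
      hxT'⟩).not_gt (hlt' (a T') (ha T' hT'f))

theorem matrixLevel_spec {n : ℕ} (A : Matrix (Fin n) (Fin n) ℤ) (hA : A.det ≠ 0) :
    0 < matrixLevel A ∧ ∃ M : Matrix (Fin n) (Fin n) ℤ, A * M = (matrixLevel A : ℤ) • 1 := by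
  have hdet : (A.map ((↑) : ℤ → ℚ)).det = (A.det : ℚ) :=
    ((Int.castRingHom ℚ).map_det A).symm
  have hdet0 : (A.det : ℚ) ≠ 0 := by exact_mod_cast hA
  have hne : {N : ℕ | 0 < N ∧ ∀ i j, ∃ z : ℤ,
      (N : ℚ) * (A.map ((↑) : ℤ → ℚ))⁻¹ i j = (z : ℚ)}.Nonempty := by
    refine ⟨A.det.natAbs, Int.natAbs_pos.2 hA, fun i j => ?_⟩
    have hadj : (A.map ((↑) : ℤ → ℚ)).adjugate i j = (A.adjugate i j : ℚ) :=
      (congrFun₂ ((Int.castRingHom ℚ).map_adjugate A) i j).symm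
    refine ⟨A.det.sign * A.adjugate i j, ?_⟩
    have h : ((A.det.natAbs : ℤ) : ℚ) = (A.det.sign : ℚ) * A.det := by
      rw [← Int.cast_mul, Int.sign_mul_self_eq_natAbs]
    rw [Matrix.inv_def, Matrix.smul_apply, hdet, hadj, Ring.inverse_eq_inv', smul_eq_mul,
      ← Int.cast_natCast, h, Int.cast_mul]
    field_simp
  obtain ⟨hpos, hz⟩ := Nat.sInf_mem hne
  change 0 < matrixLevel A at hpos
  change ∀ i j, ∃ z : ℤ, (matrixLevel A : ℚ) * _ = _ at hz
  choose M hM using hz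
  refine ⟨hpos, Matrix.of M, ?_⟩
  have hinj : Function.Injective fun C : Matrix (Fin n) (Fin n) ℤ => C.map ((↑) : ℤ → ℚ) :=
    Matrix.map_injective Int.cast_injective
  apply hinj
  have h1 : (A * Matrix.of M).map ((↑) : ℤ → ℚ)
      = A.map ((↑) : ℤ → ℚ) * (Matrix.of M).map ((↑) : ℤ → ℚ) :=
    Matrix.map_mul (f := Int.castRingHom ℚ)
  have h2 : (Matrix.of M).map ((↑) : ℤ → ℚ)
      = (matrixLevel A : ℚ) • (A.map ((↑) : ℤ → ℚ))⁻¹ := by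
    ext i j
    simp [hM]
  have h3 : IsUnit (A.map ((↑) : ℤ → ℚ)).det := by rw [hdet]; exact hdet0.isUnit
  change (A * Matrix.of M).map ((↑) : ℤ → ℚ) = _
  rw [h1, h2, Matrix.mul_smul, Matrix.mul_nonsing_inv _ h3]
  ext i j
  simp only [Matrix.map_apply, Matrix.smul_apply, Matrix.one_apply]
  split_ifs <;> simp

/-- The linear form whose coefficients are the entries of the `i`-th column of `B`. -/
def columnForm {n m : ℕ} (B : Matrix (Fin n) (Fin m) ℤ) (i : Fin m) : (Fin n → ℝ) →ₗ[ℝ] ℝ :=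
  ∑ r, (B r i : ℝ) • LinearMap.proj r

theorem columnForm_apply {n m : ℕ} (B : Matrix (Fin n) (Fin m) ℤ) (i : Fin m) (x : Fin n → ℝ) :
    columnForm B i x = ∑ r, (B r i : ℝ) * x r := by
  simp [columnForm]

/-- The points of the unit cube whose coordinates have a common denominator in `D(B)`. -/
def gridPoints {n m : ℕ} (B : Matrix (Fin n) (Fin m) ℤ) : Set (Fin n → ℝ) :=
  {p | p ∈ Set.Icc (0 : Fin n → ℝ) 1 ∧ ∃ d ∈ DSet B, ∀ i, ∃ z : ℤ, (d : ℝ) * p i = z}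

theorem finite_gridPoints {n m : ℕ} (B : Matrix (Fin n) (Fin m) ℤ) : (gridPoints B).Finite := by
  have hD : (DSet B).Finite :=
    (Set.finite_range fun c : Fin n → Fin m => matrixLevel (B.submatrix id c)).subset
      fun d ⟨c, _, _, hd⟩ => ⟨c, hd.symm⟩
  refine (hD.biUnion fun d _ => Set.Finite.pi' (ι := Fin n) fun _ =>
    ((Set.finite_Icc (0 : ℤ) d).image fun z : ℤ => (z : ℝ) / d)).subset ?_
  rintro p ⟨hp, d, hd, hz⟩
  refine Set.mem_biUnion hd fun i => ?_
  have hpos : 0 < d := by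
    obtain ⟨c, -, hdet, rfl⟩ := hd
    exact (matrixLevel_spec _ hdet).1
  have hpos' : (0 : ℝ) < d := by exact_mod_cast hpos
  obtain ⟨z, hz⟩ := hz i
  have h0 : 0 ≤ p i := hp.1 i
  have h1 : p i ≤ 1 := hp.2 i
  refine ⟨z, ⟨?_, ?_⟩, ?_⟩
  · have : (0 : ℝ) ≤ z := by rw [← hz]; positivity
    exact_mod_cast this
  · have : (z : ℝ) ≤ (d : ℤ) := by rw [← hz]; push_cast; nlinarith
    exact_mod_cast this
  · simp only
    rw [← hz]
    field_simp

theorem integral_of_matrixLevel {n : ℕ} (A : Matrix (Fin n) (Fin n) ℤ) (hA : A.det ≠ 0)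
    (p : Fin n → ℝ) (hp : ∀ k, ∃ z : ℤ, ∑ r, (A r k : ℝ) * p r = z) (i : Fin n) :
    ∃ z : ℤ, (matrixLevel A : ℝ) * p i = z := by
  obtain ⟨-, M, hM⟩ := matrixLevel_spec A hA
  choose z hz using hp
  refine ⟨∑ k, z k * M k i, ?_⟩
  push_cast
  simp_rw [← hz, Finset.sum_mul]
  rw [Finset.sum_comm]
  have h (r : Fin n) : ∑ k, (A r k : ℝ) * p r * M k i
      = (if r = i then (matrixLevel A : ℝ) else 0) * p r := by
    have := congrFun₂ hM r i
    rw [Matrix.mul_apply, Matrix.smul_apply, Matrix.one_apply] at this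
    have h' : ∑ k, (A r k : ℝ) * M k i = if r = i then (matrixLevel A : ℝ) else 0 := by
      have := congrArg (Int.cast : ℤ → ℝ) this
      push_cast at this
      rw [this]
      split_ifs <;> simp
    rw [← h', Finset.sum_mul]
    exact Finset.sum_congr rfl fun k _ => by ring
  simp [h]

/-- At an extreme point of a cell of the arrangement, the columns whose forms take integer values
span the whole space. -/
theorem span_integral_columns_eq_top {n m : ℕ} (B : Matrix (Fin n) (Fin m) ℤ) (N : Fin m → ℤ)
    {p : Fin n → ℝ}
    (hp : p ∈ Set.extremePoints ℝ
      {x | ∀ i, (N i : ℝ) ≤ columnForm B i x ∧ columnForm B i x ≤ N i + 1}) :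
    Submodule.span ℝ (Set.range fun (i : {i // ∃ z : ℤ, columnForm B i p = z}) (r : Fin n) =>
      (B r i : ℝ)) = ⊤ := by
  by_contra hne
  obtain ⟨f, hf0, hf⟩ := Submodule.exists_le_ker_of_lt_top _ (lt_top_iff_ne_top.2 hne)
  let u : Fin n → ℝ := fun r => f (Pi.single r 1)
  have hfu (y : Fin n → ℝ) : f y = ∑ r, y r * u r := by
    conv_lhs => rw [pi_eq_sum_univ' y]
    rw [map_sum]
    exact Finset.sum_congr rfl fun r _ => by rw [map_smul, smul_eq_mul]
  have hu0 : u ≠ 0 := by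
    intro hu
    apply hf0
    refine LinearMap.ext fun y => ?_
    rw [hfu, hu]
    simp
  have hlu (i : Fin m) (hi : ∃ z : ℤ, columnForm B i p = z) : columnForm B i u = 0 := by
    rw [columnForm_apply, ← hfu fun r => (B r i : ℝ)]
    exact hf (Submodule.subset_span ⟨⟨i, hi⟩, rfl⟩)
  rw [mem_extremePoints] at hp
  obtain ⟨hpP, hext⟩ := hp
  have hev : ∀ᶠ ε : ℝ in nhds 0, ∀ i, (N i : ℝ) ≤ columnForm B i (p + ε • u) ∧
      columnForm B i (p + ε • u) ≤ N i + 1 := by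
    rw [Filter.eventually_all]
    intro i
    by_cases hi : ∃ z : ℤ, columnForm B i p = z
    · refine Filter.Eventually.of_forall fun ε => ?_
      rw [map_add, map_smul, hlu i hi, smul_zero, add_zero]
      exact hpP i
    · have hcont : Filter.Tendsto (fun ε : ℝ => columnForm B i (p + ε • u)) (nhds 0)
          (nhds (columnForm B i p)) := by
        have : Continuous fun ε : ℝ => columnForm B i p + ε * columnForm B i u := by fun_prop
        simpa using this.tendsto 0
      have h1 : (N i : ℝ) < columnForm B i p :=
        (hpP i).1.lt_of_ne fun h => hi ⟨N i, h.symm⟩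
      have h2 : columnForm B i p < N i + 1 :=
        (hpP i).2.lt_of_ne fun h => hi ⟨N i + 1, by rw [h]; push_cast; rfl⟩
      filter_upwards [hcont.eventually_const_lt h1, hcont.eventually_lt_const h2]
        with ε h3 h4 using ⟨h3.le, h4.le⟩
  have hev' := (show Filter.Tendsto (fun ε : ℝ => -ε) (nhds 0) (nhds 0) by
    simpa using (continuous_neg (G := ℝ)).tendsto 0).eventually hev
  obtain ⟨ε, ⟨h1, h2⟩, hε⟩ := (((hev.and hev').filter_mono nhdsWithin_le_nhds).and
    (self_mem_nhdsWithin (s := Set.Ioi (0 : ℝ)))).exists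
  have := (hext _ h1 _ h2 ⟨1 / 2, 1 / 2, by norm_num, by norm_num, by norm_num, by
    ext r; simp; ring⟩).1
  rw [add_eq_left, smul_eq_zero] at this
  exact this.elim (ne_of_gt hε) hu0

theorem exists_columns_of_span_eq_top {n m : ℕ} (B : Matrix (Fin n) (Fin m) ℤ)
    (I : Fin m → Prop)
    (hI : Submodule.span ℝ (Set.range fun (i : {i // I i}) (r : Fin n) => (B r i : ℝ)) = ⊤) :
    ∃ c : Fin n → Fin m, StrictMono c ∧ (B.submatrix id c).det ≠ 0 ∧ ∀ k, I (c k) := by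
  classical
  obtain ⟨κ, a, ha, hspan, hli⟩ := exists_linearIndependent' ℝ
    fun (i : {i // I i}) (r : Fin n) => (B r i : ℝ)
  have : Finite κ := Finite.of_injective a ha
  let _ := Fintype.ofFinite κ
  have hcard : Fintype.card κ = n := by
    rw [← finrank_span_eq_card hli, hspan, hI, finrank_top, Module.finrank_fin_fun]
  let J : Finset (Fin m) := Finset.univ.image fun k => (a k : Fin m)
  have hJ : J.card = n := by
    rw [← hcard, ← Finset.card_univ]
    exact Finset.card_image_of_injective _ (Subtype.val_injective.comp ha)
  have hmem : ∀ k, ∃ q : κ, (a q : Fin m) = J.orderEmbOfFin hJ k := fun k => by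
    obtain ⟨q, -, hq⟩ := Finset.mem_image.1 (J.orderEmbOfFin_mem hJ k)
    exact ⟨q, hq⟩
  choose e he using hmem
  refine ⟨J.orderEmbOfFin hJ, (J.orderEmbOfFin hJ).strictMono, ?_, fun k => ?_⟩
  · have hinj : Function.Injective e := fun k k' h => by
      apply (J.orderEmbOfFin hJ).injective
      rw [← he, ← he, h]
    have hcols : LinearIndependent ℝ
        ((B.submatrix id (J.orderEmbOfFin hJ)).map (Int.castRingHom ℝ)).col := by
      have hcol : ((B.submatrix id (J.orderEmbOfFin hJ)).map (Int.castRingHom ℝ)).col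
          = ((fun (i : {i // I i}) (r : Fin n) => (B r i : ℝ)) ∘ a) ∘ e := by
        ext k r
        simp [Matrix.col, he]
      rw [hcol]
      exact hli.comp e hinj
    rw [Matrix.linearIndependent_cols_iff_isUnit, Matrix.isUnit_iff_isUnit_det] at hcols
    intro h0
    have h1 := hcols.ne_zero
    rw [← RingHom.mapMatrix_apply, ← RingHom.map_det, h0, map_zero] at h1
    exact h1 rfl
  · rw [← he]
    exact (a (e k)).2

theorem exists_compatible_of_mem_interior_cube {n m : ℕ} (B : Matrix (Fin n) (Fin m) ℤ)
    (hB : ∃ c : Fin n → Fin m, StrictMono c ∧ B.submatrix id c = 1) {x : Fin n → ℝ}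
    (hx : x ∈ interior (Set.Icc (0 : Fin n → ℝ) 1)) :
    ∃ P ⊆ (finite_gridPoints B).toFinset, IsCompatible (columnForm B) P ∧
      x ∈ convexHull ℝ (P : Set (Fin n → ℝ)) := by
  obtain ⟨c, -, hc⟩ := hB
  have hcoord (r : Fin n) (y : Fin n → ℝ) : columnForm B (c r) y = y r := by
    have h (s : Fin n) : B s (c r) = if s = r then 1 else 0 := by
      rw [← Matrix.one_apply, ← hc]; rfl
    simp [columnForm_apply, h]
  rw [← Set.pi_univ_Icc, interior_pi_set Set.finite_univ] at hx
  simp only [interior_Icc, Set.mem_pi, Set.mem_univ, true_imp_iff, Set.mem_Ioo, Pi.zero_apply,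
    Pi.one_apply] at hx
  let N : Fin m → ℤ := fun i => ⌊columnForm B i x⌋
  have hN (r : Fin n) : N (c r) = 0 := by
    simp only [N, hcoord]
    exact Int.floor_eq_zero_iff.2 ⟨(hx r).1.le, (hx r).2⟩
  let P : Set (Fin n → ℝ) :=
    {y | ∀ i, (N i : ℝ) ≤ columnForm B i y ∧ columnForm B i y ≤ N i + 1}
  have hPcube : P ⊆ Set.Icc 0 1 := by
    intro y hy
    constructor <;> intro r
    · simpa [hN, hcoord] using (hy (c r)).1
    · simpa [hN, hcoord] using (hy (c r)).2
  have hcont (i : Fin m) : Continuous (columnForm B i) :=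
    (columnForm B i).continuous_of_finiteDimensional
  have hPeq : P = ⋂ i, columnForm B i ⁻¹' Set.Icc (N i : ℝ) (N i + 1) := by
    ext y; simp [P]
  have hPcomp : IsCompact P := by
    refine isCompact_Icc.of_isClosed_subset ?_ hPcube
    rw [hPeq]
    exact isClosed_iInter fun i => isClosed_Icc.preimage (hcont i)
  have hPconv : Convex ℝ P := by
    rw [hPeq]
    exact convex_iInter fun i => (convex_Icc _ _).linear_preimage _
  have hext : Set.extremePoints ℝ P ⊆ gridPoints B := by
    intro p hp
    obtain ⟨c', hc', hdet, hz⟩ := exists_columns_of_span_eq_top B _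
      (span_integral_columns_eq_top B N hp)
    refine ⟨hPcube (extremePoints_subset hp), _, ⟨c', hc', hdet, rfl⟩,
      integral_of_matrixLevel _ hdet p fun k => ?_⟩
    simpa [columnForm_apply] using hz k
  have hfin : (Set.extremePoints ℝ P).Finite := (finite_gridPoints B).subset hext
  refine ⟨hfin.toFinset, Set.Finite.toFinset_subset_toFinset.2 hext,
    fun i => ⟨N i, fun t ht => ?_⟩, ?_⟩
  · exact extremePoints_subset (hfin.mem_toFinset.1 ht) i
  · rw [hfin.coe_toFinset, ← (hfin.isClosed_convexHull ℝ).closure_eq,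
      closure_convexHull_extremePoints hPcomp hPconv]
    exact fun i => ⟨Int.floor_le _, (Int.lt_floor_add_one _).le⟩

/-- If the `n×m` integer matrix `B` contains `I_n` as a column-submatrix, then
the unit cube `[0,1]ⁿ` can be triangulated into simplices `V₁,…,V_M` with pairwise disjoint
interiors so that (1) every vertex coordinate is a rational `q` with `d·q ∈ ℤ` for some
`d ∈ D(B)`, and (2) on each `V_j` every linear form `l_i` given by a column of `B` lies between
two consecutive integers. -/
theorem stmt_18 (n m : ℕ) (hn : 1 ≤ n) (hm : n < m)
    (B : Matrix (Fin n) (Fin m) ℤ)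
    (hB : ∃ c : Fin n → Fin m, StrictMono c ∧ B.submatrix id c = 1) :
    ∃ (M : ℕ) (W : Fin M → Set (Fin n → ℝ)) (vert : Fin M → Fin (n + 1) → (Fin n → ℝ)),
      (∀ j, AffineIndependent ℝ (vert j)) ∧
      (∀ j, W j = convexHull ℝ (Set.range (vert j))) ∧
      (⋃ j, W j) = Set.Icc (0 : Fin n → ℝ) 1 ∧
      (∀ j j', j ≠ j' → interior (W j) ∩ interior (W j') = ∅) ∧
      (∀ j l i, ∃ q : ℚ, vert j l i = (q : ℝ) ∧ ∃ d ∈ DSet B, ∃ z : ℤ, (d : ℚ) * q = (z : ℚ)) ∧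
      (∀ j (i : Fin m), ∃ Nij : ℤ, ∀ x ∈ W j,
        (Nij : ℝ) ≤ ∑ r, (B r i : ℝ) * x r ∧ ∑ r, (B r i : ℝ) * x r ≤ (Nij : ℝ) + 1) := by
  have hne : (interior (Set.Icc (0 : Fin n → ℝ) 1)).Nonempty := by
    rw [← Set.pi_univ_Icc, interior_pi_set Set.finite_univ]
    exact ⟨fun _ => 1 / 2, fun i _ => by simp; norm_num⟩
  have hK : Set.Icc (0 : Fin n → ℝ) 1 ⊆ closure (interior (Set.Icc (0 : Fin n → ℝ) 1)) := by
    rw [(convex_Icc (𝕜 := ℝ) _ _).closure_interior_eq_closure_of_nonempty_interior hne]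
    exact subset_closure
  have hSK : ((finite_gridPoints B).toFinset : Set (Fin n → ℝ)) ⊆ Set.Icc 0 1 := by
    rw [Set.Finite.coe_toFinset]
    exact fun p hp => hp.1
  obtain ⟨G, hG, hdisj, hcover⟩ := exists_compatible_triangulation (columnForm B) _ hSK
    (convex_Icc _ _) hK fun x hx => exists_compatible_of_mem_interior_cube B hB hx
  let T : Fin G.card → Finset (Fin n → ℝ) := fun j => G.equivFin.symm j
  have hT (j) : T j ∈ G := (G.equivFin.symm j).2
  have hcard (j) : (T j).card = n + 1 := by
    rw [(hG _ (hT j)).2.1.2, Module.finrank_fin_fun]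
  let e (j : Fin G.card) : Fin (n + 1) ≃ T j := ((T j).equivFinOfCardEq (hcard j)).symm
  refine ⟨G.card, fun j => convexHull ℝ (T j), fun j l => e j l, fun j => ?_, fun j => ?_, ?_,
    fun j j' hj => ?_, fun j l i => ?_, fun j i => ?_⟩
  · exact (hG _ (hT j)).2.1.1.comp_embedding (e j).toEmbedding
  · refine congrArg _ (Set.ext fun x => ?_)
    exact ⟨fun hx => ⟨(e j).symm ⟨x, hx⟩, by simp⟩, fun ⟨l, hl⟩ => hl ▸ (e j l).2⟩
  · rw [← hcover]
    ext x
    simp only [Set.mem_iUnion]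
    refine ⟨fun ⟨j, hj⟩ => ⟨T j, hT j, hj⟩, fun ⟨U, hU, hx⟩ => ⟨G.equivFin ⟨U, hU⟩, ?_⟩⟩
    simpa [T] using hx
  · refine hdisj _ (hT j) _ (hT j') fun h => hj ?_
    exact G.equivFin.symm.injective (Subtype.ext h)
  · obtain ⟨-, d, hd, hz⟩ := (finite_gridPoints B).mem_toFinset.1 ((hG _ (hT j)).1 (e j l).2)
    have hpos : (d : ℝ) ≠ 0 := by
      obtain ⟨c, -, hdet, rfl⟩ := hd
      exact_mod_cast (matrixLevel_spec _ hdet).1.ne'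
    have hpos' : (d : ℚ) ≠ 0 := by exact_mod_cast hpos
    obtain ⟨z, hz⟩ := hz i
    refine ⟨z / d, ?_, d, hd, z, by field_simp⟩
    push_cast
    rw [← hz]
    field_simp
  · obtain ⟨N, hN⟩ := (hG _ (hT j)).2.2 i
    refine ⟨N, fun x hx => ?_⟩
    rw [← columnForm_apply]
    have hsub : convexHull ℝ (T j : Set (Fin n → ℝ))
        ⊆ columnForm B i ⁻¹' Set.Icc (N : ℝ) (N + 1) :=
      convexHull_min (fun t ht => hN t ht) ((convex_Icc _ _).linear_preimage _)
    exact hsub hx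
end

section
/- Let Φ be a finite, reduced, irreducible, crystallographic root system spanning a finite-dimensional real vector space V, with a fixed base (set of simple roots) Δ = {α₁,…,α_n}, so that every root α ∈ Φ is uniquely α = Σ_{i=1}^n a_i(α)·α_i with all a_i(α) ∈ ℤ. Let θ ∈ Φ be the highest root, i.e. a root satisfying a_i(α) ≤ a_i(θ) for every α ∈ Φ and every i. Let L = span_ℤ(Φ) ⊆ V be the root lattice, let ℋ(Φ) = { a_i(θ) : 1 ≤ i ≤ n } ⊆ ℕ be the set of coefficients of the highest root, and let ℰ(Φ) = { exponent of the additive abelian group L / span_ℤ(S) : S ⊆ Φ with span_ℝ(S) = V } ⊆ ℕ, where the exponent of a finite abelian group is the smallest positive integer annihilating it. Then ℰ(Φ) = ℋ(Φ) ∪ {1}. -/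
open RealInnerProductSpace

/-- The additive subgroup `ℤ ⊆ ℝ`. -/
abbrev integralReals : AddSubgroup ℝ := (Int.castAddHom ℝ).range

lemma intCast_mem_integralReals (z : ℤ) : (z : ℝ) ∈ integralReals := ⟨z, rfl⟩

lemma natCast_mul_mem_integralReals {r : ℝ} (m : ℕ) (hr : r ∈ integralReals) :
    (m : ℝ) * r ∈ integralReals := by
  rw [← nsmul_eq_mul]
  exact nsmul_mem hr m

lemma intCast_mul_mem_integralReals {r : ℝ} (m : ℤ) (hr : r ∈ integralReals) :
    (m : ℝ) * r ∈ integralReals := by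
  rw [← zsmul_eq_mul]
  exact zsmul_mem hr m

/-- An element of finite order in an abelian group is detected, with its order, by a character. -/
lemma exists_character_addOrderOf_eq {G : Type*} [AddCommGroup G] (g : G) (hg : addOrderOf g ≠ 0) :
    ∃ χ : CharacterModule G, addOrderOf (χ g) = addOrderOf g := by
  obtain ⟨χ, hχ⟩ := CharacterModule.dual_surjective_of_injective _
    (Submodule.injective_subtype (Submodule.span ℤ {g})) (CharacterModule.ofSpanSingleton g)
  refine ⟨χ, ?_⟩
  have h1 : χ g = CharacterModule.ofSpanSingleton g ⟨g, Submodule.mem_span_singleton_self g⟩ := by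
    rw [← hχ]; rfl
  rw [h1]
  erw [CharacterModule.ofSpanSingleton, LinearMap.toAddMonoidHom_coe, LinearMap.comp_apply,
     CharacterModule.intSpanEquivQuotAddOrderOf_apply_self, Submodule.liftQSpanSingleton_apply,
    AddMonoidHom.coe_toIntLinearMap, CharacterModule.int.divByNat,
    LinearMap.toSpanSingleton_apply_one]
  rw [if_neg hg, ← one_div]
  exact AddCircle.addOrderOf_period_div (Nat.pos_of_ne_zero hg)

section RootSystem

variable {V : Type*} [NormedAddCommGroup V] [InnerProductSpace ℝ V]

/-- The reflection of `y` in the affine hyperplane `⟪·, β⟫ = k`. -/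
noncomputable def affineReflection (β : V) (k : ℤ) (y : V) : V :=
  y - ((⟪y, β⟫ - k) * (2 / ⟪β, β⟫)) • β

lemma inner_affineReflection (β γ y : V) (k : ℤ) :
    ⟪affineReflection β k y, γ⟫ =
      ⟪y, γ - (2 * ⟪γ, β⟫ / ⟪β, β⟫) • β⟫ + k * (2 * ⟪γ, β⟫ / ⟪β, β⟫) := by
  rw [affineReflection, inner_sub_left, inner_sub_right, real_inner_smul_left,
    real_inner_smul_right, real_inner_comm γ β]
  ring

/-- If `y` and `p` are strictly separated by a hyperplane, reflecting `y` brings it closer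
to `p`. -/
lemma norm_affineReflection_sub_lt {β : V} (hβ : β ≠ 0) (y p : V) (k : ℤ)
    (h : (⟪y, β⟫ - k) * (⟪p, β⟫ - k) < 0) :
    ‖affineReflection β k y - p‖ < ‖y - p‖ := by
  have hb : (0 : ℝ) < ⟪β, β⟫ := real_inner_self_pos.mpr hβ
  refine lt_of_pow_lt_pow_left₀ 2 (norm_nonneg _) ?_
  have key : ‖affineReflection β k y - p‖ ^ 2 =
      ‖y - p‖ ^ 2 + 4 / ⟪β, β⟫ * ((⟪y, β⟫ - k) * (⟪p, β⟫ - k)) := by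
    rw [affineReflection, sub_right_comm, norm_sub_sq_real, norm_smul, mul_pow, Real.norm_eq_abs,
      sq_abs, ← real_inner_self_eq_norm_sq β, real_inner_smul_right, inner_sub_left]
    field_simp
    ring
  rw [key]
  have : 0 < 4 / ⟪β, β⟫ := by positivity
  nlinarith

/-- The point `y` defines, by `β ↦ ⟪y, β⟫` modulo `ℤ`, a character of order `N` of the lattice
generated by `Φ`, and the elements of `Φ` it kills span the whole space. -/
structure IsRigidTorsionPoint (Φ : Set V) (N : ℕ) (y : V) : Prop where
  smul_mem : ∀ β ∈ Φ, (N : ℝ) * ⟪y, β⟫ ∈ integralReals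
  rigid : ∀ f : V →ₗ[ℝ] ℝ, (∀ β ∈ Φ, ⟪y, β⟫ ∈ integralReals → f β = 0) → f = 0
  dvd : ∀ m : ℕ, (∀ β ∈ Φ, (m : ℝ) * ⟪y, β⟫ ∈ integralReals) → N ∣ m

variable {Φ : Set V}

lemma IsRigidTorsionPoint.affineReflection {N : ℕ} {y : V} (hy : IsRigidTorsionPoint Φ N y)
    (h0 : (0 : V) ∉ Φ)
    (hrefl : ∀ α ∈ Φ, ∀ β ∈ Φ, β - (2 * ⟪β, α⟫ / ⟪α, α⟫) • α ∈ Φ)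
    (hcrys : ∀ α ∈ Φ, ∀ β ∈ Φ, ∃ z : ℤ, 2 * ⟪β, α⟫ / ⟪α, α⟫ = (z : ℝ))
    {β : V} (hβ : β ∈ Φ) (k : ℤ) :
    IsRigidTorsionPoint Φ N (affineReflection β k y) := by
  have hb : (⟪β, β⟫ : ℝ) ≠ 0 := by
    rw [Ne, inner_self_eq_zero]
    rintro rfl
    exact h0 hβ
  have hk : ∀ γ ∈ Φ, (k : ℝ) * (2 * ⟪γ, β⟫ / ⟪β, β⟫) ∈ integralReals := by
    intro γ hγ
    obtain ⟨z, hz⟩ := hcrys β hβ γ hγ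
    rw [hz]
    exact intCast_mul_mem_integralReals k (intCast_mem_integralReals z)
  have hss : ∀ γ : V, (γ - (2 * ⟪γ, β⟫ / ⟪β, β⟫) • β) -
      (2 * ⟪γ - (2 * ⟪γ, β⟫ / ⟪β, β⟫) • β, β⟫ / ⟪β, β⟫) • β = γ := by
    intro γ
    rw [inner_sub_left, real_inner_smul_left, sub_sub, ← add_smul]
    have : 2 * ⟪γ, β⟫ / ⟪β, β⟫ +
        2 * (⟪γ, β⟫ - 2 * ⟪γ, β⟫ / ⟪β, β⟫ * ⟪β, β⟫) / ⟪β, β⟫ = 0 := by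
      field_simp
      ring
    rw [this, zero_smul, sub_zero]
  refine ⟨fun γ hγ => ?_, fun f hf => ?_, fun m hm => hy.dvd m fun γ hγ => ?_⟩
  · rw [inner_affineReflection, mul_add]
    exact add_mem (hy.smul_mem _ (hrefl β hβ γ hγ)) (natCast_mul_mem_integralReals N (hk γ hγ))
  · have hf' := hy.rigid (f - (2 * f β / ⟪β, β⟫) • innerₗ V β) fun γ hγ hyγ => by
      have := hf _ (hrefl β hβ γ hγ) (by
        rw [inner_affineReflection, hss]
        exact add_mem hyγ (hk _ (hrefl β hβ γ hγ)))
      rw [map_sub, map_smul, smul_eq_mul] at this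
      simp only [LinearMap.sub_apply, LinearMap.smul_apply, innerₗ_apply_apply, smul_eq_mul]
      rw [← this, real_inner_comm γ β]
      ring
    have h2 : ∀ v, f v = 2 * f β / ⟪β, β⟫ * ⟪β, v⟫ := by
      intro v
      have := LinearMap.congr_fun hf' v
      simp only [LinearMap.sub_apply, LinearMap.smul_apply, innerₗ_apply_apply, smul_eq_mul,
        LinearMap.zero_apply] at this
      linarith
    have h3 : f β = 0 := by
      have := h2 β
      rw [div_mul_cancel₀ _ hb] at this
      linarith
    ext v
    rw [h2 v, h3]
    simp
  · have h1 := hm _ (hrefl β hβ γ hγ)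
    rw [inner_affineReflection, hss, mul_add] at h1
    exact (AddSubgroup.add_mem_cancel_right _
      (natCast_mul_mem_integralReals m (hk _ (hrefl β hβ γ hγ)))).mp h1

variable {n : ℕ} {α : Fin n → V}

/-- Every system of values on a basis is realised by the inner product with some vector. -/
lemma exists_inner_basis_eq [FiniteDimensional ℝ V] (b : Module.Basis (Fin n) ℝ V) (r : Fin n → ℝ) :
    ∃ x : V, ∀ i, ⟪x, b i⟫ = r i := by
  refine ⟨(InnerProductSpace.toDual ℝ V).symm (LinearMap.toContinuousLinearMap (b.constr ℝ r)),
    fun i => ?_⟩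
  rw [InnerProductSpace.toDual_symm_apply]
  simp

/-- A nonempty set of points with values in `ℤ / N` on a basis contains a point
closest to a given one. -/
lemma exists_forall_norm_sub_le (b : Module.Basis (Fin n) ℝ V) {N : ℕ} (hN : 0 < N)
    (Y : Set V) (hY : ∀ y ∈ Y, ∀ i, (N : ℝ) * ⟪y, b i⟫ ∈ integralReals) (hne : Y.Nonempty) (p : V) :
    ∃ y ∈ Y, ∀ z ∈ Y, ‖y - p‖ ≤ ‖z - p‖ := by
  obtain ⟨y₀, hy₀⟩ := hne
  set F : Set V := {y | y ∈ Y ∧ ‖y - p‖ ≤ ‖y₀ - p‖}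
  have hF : F.Finite := by
    let g : V → Fin n → ℤ := fun y i => ⌊(N : ℝ) * ⟪y, b i⟫⌋
    have hg : ∀ y ∈ Y, ∀ i, ((g y i : ℤ) : ℝ) = N * ⟪y, b i⟫ := by
      intro y hy i
      obtain ⟨z, hz⟩ := hY y hy i
      have hz' : (N : ℝ) * ⟪y, b i⟫ = (z : ℝ) := hz.symm
      simp only [g, hz', Int.floor_intCast]
    let R : Fin n → ℤ := fun i => ⌈(N : ℝ) * ((‖y₀ - p‖ + ‖p‖) * ‖b i‖)⌉
    refine Set.Finite.of_finite_image (f := g) ((Set.finite_Icc (-R) R).subset ?_) ?_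
    · rintro _ ⟨y, ⟨hy, hyp⟩, rfl⟩
      have hb : ∀ i, |(N : ℝ) * ⟪y, b i⟫| ≤ R i := by
        intro i
        refine le_trans ?_ (Int.le_ceil _)
        rw [abs_mul, Nat.abs_cast]
        have h1 : ‖y‖ ≤ ‖y₀ - p‖ + ‖p‖ := by
          have := norm_add_le (y - p) p
          rw [sub_add_cancel] at this
          linarith
        gcongr
        exact (abs_real_inner_le_norm _ _).trans (by gcongr)
      constructor
      · intro i
        have := (abs_le.mp (hb i)).1
        rw [← hg y hy i] at this
        exact_mod_cast this
      · intro i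
        have := (abs_le.mp (hb i)).2
        rw [← hg y hy i] at this
        exact_mod_cast this
    · intro y hy z hz hyz
      refine InnerProductSpace.ext_inner_right_basis b fun i => ?_
      have h1 := hg y hy.1 i
      rw [hyz, hg z hz.1 i] at h1
      exact (mul_left_cancel₀ (by positivity) h1).symm
  obtain ⟨y, hy, hmin⟩ := Set.exists_min_image F (fun y => ‖y - p‖) hF ⟨y₀, hy₀, le_rfl⟩
  refine ⟨y, hy.1, fun z hz => ?_⟩
  rcases le_total ‖z - p‖ ‖y₀ - p‖ with h | h
  · exact hmin z ⟨hz, h⟩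
  · exact hy.2.trans h

/-- The exponent `N` of the quotient of the lattice of `Φ` by the sublattice of a spanning subset
is the order of a character of this quotient. -/
lemma exists_isRigidTorsionPoint [FiniteDimensional ℝ V] (b : Module.Basis (Fin n) ℝ V)
    (hbΦ : ∀ i, b i ∈ Φ) (c : V → Fin n → ℤ) (hc : ∀ β ∈ Φ, β = ∑ i, c β i • b i)
    {S : Set V} (hSΦ : S ⊆ Φ) (hS : Submodule.span ℝ S = ⊤) {N : ℕ}
    (hN : IsLeast {N' : ℕ | 0 < N' ∧
      ∀ x ∈ Submodule.span ℤ Φ, (N' : ℤ) • x ∈ Submodule.span ℤ S} N) :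
    ∃ y : V, IsRigidTorsionPoint Φ N y := by
  let L : Submodule ℤ V := Submodule.span ℤ Φ
  let M : Submodule ℤ L := (Submodule.span ℤ S).comap L.subtype
  have hLb : L = Submodule.span ℤ (Set.range b) := by
    apply le_antisymm
    · refine Submodule.span_le.mpr fun β hβ => ?_
      rw [hc β hβ]
      exact sum_mem fun i _ => Submodule.smul_mem _ _ (Submodule.subset_span ⟨i, rfl⟩)
    · refine Submodule.span_mono ?_
      rintro _ ⟨i, rfl⟩
      exact hbΦ i
  have hann : ∀ k : ℕ, (∀ g : L ⧸ M, k • g = 0) ↔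
      ∀ x ∈ Submodule.span ℤ Φ, (k : ℤ) • x ∈ Submodule.span ℤ S := by
    intro k
    constructor
    · intro h x hx
      have := h (M.mkQ ⟨x, hx⟩)
      rw [← map_nsmul, ← LinearMap.mem_ker, Submodule.ker_mkQ] at this
      rw [natCast_zsmul]
      exact this
    · intro h g
      obtain ⟨⟨x, hx⟩, rfl⟩ := M.mkQ_surjective g
      rw [← map_nsmul, ← LinearMap.mem_ker, Submodule.ker_mkQ]
      have := h x hx
      rw [natCast_zsmul] at this
      exact this
  have hexp : AddMonoid.exponent (L ⧸ M) = N := by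
    have hdvd : AddMonoid.exponent (L ⧸ M) ∣ N :=
      AddMonoid.exponent_dvd_iff_forall_nsmul_eq_zero.mpr ((hann N).mpr hN.1.2)
    have hpos : 0 < AddMonoid.exponent (L ⧸ M) := Nat.pos_of_dvd_of_pos hdvd hN.1.1
    exact le_antisymm (Nat.le_of_dvd hN.1.1 hdvd)
      (hN.2 ⟨hpos, (hann _).mp AddMonoid.exponent_nsmul_eq_zero⟩)
  obtain ⟨g, hg⟩ := AddMonoid.exists_addOrderOf_eq_exponent
    (AddMonoid.exponent_ne_zero.mp (hexp ▸ hN.1.1.ne'))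
  rw [hexp] at hg
  obtain ⟨χ, hχ⟩ := exists_character_addOrderOf_eq g (hg ▸ hN.1.1.ne')
  rw [hg] at hχ
  let ψ : L →+ AddCircle (1 : ℚ) := AddMonoidHom.comp χ M.mkQ.toAddMonoidHom
  choose r hr using fun i : Fin n =>
    QuotientAddGroup.mk_surjective (ψ ⟨b i, Submodule.subset_span (hbΦ i)⟩)
  obtain ⟨y, hy⟩ := exists_inner_basis_eq b (fun i => (r i : ℝ))
  have key : ∀ v ∈ Submodule.span ℤ (Set.range b), ∀ hv : v ∈ L,
      ∃ q : ℚ, ⟪y, v⟫ = q ∧ ψ ⟨v, hv⟩ = (q : AddCircle (1 : ℚ)) := by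
    intro v hv
    induction hv using Submodule.span_induction with
    | mem x hx =>
      obtain ⟨i, rfl⟩ := hx
      exact fun _ => ⟨r i, hy i, (hr i).symm⟩
    | zero => exact fun _ => ⟨0, by simp, map_zero ψ⟩
    | add u w hu hw ihu ihw =>
      intro _
      obtain ⟨p, hp, hp'⟩ := ihu (hLb ▸ hu)
      obtain ⟨q, hq, hq'⟩ := ihw (hLb ▸ hw)
      refine ⟨p + q, by rw [inner_add_right, hp, hq]; push_cast; rfl, ?_⟩
      rw [AddCircle.coe_add, ← hp', ← hq', ← map_add]
      rfl
    | smul k u hu ihu =>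
      intro _
      obtain ⟨p, hp, hp'⟩ := ihu (hLb ▸ hu)
      refine ⟨k • p, ?_, ?_⟩
      · rw [← Int.cast_smul_eq_zsmul ℝ, real_inner_smul_right, hp]
        simp
      · rw [AddCircle.coe_zsmul, ← hp', ← map_zsmul]
        rfl
  have hint : ∀ v (hv : v ∈ L), ⟪y, v⟫ ∈ integralReals ↔ ψ ⟨v, hv⟩ = 0 := by
    intro v hv
    obtain ⟨q, hq, hq'⟩ := key v (hLb ▸ hv) hv
    rw [hq, hq', AddCircle.coe_eq_zero_iff]
    refine exists_congr fun z => ?_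
    simp only [Int.coe_castAddHom, zsmul_eq_mul, mul_one]
    exact_mod_cast Iff.rfl
  have hmul : ∀ (m : ℕ) (v : V), (m : ℝ) * ⟪y, v⟫ = ⟪y, m • v⟫ := by
    intro m v
    rw [← Nat.cast_smul_eq_nsmul ℝ, real_inner_smul_right]
  refine ⟨y, fun β hβ => ?_, fun f hf => ?_, fun m hm => ?_⟩
  · have hβL : β ∈ L := Submodule.subset_span hβ
    rw [hmul, hint _ (nsmul_mem hβL N)]
    have h1 : (N • M.mkQ ⟨β, hβL⟩ : L ⧸ M) = 0 := (hann N).mpr hN.1.2 _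
    change χ (M.mkQ (N • ⟨β, hβL⟩)) = 0
    rw [map_nsmul, h1, map_zero]
  · refine LinearMap.ext_on hS fun s hs => ?_
    have hsL : s ∈ L := Submodule.subset_span (hSΦ hs)
    refine hf s (hSΦ hs) ((hint s hsL).mpr ?_)
    have h1 : M.mkQ ⟨s, hsL⟩ = 0 := by
      rw [← LinearMap.mem_ker, Submodule.ker_mkQ]
      exact Submodule.subset_span hs
    change χ (M.mkQ ⟨s, hsL⟩) = 0
    rw [h1, map_zero]
  · rw [← hχ]
    apply addOrderOf_dvd_of_nsmul_eq_zero
    obtain ⟨⟨v, hv⟩, rfl⟩ := M.mkQ_surjective g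
    rw [← map_nsmul, ← map_nsmul]
    refine (hint (m • v) (nsmul_mem hv m)).mp ?_
    rw [← hmul]
    clear hg hχ
    induction hv using Submodule.span_induction with
    | mem x hx => exact hm x hx
    | zero => simp
    | add u w _ _ hu hw =>
      rw [inner_add_right, mul_add]
      exact add_mem hu hw
    | smul k u _ hu =>
      rw [← Int.cast_smul_eq_zsmul ℝ, real_inner_smul_right, mul_left_comm]
      exact intCast_mul_mem_integralReals k hu

/-- A rigid torsion point of order `N` in the fundamental alcove is a vertex of the alcove, so `N`
is `1` or a coefficient of the highest root. -/
lemma IsRigidTorsionPoint.eq_one_or_exists {N : ℕ} {y : V} (hy : IsRigidTorsionPoint Φ N y)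
    (b : Module.Basis (Fin n) ℝ V) (hbΦ : ∀ i, b i ∈ Φ)
    (c : V → Fin n → ℤ) (hc : ∀ β ∈ Φ, β = ∑ i, c β i • b i)
    (hbase : ∀ β ∈ Φ, (∀ i, 0 ≤ c β i) ∨ (∀ i, c β i ≤ 0))
    (hneg : ∀ β ∈ Φ, -β ∈ Φ)
    {θ : V} (hθ : θ ∈ Φ) (hθpos : ∀ i, 0 < c θ i) (hhigh : ∀ β ∈ Φ, ∀ i, c β i ≤ c θ i)
    (hy0 : ∀ i, 0 ≤ ⟪y, b i⟫) (hy1 : ⟪y, θ⟫ ≤ 1) :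
    N = 1 ∨ ∃ i, c θ i = N := by
  have hcoord : ∀ β ∈ Φ, ∀ i, b.coord i β = c β i := by
    intro β hβ i
    conv_lhs => rw [hc β hβ]
    simp [Finsupp.single_apply]
  have hval : ∀ β ∈ Φ, ⟪y, β⟫ = ∑ i, (c β i : ℝ) * ⟪y, b i⟫ := by
    intro β hβ
    conv_lhs => rw [hc β hβ]
    simp_rw [inner_sum, ← Int.cast_smul_eq_zsmul ℝ, real_inner_smul_right]
  have hle : ∀ β ∈ Φ, ⟪y, β⟫ ≤ ⟪y, θ⟫ := by
    intro β hβ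
    rw [hval β hβ, hval θ hθ]
    exact Finset.sum_le_sum fun i _ =>
      mul_le_mul_of_nonneg_right (by exact_mod_cast hhigh β hβ i) (hy0 i)
  have hzero : ∀ β ∈ Φ, ⟪y, β⟫ = 0 → ∀ i, ⟪y, b i⟫ ≠ 0 → c β i = 0 := by
    intro β hβ h i hi
    rw [hval β hβ] at h
    have : (c β i : ℝ) * ⟪y, b i⟫ = 0 := by
      rcases hbase β hβ with hp | hp
      · exact (Finset.sum_eq_zero_iff_of_nonneg fun j _ =>
          mul_nonneg (by exact_mod_cast hp j) (hy0 j)).mp h i (Finset.mem_univ i)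
      · exact (Finset.sum_eq_zero_iff_of_nonpos fun j _ =>
          mul_nonpos_of_nonpos_of_nonneg (by exact_mod_cast hp j) (hy0 j)).mp h i
            (Finset.mem_univ i)
    exact_mod_cast (mul_eq_zero.mp this).resolve_right hi
  have hone : ∀ β ∈ Φ, ⟪y, β⟫ = 1 → ⟪y, θ⟫ = 1 ∧ ∀ i, ⟪y, b i⟫ ≠ 0 → c β i = c θ i := by
    intro β hβ h
    have hθ1 : ⟪y, θ⟫ = 1 := le_antisymm hy1 (h ▸ hle β hβ)
    refine ⟨hθ1, fun i hi => ?_⟩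
    have h2 : ∑ i, ((c θ i : ℝ) - c β i) * ⟪y, b i⟫ = 0 := by
      simp_rw [sub_mul, Finset.sum_sub_distrib]
      rw [← hval β hβ, ← hval θ hθ, h, hθ1, sub_self]
    have h3 := (Finset.sum_eq_zero_iff_of_nonneg fun j _ =>
      mul_nonneg (sub_nonneg.mpr (by exact_mod_cast hhigh β hβ j)) (hy0 j)).mp h2 i
        (Finset.mem_univ i)
    have h4 := (mul_eq_zero.mp h3).resolve_right hi
    exact_mod_cast (sub_eq_zero.mp h4).symm
  have hcases : ∀ β ∈ Φ, ⟪y, β⟫ ∈ integralReals → (∀ i, ⟪y, b i⟫ ≠ 0 → c β i = 0) ∨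
      ⟪y, θ⟫ = 1 ∧ ((∀ i, ⟪y, b i⟫ ≠ 0 → c β i = c θ i) ∨
        ∀ i, ⟪y, b i⟫ ≠ 0 → c β i = -c θ i) := by
    rintro β hβ ⟨z, hz⟩
    have hz' : (z : ℝ) = ⟪y, β⟫ := hz
    have hz1 : z ≤ 1 := by
      have : (z : ℝ) ≤ 1 := hz' ▸ (hle β hβ).trans hy1
      exact_mod_cast this
    have hz2 : -1 ≤ z := by
      have h := (hle _ (hneg β hβ)).trans hy1
      rw [inner_neg_right, ← hz'] at h
      have : (-1 : ℝ) ≤ z := by linarith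
      exact_mod_cast this
    obtain rfl | rfl | rfl : z = 0 ∨ z = 1 ∨ z = -1 := by omega
    · exact Or.inl (hzero β hβ (by simpa using hz'.symm))
    · obtain ⟨h1, h2⟩ := hone β hβ (by simpa using hz'.symm)
      exact Or.inr ⟨h1, Or.inl h2⟩
    · obtain ⟨h1, h2⟩ := hone (-β) (hneg β hβ) (by rw [inner_neg_right, ← hz']; simp)
      refine Or.inr ⟨h1, Or.inr fun i hi => ?_⟩
      have h3 : (c (-β) i : ℝ) = -c β i := by
        rw [← hcoord _ (hneg β hβ), ← hcoord β hβ, map_neg]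
      have h4 : c (-β) i = -c β i := by exact_mod_cast h3
      rw [← h2 i hi, h4, neg_neg]
  by_cases hall : ∀ i, ⟪y, b i⟫ = 0
  · left
    refine Nat.dvd_one.mp (hy.dvd 1 fun β hβ => ?_)
    rw [hval β hβ]
    simp only [hall, mul_zero, Finset.sum_const_zero]
    exact zero_mem _
  right
  push Not at hall
  obtain ⟨i, hi⟩ := hall
  refine ⟨i, ?_⟩
  have huniq : ∀ j, j ≠ i → ⟪y, b j⟫ = 0 := by
    intro j hji
    by_contra hj
    have hf := hy.rigid ((c θ j : ℝ) • b.coord i - (c θ i : ℝ) • b.coord j) fun β hβ hyβ => by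
      simp only [LinearMap.sub_apply, LinearMap.smul_apply, smul_eq_mul, hcoord β hβ]
      rcases hcases β hβ hyβ with h | ⟨-, h | h⟩ <;> rw [h i hi, h j hj] <;> push_cast <;> ring
    have h1 := LinearMap.congr_fun hf (b i)
    simp only [LinearMap.sub_apply, LinearMap.smul_apply, smul_eq_mul, Module.Basis.coord_apply,
      b.repr_self, Finsupp.single_eq_same, Finsupp.single_eq_of_ne hji, LinearMap.zero_apply] at h1
    have h2 : (0 : ℝ) < c θ j := by exact_mod_cast hθpos j
    linarith
  have hsum : ∀ β ∈ Φ, ⟪y, β⟫ = c β i * ⟪y, b i⟫ := by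
    intro β hβ
    rw [hval β hβ]
    exact Finset.sum_eq_single i (fun j _ hj => by rw [huniq j hj, mul_zero]) (by simp)
  have hθ1 : ⟪y, θ⟫ = 1 := by
    by_contra hne
    have hf := hy.rigid (b.coord i) fun β hβ hyβ => by
      rcases hcases β hβ hyβ with h | ⟨h, -⟩
      · rw [hcoord β hβ, h i hi, Int.cast_zero]
      · exact absurd h hne
    simpa using LinearMap.congr_fun hf (b i)
  rw [hsum θ hθ] at hθ1
  obtain ⟨h, hh⟩ := Int.eq_ofNat_of_zero_le (hθpos i).le
  rw [hh] at hθ1 ⊢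
  have h1 : N ∣ h := hy.dvd h fun β hβ => by
    rw [hsum β hβ, mul_left_comm, ← Int.cast_natCast, hθ1, mul_one]
    exact intCast_mem_integralReals _
  have h2 : (h : ℤ) ∣ N := by
    obtain ⟨z, hz⟩ := hy.smul_mem _ (hbΦ i)
    have hz' : (z : ℝ) = N * ⟪y, b i⟫ := hz
    refine ⟨z, ?_⟩
    have : (N : ℝ) = ((h : ℤ) : ℝ) * z := by
      rw [hz', mul_left_comm, hθ1, mul_one]
    exact_mod_cast this
  exact congrArg _ (Nat.dvd_antisymm (Int.natCast_dvd_natCast.mp h2) h1)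

/-- A nonzero coefficient of a root `θ` is the exponent of the quotient of the root lattice
obtained by replacing the corresponding simple root by `θ`. -/
lemma exists_isLeast_of_coeff (b : Module.Basis (Fin n) ℝ V) (hbΦ : ∀ i, b i ∈ Φ)
    (c : V → Fin n → ℤ) (hc : ∀ β ∈ Φ, β = ∑ i, c β i • b i) {θ : V} (hθ : θ ∈ Φ)
    {i : Fin n} {h : ℕ} (hpos : 0 < h) (hi : c θ i = h) :
    ∃ S : Set V, S ⊆ Φ ∧ Submodule.span ℝ S = ⊤ ∧
      IsLeast {N' : ℕ | 0 < N' ∧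
        ∀ x ∈ Submodule.span ℤ Φ, (N' : ℤ) • x ∈ Submodule.span ℤ S} h := by
  let S : Set V := insert θ (b '' {j | j ≠ i})
  have hbS : ∀ j, j ≠ i → b j ∈ S := fun j hj => Or.inr ⟨j, hj, rfl⟩
  have hθi : (h : ℤ) • b i = θ - ∑ j ∈ Finset.univ.erase i, c θ j • b j := by
    rw [eq_sub_iff_add_eq, ← hi, Finset.add_sum_erase _ (fun j => c θ j • b j) (Finset.mem_univ i),
      ← hc θ hθ]
  have hbi : (h : ℤ) • b i ∈ Submodule.span ℤ S := by
    rw [hθi]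
    exact sub_mem (Submodule.subset_span (Or.inl rfl)) (sum_mem fun j hj =>
      Submodule.smul_mem _ _ (Submodule.subset_span (hbS j (Finset.ne_of_mem_erase hj))))
  refine ⟨S, ?_, ?_, ⟨hpos, fun x hx => ?_⟩, ?_⟩
  · rintro _ (rfl | ⟨j, -, rfl⟩)
    exacts [hθ, hbΦ j]
  · rw [eq_top_iff, ← b.span_eq, Submodule.span_le]
    rintro _ ⟨j, rfl⟩
    by_cases hj : j = i
    · subst hj
      have h1 : (h : ℤ) • b j ∈ (Submodule.span ℝ S).restrictScalars ℤ :=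
        Submodule.span_subset_span ℤ ℝ S hbi
      rw [Submodule.restrictScalars_mem, ← Int.cast_smul_eq_zsmul ℝ] at h1
      refine (Submodule.smul_mem_iff _ ?_).mp h1
      exact_mod_cast hpos.ne'
    · exact Submodule.subset_span (hbS j hj)
  · induction hx using Submodule.span_induction with
    | mem β hβ =>
      rw [hc β hβ, Finset.smul_sum]
      refine sum_mem fun j _ => ?_
      rw [smul_comm]
      refine Submodule.smul_mem _ _ ?_
      by_cases hj : j = i
      · rwa [hj]
      · exact Submodule.smul_mem _ _ (Submodule.subset_span (hbS j hj))
    | zero => simp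
    | add u w _ _ hu hw => rw [smul_add]; exact add_mem hu hw
    | smul k u _ hu => rw [smul_comm]; exact Submodule.smul_mem _ _ hu
  · rintro N ⟨hN, hNS⟩
    have hdvd : ∀ v ∈ Submodule.span ℤ S, ∃ z : ℤ, b.repr v i = h * z := by
      intro v hv
      induction hv using Submodule.span_induction with
      | mem v hv =>
        obtain rfl | ⟨j, hj, rfl⟩ := hv
        · refine ⟨1, ?_⟩
          conv_lhs => rw [hc v hθ]
          simp [Finsupp.single_apply, hi]
        · exact ⟨0, by rw [b.repr_self, Finsupp.single_eq_of_ne hj.symm]; simp⟩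
      | zero => exact ⟨0, by simp⟩
      | add u w _ _ hu hw =>
        obtain ⟨p, hp⟩ := hu
        obtain ⟨q, hq⟩ := hw
        exact ⟨p + q, by rw [map_add, Finsupp.add_apply, hp, hq]; push_cast; ring⟩
      | smul k u _ hu =>
        obtain ⟨p, hp⟩ := hu
        refine ⟨k * p, ?_⟩
        rw [← Int.cast_smul_eq_zsmul ℝ, map_smul, Finsupp.smul_apply, hp, smul_eq_mul]
        push_cast
        ring
    obtain ⟨z, hz⟩ := hdvd _ (hNS _ (Submodule.subset_span (hbΦ i)))
    rw [← Int.cast_smul_eq_zsmul ℝ, map_smul, Finsupp.smul_apply, b.repr_self,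
      Finsupp.single_eq_same, smul_eq_mul, mul_one] at hz
    have hz' : (N : ℤ) = h * z := by exact_mod_cast hz
    exact Nat.le_of_dvd hN (Int.natCast_dvd_natCast.mp ⟨z, hz'⟩)

end RootSystem

/-- For a finite reduced irreducible crystallographic root system `Φ` with
base `α₁,…,α_n`, highest root `θ` and root lattice `L = span_ℤ Φ`: the set `ℰ(Φ)` of exponents
of the quotients `L / span_ℤ S` (over all `S ⊆ Φ` spanning `V` over `ℝ`) equals
`ℋ(Φ) ∪ {1}`, where `ℋ(Φ)` is the set of coefficients of the highest root. -/
theorem stmt_19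
    {V : Type*} [NormedAddCommGroup V] [InnerProductSpace ℝ V] [FiniteDimensional ℝ V]
    (Φ : Set V) (hfin : Φ.Finite) (h0 : (0 : V) ∉ Φ)
    (hspan : Submodule.span ℝ Φ = ⊤)
    (hrefl : ∀ α ∈ Φ, ∀ β ∈ Φ, β - (2 * ⟪β, α⟫ / ⟪α, α⟫) • α ∈ Φ)
    (hcrys : ∀ α ∈ Φ, ∀ β ∈ Φ, ∃ z : ℤ, 2 * ⟪β, α⟫ / ⟪α, α⟫ = (z : ℝ))
    (hred : ∀ α ∈ Φ, ∀ t : ℝ, t • α ∈ Φ → t = 1 ∨ t = -1)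
    (hirr : ∀ Φ₁ Φ₂ : Set V, Φ₁ ∪ Φ₂ = Φ → Φ₁.Nonempty → Φ₂.Nonempty →
      (∀ β₁ ∈ Φ₁, ∀ β₂ ∈ Φ₂, ⟪β₁, β₂⟫ = 0) → False)
    (n : ℕ) (hn : 1 ≤ n)
    (α : Fin n → V) (hαΦ : ∀ i, α i ∈ Φ)
    (hindep : LinearIndependent ℝ α)
    (hspanα : Submodule.span ℝ (Set.range α) = ⊤)
    -- the (unique) integer coordinates of each root with respect to the base:
    (c : V → Fin n → ℤ)
    (hc : ∀ β ∈ Φ, β = ∑ i, c β i • α i)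
    (hbase : ∀ β ∈ Φ, (∀ i, 0 ≤ c β i) ∨ (∀ i, c β i ≤ 0))
    -- the highest root:
    (θ : V) (hθ : θ ∈ Φ)
    (hhigh : ∀ β ∈ Φ, ∀ i, c β i ≤ c θ i) :
    {N : ℕ | ∃ S : Set V, S ⊆ Φ ∧ Submodule.span ℝ S = ⊤ ∧
        IsLeast {N' : ℕ | 0 < N' ∧
          ∀ x ∈ Submodule.span ℤ Φ, (N' : ℤ) • x ∈ Submodule.span ℤ S} N} =
      {h : ℕ | ∃ i, c θ i = (h : ℤ)} ∪ {1} := by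
  let b : Module.Basis (Fin n) ℝ V := Module.Basis.mk hindep hspanα.ge
  have hb : ⇑b = α := Module.Basis.coe_mk hindep hspanα.ge
  have hbα : ∀ i, b i = α i := fun i => congrFun hb i
  have hbΦ : ∀ i, b i ∈ Φ := fun i => hbα i ▸ hαΦ i
  have hcb : ∀ β ∈ Φ, β = ∑ i, c β i • b i := by
    rw [hb]
    exact hc
  have hneg : ∀ β ∈ Φ, -β ∈ Φ := by
    intro β hβ
    have hne : (⟪β, β⟫ : ℝ) ≠ 0 := by
      rw [Ne, inner_self_eq_zero]
      rintro rfl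
      exact h0 hβ
    have := hrefl β hβ β hβ
    rwa [mul_div_cancel_right₀ _ hne, two_smul, sub_add_cancel_left] at this
  have hθpos : ∀ i, 0 < c θ i := by
    intro i
    refine lt_of_lt_of_le ?_ (hhigh _ (hbΦ i) i)
    have h1 : b.repr (b i) i = c (b i) i := by
      conv_lhs => rw [hcb _ (hbΦ i)]
      simp [Finsupp.single_apply]
    rw [b.repr_self, Finsupp.single_eq_same] at h1
    have : (1 : ℤ) = c (b i) i := by exact_mod_cast h1
    omega
  ext N
  simp only [Set.mem_union, Set.mem_ofPred_eq, Set.mem_singleton_iff]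
  constructor
  · rintro ⟨S, hSΦ, hS, hN⟩
    let D : ℝ := 1 + ∑ i, (c θ i : ℝ)
    have hsum : (0 : ℝ) ≤ ∑ i, (c θ i : ℝ) :=
      Finset.sum_nonneg fun i _ => by exact_mod_cast (hθpos i).le
    have hD : 0 < D := by positivity
    obtain ⟨p, hp⟩ := exists_inner_basis_eq b fun _ => 1 / D
    have hpθ : ⟪p, θ⟫ < 1 := by
      rw [hcb θ hθ, inner_sum]
      simp_rw [← Int.cast_smul_eq_zsmul ℝ, real_inner_smul_right, hp]
      rw [← Finset.sum_mul, mul_one_div, div_lt_one hD]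
      exact lt_one_add _
    obtain ⟨y, hy, hmin⟩ := exists_forall_norm_sub_le b hN.1.1 {y | IsRigidTorsionPoint Φ N y}
      (fun y hy i => hy.smul_mem _ (hbΦ i)) (exists_isRigidTorsionPoint b hbΦ c hcb hSΦ hS hN) p
    have hsep : ∀ β ∈ Φ, ∀ k : ℤ, 0 ≤ (⟪y, β⟫ - k) * (⟪p, β⟫ - k) := by
      intro β hβ k
      by_contra! hlt
      exact (hmin _ (hy.affineReflection h0 hrefl hcrys hβ k)).not_gt
        (norm_affineReflection_sub_lt (fun h => h0 (h ▸ hβ)) y p k hlt)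
    refine (hy.eq_one_or_exists b hbΦ c hcb hbase hneg hθ hθpos hhigh (fun i => ?_) ?_).symm
    · have h1 := hsep _ (hbΦ i) 0
      rw [hp, Int.cast_zero, sub_zero, sub_zero] at h1
      exact nonneg_of_mul_nonneg_left h1 (by positivity)
    · have h1 := hsep θ hθ 1
      rw [Int.cast_one] at h1
      nlinarith
  · rintro (⟨i, hi⟩ | rfl)
    · have hpos : 0 < N := by
        have := hθpos i
        omega
      exact exists_isLeast_of_coeff b hbΦ c hcb hθ hpos hi
    · exact ⟨Φ, le_rfl, hspan, ⟨one_pos, fun x hx => Submodule.smul_mem _ _ hx⟩, fun k hk => hk.1⟩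
end
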